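/- Let ω₀ = dx₁∧dy₁ + dx₂∧dy₂ be the standard symplectic form on ℝ⁴ and let J be a smooth almost complex structure on ℝ⁴ adapted to ω₀. Then there is no nonempty compact closed J-holomorphic curve without boundary in ℝ⁴: there exists no nonempty compact subset C ⊆ ℝ⁴ such that every point of C has an open neighborhood V with C ∩ V equal to the image of an injective regular J-holomorphic disk. -/

import Mathlib

noncomputable section

open Set

abbrev E4 : Type := EuclideanSpace ℝ (Fin 4)
abbrev E2 : Type := ℝ × ℝ

/-- The standard complex structure `J₀` on `ℝ²`: `J₀(x,y) = (-y,x)`. -/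
def J0 : E2 →L[ℝ] E2 :=
  (-(ContinuousLinearMap.snd ℝ ℝ ℝ)).prod (ContinuousLinearMap.fst ℝ ℝ ℝ)

/-- A real-analytic almost complex structure on `ℝ⁴`. -/
def IsAlmostComplex (J : E4 → E4 →L[ℝ] E4) : Prop :=
  (∀ p, AnalyticAt ℝ J p) ∧ ∀ p, (J p).comp (J p) = - ContinuousLinearMap.id ℝ E4

/-- A `J`-holomorphic disk: a smooth map on an open neighborhood `V` of `0` in `ℝ²`
satisfying `du ∘ J₀ = J(u) ∘ du` on `V`. -/
def IsJHolDisk (J : E4 → E4 →L[ℝ] E4) (V : Set E2) (u : E2 → E4) : Prop :=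
  IsOpen V ∧ (0 : E2) ∈ V ∧ ContDiffOn ℝ (⊤ : ℕ∞) u V ∧
    ∀ z ∈ V, (fderiv ℝ u z).comp J0 = (J (u z)).comp (fderiv ℝ u z)

/-- `u` is regular on `V` if its differential does not vanish on `V`. -/
def IsRegularOn (u : E2 → E4) (V : Set E2) : Prop := ∀ z ∈ V, fderiv ℝ u z ≠ 0

/-- `f` vanishes to order at least `k` at `0`: all derivatives of order `< k` vanish at `0`. -/
def VanishesToOrder (f : E2 → ℝ) (k : ℕ) : Prop :=
  ∀ i < k, iteratedFDeriv ℝ i f 0 = 0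

/-- The standard symplectic form `ω₀ = dx₁∧dy₁ + dx₂∧dy₂` on `ℝ⁴`, with coordinates
`(x₁, y₁, x₂, y₂)`. -/
def omega0 (v w : E4) : ℝ := v 0 * w 1 - v 1 * w 0 + v 2 * w 3 - v 3 * w 2

/-- `J` is adapted to `ω₀`: `ω₀` is `J`-invariant and `ω₀(·, J·)` is positive. -/
def IsAdapted (J : E4 → E4 →L[ℝ] E4) : Prop :=
  (∀ p v w, omega0 (J p v) (J p w) = omega0 v w) ∧
    ∀ p v, v ≠ 0 → 0 < omega0 v (J p v)

open MeasureTheory Filter Topology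
open scoped ContDiff
set_option linter.all false
section MyDev
structure JS (J : E4 → E4 →L[ℝ] E4) : Prop where
  sm : ContDiff ℝ ∞ J
  sq : ∀ x ξ, J x (J x ξ) = -ξ
  inv : ∀ p v w, omega0 (J p v) (J p w) = omega0 v w
  pos : ∀ p v, v ≠ 0 → 0 < omega0 v (J p v)

def dd (J : E4 → E4 →L[ℝ] E4) (α : E4 → E4 →L[ℝ] ℝ) (x ξ : E4) : ℝ :=
  fderiv ℝ α x ξ (J x ξ) - fderiv ℝ α x (J x ξ) ξ
def dc (J : E4 → E4 →L[ℝ] E4) (f : E4 → ℝ) : E4 → E4 →L[ℝ] ℝ :=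
  fun y => (fderiv ℝ f y).comp (J y)
def LL (J : E4 → E4 →L[ℝ] E4) (f : E4 → ℝ) (x ξ : E4) : ℝ := - dd J (dc J f) x ξ
def GG (J : E4 → E4 →L[ℝ] E4) (f g : E4 → ℝ) (x ξ : E4) : ℝ :=
  fderiv ℝ f x ξ * fderiv ℝ g x ξ + fderiv ℝ f x (J x ξ) * fderiv ℝ g x (J x ξ)
def Gq (J : E4 → E4 →L[ℝ] E4) (x ξ : E4) : ℝ := omega0 ξ (J x ξ)
/-- 2-homogeneous functions. -/
def Hom2 {R : Type*} (J : E4 → E4 →L[ℝ] E4) (F : E4 → E4 → R) (s : ℝ → R → R) : Prop :=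
  ∀ x ξ a b, F x (a • ξ + b • J x ξ) = s (a ^ 2 + b ^ 2) (F x ξ)

variable {J : E4 → E4 →L[ℝ] E4}

lemma cd1 {F G : Type*} [NormedAddCommGroup F] [NormedSpace ℝ F] [NormedAddCommGroup G]
    [NormedSpace ℝ G] {f : F → G} (hf : ContDiff ℝ ∞ f) : Differentiable ℝ f :=
  hf.differentiable (by simp)
lemma cdf {F G : Type*} [NormedAddCommGroup F] [NormedSpace ℝ F] [NormedAddCommGroup G]
    [NormedSpace ℝ G] {f : F → G} (hf : ContDiff ℝ ∞ f) : ContDiff ℝ ∞ (fderiv ℝ f) :=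
  hf.fderiv_right (m := ∞) (by simp)

lemma dc_sm (hJ : JS J) {f : E4 → ℝ} (hf : ContDiff ℝ ∞ f) : ContDiff ℝ ∞ (dc J f) :=
  (cdf hf).clm_comp hJ.sm

lemma dd_rot (hJ : JS J) (α : E4 → E4 →L[ℝ] ℝ) (x ξ : E4) (a b : ℝ) :
    dd J α x (a • ξ + b • J x ξ) = (a ^ 2 + b ^ 2) * dd J α x ξ := by
  simp only [dd, map_add, map_smul, hJ.sq, ContinuousLinearMap.add_apply,
    ContinuousLinearMap.smul_apply, smul_eq_mul, map_neg, ContinuousLinearMap.neg_apply, smul_neg]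
  ring

lemma LL_rot (hJ : JS J) (f : E4 → ℝ) (x ξ : E4) (a b : ℝ) :
    LL J f x (a • ξ + b • J x ξ) = (a ^ 2 + b ^ 2) * LL J f x ξ := by
  simp only [LL, dd_rot hJ]; ring

lemma GG_rot (hJ : JS J) (f g : E4 → ℝ) (x ξ : E4) (a b : ℝ) :
    GG J f g x (a • ξ + b • J x ξ) = (a ^ 2 + b ^ 2) * GG J f g x ξ := by
  simp only [GG, map_add, map_smul, hJ.sq, smul_eq_mul, map_neg, smul_neg]
  ring

def omB : E4 →ₗ[ℝ] E4 →ₗ[ℝ] ℝ := LinearMap.mk₂ ℝ omega0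
  (by intros; simp [omega0]; ring) (by intros; simp [omega0]; ring)
  (by intros; simp [omega0]; ring) (by intros; simp [omega0]; ring)

lemma omB_apply (v w : E4) : omB v w = omega0 v w := rfl
lemma om_self (v : E4) : omega0 v v = 0 := by simp [omega0]; ring
lemma om_swap (v w : E4) : omega0 v w = - omega0 w v := by simp [omega0]; ring

lemma Gq_rot (hJ : JS J) (x ξ : E4) (a b : ℝ) :
    Gq J x (a • ξ + b • J x ξ) = (a ^ 2 + b ^ 2) * Gq J x ξ := by
  simp only [Gq, ← omB_apply, map_add, map_smul, hJ.sq, smul_eq_mul, map_neg, smul_neg,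
    LinearMap.add_apply, LinearMap.smul_apply, LinearMap.neg_apply]
  simp only [omB_apply, om_self, om_swap (J x ξ) ξ]
  ring

lemma dd_smul {h : E4 → ℝ} {α : E4 → E4 →L[ℝ] ℝ} {x : E4} (hh : DifferentiableAt ℝ h x)
    (hα : DifferentiableAt ℝ α x) (ξ : E4) :
    dd J (fun y => h y • α y) x ξ = h x * dd J α x ξ + fderiv ℝ h x ξ * α x (J x ξ)
      - fderiv ℝ h x (J x ξ) * α x ξ := by
  simp only [dd]
  rw [fderiv_fun_smul hh hα]
  simp
  ring

lemma dd_smul_dc (hJ : JS J) {h φ : E4 → ℝ} (hh : ContDiff ℝ ∞ h) (hφ : ContDiff ℝ ∞ φ)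
    (x ξ : E4) :
    dd J (fun y => h y • dc J φ y) x ξ = -(h x * LL J φ x ξ + GG J h φ x ξ) := by
  rw [dd_smul (cd1 hh x) (cd1 (dc_sm hJ hφ) x)]
  simp only [LL, GG, dc, ContinuousLinearMap.comp_apply, hJ.sq, map_neg]
  ring

lemma dd_add {α β : E4 → E4 →L[ℝ] ℝ} {x : E4} (hα : DifferentiableAt ℝ α x)
    (hβ : DifferentiableAt ℝ β x) (ξ : E4) :
    dd J (fun y => α y + β y) x ξ = dd J α x ξ + dd J β x ξ := by
  simp only [dd]
  rw [fderiv_fun_add hα hβ]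
  simp
  ring

lemma LL_add (hJ : JS J) {f g : E4 → ℝ} (hf : ContDiff ℝ ∞ f) (hg : ContDiff ℝ ∞ g) (x ξ : E4) :
    LL J (fun y => f y + g y) x ξ = LL J f x ξ + LL J g x ξ := by
  have : dc J (fun y => f y + g y) = fun y => dc J f y + dc J g y := by
    ext y ζ
    simp only [dc]
    rw [fderiv_fun_add (cd1 hf y) (cd1 hg y)]
    simp
  simp only [LL, this]
  rw [dd_add (cd1 (dc_sm hJ hf) x) (cd1 (dc_sm hJ hg) x)]
  ring

lemma LL_comp (hJ : JS J) {f : E4 → ℝ} (hf : ContDiff ℝ ∞ f) {k : ℝ → ℝ} (hk : ContDiff ℝ ∞ k)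
    (x ξ : E4) : LL J (fun y => k (f y)) x ξ =
      deriv k (f x) * LL J f x ξ + deriv (deriv k) (f x) * GG J f f x ξ := by
  have hk' : ContDiff ℝ ∞ (deriv k) := by
    simpa using (contDiff_infty_iff_deriv.1 hk).2
  have : dc J (fun y => k (f y)) = fun y => (deriv k (f y)) • dc J f y := by
    ext y ζ
    simp only [dc]
    rw [show (fun y => k (f y)) = k ∘ f from rfl, fderiv_comp y (cd1 hk _) (cd1 hf y)]
    simp [fderiv_eq_deriv_mul]
    ring
  have h2 : ∀ ζ, fderiv ℝ (fun y => deriv k (f y)) x ζ = deriv (deriv k) (f x) * fderiv ℝ f x ζ := by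
    intro ζ
    rw [show (fun y => deriv k (f y)) = (deriv k) ∘ f from rfl,
      fderiv_comp x (cd1 hk' _) (cd1 hf x)]
    simp [fderiv_eq_deriv_mul]
    ring
  simp only [LL] at *
  rw [this, dd_smul_dc hJ (h := fun y => deriv k (f y)) (hk'.comp hf) hf]
  simp only [LL, GG, h2]
  ring

lemma GG_comp {f g : E4 → ℝ} (hf : ContDiff ℝ ∞ f) {k : ℝ → ℝ} (hk : ContDiff ℝ ∞ k)
    (x ξ : E4) : GG J (fun y => k (f y)) g x ξ = deriv k (f x) * GG J f g x ξ := by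
  have h2 : ∀ ζ, fderiv ℝ (fun y => k (f y)) x ζ = deriv k (f x) * fderiv ℝ f x ζ := by
    intro ζ
    rw [show (fun y => k (f y)) = k ∘ f from rfl,
      fderiv_comp x (cd1 hk _) (cd1 hf x)]
    simp [fderiv_eq_deriv_mul]
    ring
  simp only [GG, h2]; ring

lemma GG_comm (f g : E4 → ℝ) (x ξ : E4) : GG J f g x ξ = GG J g f x ξ := by
  simp only [GG]; ring

lemma GG_add {f g h : E4 → ℝ} (hf : ContDiff ℝ ∞ f) (hg : ContDiff ℝ ∞ g) (x ξ : E4) :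
    GG J (fun y => f y + g y) h x ξ = GG J f h x ξ + GG J g h x ξ := by
  simp only [GG]
  rw [fderiv_fun_add (cd1 hf x) (cd1 hg x)]
  simp; ring

lemma GG_mul {f g h : E4 → ℝ} (hf : ContDiff ℝ ∞ f) (hg : ContDiff ℝ ∞ g) (x ξ : E4) :
    GG J (fun y => f y * g y) h x ξ = f x * GG J g h x ξ + g x * GG J f h x ξ := by
  simp only [GG]
  rw [fderiv_fun_mul (cd1 hf x) (cd1 hg x)]
  simp; ring

lemma GG_nonneg (f : E4 → ℝ) (x ξ : E4) : 0 ≤ GG J f f x ξ := by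
  simp only [GG]; nlinarith [mul_self_nonneg (fderiv ℝ f x ξ), mul_self_nonneg (fderiv ℝ f x (J x ξ))]

lemma GG_cs (f g : E4 → ℝ) (x ξ : E4) : (GG J f g x ξ) ^ 2 ≤ GG J f f x ξ * GG J g g x ξ := by
  simp only [GG]
  nlinarith [sq_nonneg (fderiv ℝ f x ξ * fderiv ℝ g x (J x ξ) - fderiv ℝ f x (J x ξ) * fderiv ℝ g x ξ)]

lemma GG_young (f g : E4 → ℝ) (x ξ : E4) {t : ℝ} (ht : 0 < t) :
    2 * |GG J f g x ξ| ≤ t * GG J f f x ξ + t⁻¹ * GG J g g x ξ := by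
  have h := GG_cs (J := J) f g x ξ
  have h1 := GG_nonneg (J := J) f x ξ
  have h2 := GG_nonneg (J := J) g x ξ
  have ht' : 0 < t⁻¹ := inv_pos.2 ht
  refine abs_le_of_sq_le_sq' (a := 2 * |GG J f g x ξ|) ?_ (by positivity) |>.2
  have e : t * t⁻¹ = 1 := mul_inv_cancel₀ ht.ne'
  rw [mul_pow, sq_abs]
  nlinarith [sq_nonneg (t * GG J f f x ξ - t⁻¹ * GG J g g x ξ)]

lemma LL_mul (hJ : JS J) {f g : E4 → ℝ} (hf : ContDiff ℝ ∞ f) (hg : ContDiff ℝ ∞ g) (x ξ : E4) :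
    LL J (fun y => f y * g y) x ξ = f x * LL J g x ξ + g x * LL J f x ξ + 2 * GG J f g x ξ := by
  have : dc J (fun y => f y * g y) = fun y => (f y • dc J g y) + (g y • dc J f y) := by
    ext y ζ
    simp only [dc]
    rw [fderiv_fun_mul (cd1 hf y) (cd1 hg y)]
    simp
  simp only [LL, this]
  rw [dd_add (α := fun y => f y • dc J g y) (β := fun y => g y • dc J f y)
    (cd1 (hf.smul (dc_sm hJ hg)) x) (cd1 (hg.smul (dc_sm hJ hf)) x),
    dd_smul_dc hJ hf hg, dd_smul_dc hJ hg hf, GG_comm g f]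
  simp only [LL]; ring

lemma LL_const (c : ℝ) (x ξ : E4) : LL J (fun _ => c) x ξ = 0 := by
  have : dc J (fun _ => c) = fun _ => 0 := by ext y ζ; simp [dc]
  simp [LL, this, dd]

lemma LL_cmul (hJ : JS J) {f : E4 → ℝ} (hf : ContDiff ℝ ∞ f) (c : ℝ) (x ξ : E4) :
    LL J (fun y => c * f y) x ξ = c * LL J f x ξ := by
  rw [LL_mul hJ contDiff_const hf, LL_const]
  simp [GG]

lemma LL_congr {f g : E4 → ℝ} {x : E4} (h : f =ᶠ[𝓝 x] g) (ξ : E4) : LL J f x ξ = LL J g x ξ := by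
  have : dc J f =ᶠ[𝓝 x] dc J g := by
    filter_upwards [h.fderiv (𝕜 := ℝ)] with y hy
    simp [dc, hy]
  simp [LL, dd, this.fderiv_eq]

lemma GG_congr {f g h : E4 → ℝ} {x : E4} (hh : f =ᶠ[𝓝 x] g) (ξ : E4) :
    GG J f h x ξ = GG J g h x ξ := by
  simp [GG, hh.fderiv_eq]

lemma dd_sm (hJ : JS J) {α : E4 → E4 →L[ℝ] ℝ} (hα : ContDiff ℝ ∞ α) :
    ContDiff ℝ ∞ (fun p : E4 × E4 => dd J α p.1 p.2) := by
  have h1 : ContDiff ℝ ∞ (fun p : E4 × E4 => fderiv ℝ α p.1) := (cdf hα).comp contDiff_fst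
  have h2 : ContDiff ℝ ∞ (fun p : E4 × E4 => J p.1 p.2) := (hJ.sm.comp contDiff_fst).clm_apply contDiff_snd
  exact ((h1.clm_apply contDiff_snd).clm_apply h2).sub ((h1.clm_apply h2).clm_apply contDiff_snd)

lemma LL_sm (hJ : JS J) {f : E4 → ℝ} (hf : ContDiff ℝ ∞ f) :
    ContDiff ℝ ∞ (fun p : E4 × E4 => LL J f p.1 p.2) := (dd_sm hJ (dc_sm hJ hf)).neg

lemma fd_sm {f : E4 → ℝ} (hf : ContDiff ℝ ∞ f) :
    ContDiff ℝ ∞ (fun p : E4 × E4 => fderiv ℝ f p.1 p.2) :=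
  ((cdf hf).comp contDiff_fst).clm_apply contDiff_snd
lemma JJ_sm (hJ : JS J) : ContDiff ℝ ∞ (fun p : E4 × E4 => J p.1 p.2) :=
  (hJ.sm.comp contDiff_fst).clm_apply contDiff_snd
lemma fdJ_sm (hJ : JS J) {f : E4 → ℝ} (hf : ContDiff ℝ ∞ f) :
    ContDiff ℝ ∞ (fun p : E4 × E4 => fderiv ℝ f p.1 (J p.1 p.2)) :=
  ((cdf hf).comp contDiff_fst).clm_apply (JJ_sm hJ)
lemma GG_sm (hJ : JS J) {f g : E4 → ℝ} (hf : ContDiff ℝ ∞ f) (hg : ContDiff ℝ ∞ g) :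
    ContDiff ℝ ∞ (fun p : E4 × E4 => GG J f g p.1 p.2) :=
  ((fd_sm hf).mul (fd_sm hg)).add ((fdJ_sm hJ hf).mul (fdJ_sm hJ hg))
lemma coord_sm (i : Fin 4) : ContDiff ℝ ∞ (fun x : E4 => x i) :=
  (EuclideanSpace.proj (𝕜 := ℝ) i).contDiff
lemma om_sm {F : Type*} [NormedAddCommGroup F] [NormedSpace ℝ F] {a b : F → E4}
    (ha : ContDiff ℝ ∞ a) (hb : ContDiff ℝ ∞ b) : ContDiff ℝ ∞ (fun p => omega0 (a p) (b p)) := by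
  have h1 := fun i => (coord_sm i).comp ha
  have h2 := fun i => (coord_sm i).comp hb
  exact ((((h1 0).mul (h2 1)).sub ((h1 1).mul (h2 0))).add ((h1 2).mul (h2 3))).sub ((h1 3).mul (h2 2))
lemma Gq_sm (hJ : JS J) : ContDiff ℝ ∞ (fun p : E4 × E4 => Gq J p.1 p.2) :=
  om_sm contDiff_snd (JJ_sm hJ)

def ee1 : E2 := (1, 0)
def ee2 : E2 := (0, 1)
lemma J0_e1 : J0 ee1 = ee2 := by simp [J0, ee1, ee2]
lemma J0_e2 : J0 ee2 = -ee1 := by simp [J0, ee1, ee2]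

/-- J-holomorphic on an open set. -/
structure JH (J : E4 → E4 →L[ℝ] E4) (v : E2 → E4) (Ω : Set E2) : Prop where
  op : IsOpen Ω
  sm : ContDiffOn ℝ ∞ v Ω
  hol : ∀ z ∈ Ω, ∀ ζ, fderiv ℝ v z (J0 ζ) = J (v z) (fderiv ℝ v z ζ)

def vx (v : E2 → E4) (z : E2) : E4 := fderiv ℝ v z ee1

namespace JH
variable {v : E2 → E4} {Ω : Set E2}
lemma at_ (h : JH J v Ω) {z} (hz : z ∈ Ω) : ContDiffAt ℝ ∞ v z :=
  h.sm.contDiffAt (h.op.mem_nhds hz)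
lemma df (h : JH J v Ω) {z} (hz : z ∈ Ω) : DifferentiableAt ℝ v z :=
  (h.at_ hz).differentiableAt (by simp)
lemma fd (h : JH J v Ω) {z} (hz : z ∈ Ω) : ContDiffAt ℝ ∞ (fderiv ℝ v) z :=
  (h.at_ hz).fderiv_right (m := ∞) (by simp)
lemma vy (h : JH J v Ω) {z} (hz : z ∈ Ω) : fderiv ℝ v z ee2 = J (v z) (vx v z) := by
  rw [← J0_e1, h.hol z hz]; rfl
lemma mono (h : JH J v Ω) {Ω'} (ho : IsOpen Ω') (hs : Ω' ⊆ Ω) : JH J v Ω' :=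
  ⟨ho, h.sm.mono hs, fun z hz => h.hol z (hs hz)⟩
lemma fd_apply (h : JH J v Ω) {z} (hz : z ∈ Ω) (ζ : E2) :
    fderiv ℝ v z ζ = ζ.1 • vx v z + ζ.2 • J (v z) (vx v z) := by
  conv_lhs => rw [show ζ = ζ.1 • ee1 + ζ.2 • ee2 by simp [ee1, ee2]]
  rw [map_add, map_smul, map_smul, h.vy hz]; rfl

lemma pull (h : JH J v Ω) {z} (hz : z ∈ Ω) {α : E4 → E4 →L[ℝ] ℝ} (hα : ContDiff ℝ ∞ α) :
    dd J α (v z) (vx v z) = fderiv ℝ (fun w => α (v w) (fderiv ℝ v w ee2)) z ee1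
      - fderiv ℝ (fun w => α (v w) (fderiv ℝ v w ee1)) z ee2 := by
  have hα' : HasFDerivAt (fun w => α (v w)) ((fderiv ℝ α (v z)).comp (fderiv ℝ v z)) z :=
    (cd1 hα (v z)).hasFDerivAt.comp z (h.df hz).hasFDerivAt
  have hv' := fun e : E2 => (((h.fd hz).differentiableAt (by simp)).hasFDerivAt.clm_apply
    (hasFDerivAt_const e z))
  have key := fun e : E2 => (hα'.clm_apply (hv' e)).fderiv
  have sym : fderiv ℝ (fderiv ℝ v) z ee1 ee2 = fderiv ℝ (fderiv ℝ v) z ee2 ee1 :=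
    ((h.at_ hz).isSymmSndFDerivAt (by simp; exact WithTop.coe_le_coe.2 le_top)) _ _
  rw [key ee2, key ee1]
  simp [sym, dd, h.vy hz, vx]

lemma pullL (hJ : JS J) (h : JH J v Ω) {z} (hz : z ∈ Ω) {f : E4 → ℝ} (hf : ContDiff ℝ ∞ f) :
    LL J f (v z) (vx v z) = fderiv ℝ (fun w => fderiv ℝ (fun w => f (v w)) w ee1) z ee1
      + fderiv ℝ (fun w => fderiv ℝ (fun w => f (v w)) w ee2) z ee2 := by
  have hc : ∀ w ∈ Ω, fderiv ℝ (fun w => f (v w)) w = (fderiv ℝ f (v w)).comp (fderiv ℝ v w) :=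
    fun w hw => fderiv_comp w (cd1 hf _) (h.df hw)
  have e2 : (fun w => dc J f (v w) (fderiv ℝ v w ee2)) =ᶠ[𝓝 z]
      fun w => - fderiv ℝ (fun w => f (v w)) w ee1 := by
    filter_upwards [h.op.mem_nhds hz] with w hw
    simp [dc, hc w hw, h.vy hw, hJ.sq, vx]
  have e1 : (fun w => dc J f (v w) (fderiv ℝ v w ee1)) =ᶠ[𝓝 z]
      fun w => fderiv ℝ (fun w => f (v w)) w ee2 := by
    filter_upwards [h.op.mem_nhds hz] with w hw
    simp [dc, hc w hw, h.vy hw, vx]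
  rw [LL, h.pull hz (dc_sm hJ hf), e2.fderiv_eq, e1.fderiv_eq, fderiv_fun_neg]
  simp; ring
end JH

def LMPat (J : E4 → E4 →L[ℝ] E4) (K : Set E4) (x : E4) : Prop :=
  ∀ f : E4 → ℝ, ContDiff ℝ ∞ f → IsLocalMaxOn f K x → ∃ ξ, ξ ≠ 0 ∧ LL J f x ξ ≤ 0
def LMP (J : E4 → E4 →L[ℝ] E4) (K : Set E4) : Prop := ∀ x ∈ K, LMPat J K x

lemma sc_of_rot {Ψ : E4 → E4 → ℝ}
    (h : ∀ x ξ a b, Ψ x (a • ξ + b • J x ξ) = (a ^ 2 + b ^ 2) * Ψ x ξ) (x ξ : E4) (t : ℝ) :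
    Ψ x (t • ξ) = t ^ 2 * Ψ x ξ := by simpa using h x ξ t 0

lemma Gq_pos (hJ : JS J) (x : E4) {ξ : E4} (h : ξ ≠ 0) : 0 < Gq J x ξ := hJ.pos x ξ h
lemma Gq_sc (hJ : JS J) (x ξ : E4) (t : ℝ) : Gq J x (t • ξ) = t ^ 2 * Gq J x ξ :=
  sc_of_rot (Gq_rot hJ) x ξ t
lemma LL_sc (hJ : JS J) (f : E4 → ℝ) (x ξ : E4) (t : ℝ) : LL J f x (t • ξ) = t ^ 2 * LL J f x ξ :=
  sc_of_rot (LL_rot hJ f) x ξ t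

lemma isc (S : Set E4) (hS : IsCompact S) : IsCompact (S ×ˢ Metric.sphere (0 : E4) 1) :=
  hS.prod (isCompact_sphere 0 1)

lemma norm_red {Φ : E4 → ℝ} (hs : ∀ t ξ, Φ (t • ξ) = t ^ 2 * Φ ξ)
    (h : ∀ ξ ∈ Metric.sphere (0 : E4) 1, 0 ≤ Φ ξ) (ξ : E4) : 0 ≤ Φ ξ := by
  by_cases h0 : ξ = 0
  · have := hs 0 0; simp at this; simp [h0, this]
  · have hn : ‖ξ‖ ≠ 0 := by simpa using h0
    have e : ξ = ‖ξ‖ • (‖ξ‖⁻¹ • ξ) := by rw [smul_smul, mul_inv_cancel₀ hn, one_smul]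
    rw [e, hs]
    refine mul_nonneg (by positivity) (h _ ?_)
    simp [norm_smul, hn]

lemma bdd2 (hJ : JS J) {Ψ : E4 → E4 → ℝ} (hc : Continuous (fun p : E4 × E4 => Ψ p.1 p.2))
    (hs : ∀ x ξ t, Ψ x (t • ξ) = t ^ 2 * Ψ x ξ) {S : Set E4} (hS : IsCompact S) :
    ∃ C, 0 ≤ C ∧ ∀ x ∈ S, ∀ ξ, |Ψ x ξ| ≤ C * Gq J x ξ := by
  have hG := (Gq_sm hJ).continuous
  obtain ⟨A, hA⟩ := (isc S hS).exists_bound_of_continuousOn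
    (f := fun p : E4 × E4 => Ψ p.1 p.2 / Gq J p.1 p.2) (by
      refine ContinuousOn.div hc.continuousOn hG.continuousOn ?_
      rintro ⟨x, ξ⟩ ⟨_, h2⟩
      refine (Gq_pos hJ x ?_).ne'
      rintro rfl; simp at h2)
  refine ⟨max A 0, le_max_right _ _, fun x hx ξ => ?_⟩
  rw [← sub_nonneg]
  refine norm_red (Φ := fun ξ => max A 0 * Gq J x ξ - |Ψ x ξ|) (fun t ξ => ?_) (fun ξ hξ => ?_) ξ
  · rw [Gq_sc hJ, hs, abs_mul, abs_of_nonneg (sq_nonneg t)]; ring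
  · have h0 : ξ ≠ 0 := by rintro rfl; simp at hξ
    have := hA (x, ξ) ⟨hx, hξ⟩
    have hp := Gq_pos hJ x h0
    rw [Real.norm_eq_abs, abs_div, abs_of_pos hp, div_le_iff₀ hp] at this
    have h3 : A * Gq J x ξ ≤ max A 0 * Gq J x ξ := by gcongr; exact le_max_left _ _
    linarith

lemma posAt (hJ : JS J) {f : E4 → ℝ} (hf : ContDiff ℝ ∞ f) {x : E4}
    (h : ∀ ξ, ξ ≠ 0 → 0 < LL J f x ξ) :
    ∃ c, 0 < c ∧ ∃ r, 0 < r ∧ ∀ y ∈ Metric.closedBall x r, ∀ ξ, c * Gq J y ξ ≤ LL J f y ξ := by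
  have hL := (LL_sm hJ hf).continuous
  have hG := (Gq_sm hJ).continuous
  obtain ⟨p, hp, hmin⟩ := (isc {x} isCompact_singleton).exists_isMinOn
    (f := fun p : E4 × E4 => LL J f p.1 p.2 / Gq J p.1 p.2)
    (by obtain ⟨w, hw⟩ := (NormedSpace.sphere_nonempty (x := (0 : E4)) (r := 1)).2 zero_le_one
        exact ⟨(x, w), rfl, hw⟩)
    (by
      refine ContinuousOn.div hL.continuousOn hG.continuousOn ?_
      rintro ⟨x, ξ⟩ ⟨_, h2⟩
      refine (Gq_pos hJ x ?_).ne'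
      rintro rfl; simp at h2)
  set m := LL J f p.1 p.2 / Gq J p.1 p.2 with hm
  have hm0 : 0 < m := by
    have h2 : p.2 ≠ 0 := by rintro h; have := hp.2; simp [h] at this
    have h1 : p.1 = x := hp.1
    rw [hm, h1]
    exact div_pos (h _ h2) (Gq_pos hJ x h2)
  have hopen : IsOpen {p : E4 × E4 | m / 2 * Gq J p.1 p.2 < LL J f p.1 p.2} :=
    isOpen_lt (by fun_prop) hL
  obtain ⟨u, w, hu, hw, hxu, hsw, huw⟩ := generalized_tube_lemma (isCompact_singleton (x := x))
    (isCompact_sphere (0 : E4) 1) hopen (by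
      rintro ⟨y, ξ⟩ ⟨h1, h2⟩
      have h1 : y = x := h1
      subst h1
      have h0 : ξ ≠ 0 := by rintro rfl; simp at h2
      have hg := Gq_pos hJ y h0
      have := hmin (show (y, ξ) ∈ {y} ×ˢ Metric.sphere (0 : E4) 1 from ⟨rfl, h2⟩)
      simp only [mem_setOf_eq] at this ⊢
      rw [← hm, le_div_iff₀ hg] at this
      nlinarith)
  obtain ⟨r, hr, hru⟩ := Metric.nhds_basis_closedBall.mem_iff.1 (hu.mem_nhds (hxu rfl))
  refine ⟨m / 2, by positivity, r, hr, fun y hy ξ => ?_⟩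
  rw [← sub_nonneg]
  refine norm_red (Φ := fun ξ => LL J f y ξ - m / 2 * Gq J y ξ) (fun t ξ => ?_) (fun ξ hξ => ?_) ξ
  · rw [Gq_sc hJ, LL_sc hJ]; ring
  · have := huw (show (y, ξ) ∈ u ×ˢ w from ⟨hru hy, hsw hξ⟩)
    simp only [mem_setOf_eq] at this
    linarith

lemma sq_sm (x : E4) : ContDiff ℝ ∞ (fun y : E4 => ‖y - x‖ ^ 2) :=
  (contDiff_norm_sq ℝ).comp (contDiff_id.sub contDiff_const)

lemma LL_bdd (hJ : JS J) {f : E4 → ℝ} (hf : ContDiff ℝ ∞ f) {S : Set E4} (hS : IsCompact S) :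
    ∃ C, 0 ≤ C ∧ ∀ x ∈ S, ∀ ξ, |LL J f x ξ| ≤ C * Gq J x ξ :=
  bdd2 hJ (LL_sm hJ hf).continuous (fun x ξ t => LL_sc hJ f x ξ t) hS

/-- failure of LMP, made strict. -/
lemma strictify (hJ : JS J) {K : Set E4} {x : E4} (hx : x ∈ K) (h : ¬ LMPat J K x) {R : ℝ}
    (hR : 0 < R) : ∃ f : E4 → ℝ, ContDiff ℝ ∞ f ∧ f x = 0 ∧ ∃ ε c r, 0 < ε ∧ 0 < c ∧ 0 < r ∧ r ≤ R ∧
      (∀ y ∈ Metric.closedBall x r, y ∈ K → f y ≤ - ε * ‖y - x‖ ^ 2) ∧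
      ∀ y ∈ Metric.closedBall x r, ∀ ξ, c * Gq J y ξ ≤ LL J f y ξ := by
  simp only [LMPat] at h
  push Not at h
  obtain ⟨f, hf, hmax, hpos⟩ := h
  obtain ⟨c, hc, r, hr, hcr⟩ := posAt hJ hf hpos
  obtain ⟨C, hC, hCb⟩ := LL_bdd hJ (sq_sm x) (isCompact_closedBall x r)
  obtain ⟨r2, hr2, hr2'⟩ : ∃ r2 > 0, ∀ y ∈ Metric.closedBall x r2, y ∈ K → f y ≤ f x := by
    have := hmax
    simp only [IsLocalMaxOn, IsMaxFilter] at this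
    rw [eventually_nhdsWithin_iff] at this
    obtain ⟨r2, h1, h2⟩ := Metric.nhds_basis_closedBall.eventually_iff.1 this
    exact ⟨r2, h1, fun y hy hk => h2 hy hk⟩
  set ε := c / (2 * (C + 1)) with hε
  have hε0 : 0 < ε := by positivity
  refine ⟨fun y => f y + (-ε * ‖y - x‖ ^ 2 + (- f x)), ?_, by simp, ε, c / 2, min (min r r2) R, hε0,
    by positivity, by positivity, min_le_right _ _, ?_, ?_⟩
  · exact hf.add ((contDiff_const.mul (sq_sm x)).add contDiff_const)
  · intro y hy hK
    have := hr2' y (Metric.closedBall_subset_closedBall ((min_le_left _ _).trans (min_le_right _ _)) hy) hK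
    dsimp only
    linarith
  · intro y hy ξ
    have hy' := (Metric.closedBall_subset_closedBall ((min_le_left _ _).trans (min_le_left _ _)) hy)
    rw [LL_add hJ hf ((contDiff_const.mul (sq_sm x)).add contDiff_const),
      LL_add hJ (contDiff_const.mul (sq_sm x)) contDiff_const, LL_const, LL_cmul hJ (sq_sm x)]
    have h1 := hcr y hy' ξ
    have h2 := (abs_le.1 (hCb y hy' ξ)).2
    have hg : 0 ≤ Gq J y ξ := by
      by_cases h0 : ξ = 0
      · simp [h0, Gq, omega0]
      · exact (Gq_pos hJ y h0).le
    have h3 : ε * LL J (fun y => ‖y - x‖ ^ 2) y ξ ≤ ε * ((C + 1) * Gq J y ξ) := by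
      gcongr; nlinarith
    have h4 : ε * ((C + 1) * Gq J y ξ) = c / 2 * Gq J y ξ := by
      rw [hε]; field_simp
    nlinarith

lemma chain_inter {c : Set (Set E4)} (hch : IsChain (· ⊆ ·) c) (hne : c.Nonempty) {T : Set E4}
    (hT : IsClosed T) (hcp : ∀ K ∈ c, IsCompact K) (h : ∀ K ∈ c, (K ∩ T).Nonempty) :
    (⋂₀ c ∩ T).Nonempty := by
  haveI : Nonempty c := hne.to_subtype
  have := IsCompact.nonempty_iInter_of_directed_nonempty_isCompact_isClosed
    (fun K : c => K.1 ∩ T) (by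
      intro A B
      rcases hch.total A.2 B.2 with h | h
      · exact ⟨A, subset_rfl, inter_subset_inter_left _ h⟩
      · exact ⟨B, inter_subset_inter_left _ h, subset_rfl⟩)
    (fun K => h K.1 K.2) (fun K => (hcp K.1 K.2).inter_right hT)
    (fun K => (hcp K.1 K.2).isClosed.inter hT)
  obtain ⟨x, hx⟩ := this
  simp only [mem_iInter] at hx
  obtain ⟨K, hK⟩ := hne
  exact ⟨x, fun A hA => (hx ⟨A, hA⟩).1, (hx ⟨K, hK⟩).2⟩

lemma max_contra (hJ : JS J) {K : Set E4} (hK : IsCompact K) {f : E4 → ℝ} (hf : ContDiff ℝ ∞ f)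
    {x : E4} {r b : ℝ} (hy : ∃ y ∈ K ∩ Metric.closedBall x r, b < f y)
    (hL : ∀ y ∈ Metric.closedBall x r, ∀ ξ, ξ ≠ 0 → 0 < LL J f y ξ)
    (hb : ∀ y ∈ K ∩ Metric.sphere x r, f y ≤ b) (hKL : ∀ y ∈ K ∩ Metric.closedBall x r, b < f y → LMPat J K y) :
    False := by
  obtain ⟨y, hy, hby⟩ := hy
  obtain ⟨z, hz, hmax⟩ := (hK.inter_right Metric.isClosed_closedBall).exists_isMaxOn ⟨y, hy⟩
    hf.continuous.continuousOn
  have hfz : b < f z := hby.trans_le (hmax hy)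
  have hzb : z ∈ Metric.ball x r := by
    by_contra hn
    have : z ∈ Metric.sphere x r := by
      have h1 := hz.2
      simp only [Metric.mem_closedBall, Metric.mem_ball, Metric.mem_sphere] at *
      exact le_antisymm h1 (not_lt.1 hn)
    exact absurd (hb z ⟨hz.1, this⟩) (not_le.2 hfz)
  have : IsLocalMaxOn f K z := by
    simp only [IsLocalMaxOn, IsMaxFilter]
    rw [eventually_nhdsWithin_iff]
    filter_upwards [Metric.isOpen_ball.mem_nhds hzb] with w hw hwK
    exact hmax ⟨hwK, Metric.ball_subset_closedBall hw⟩
  obtain ⟨ξ, h0, hξ⟩ := hKL z hz hfz f hf this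
  exact absurd hξ (not_le.2 (hL z hz.2 ξ h0))

lemma exists_min (hJ : JS J) {C : Set E4} (hC : IsCompact C) (hne : C.Nonempty) (hL : LMP J C) :
    ∃ K ⊆ C, IsCompact K ∧ K.Nonempty ∧ LMP J K ∧
      ∀ K' ⊆ K, IsCompact K' → K'.Nonempty → LMP J K' → K' = K := by
  obtain ⟨K, hKC, hmin⟩ := zorn_superset_nonempty {K | IsCompact K ∧ K.Nonempty ∧ LMP J K} (by
    intro c hc hch hne
    have hcl : IsClosed (⋂₀ c) := isClosed_sInter fun K hK => (hc hK).1.isClosed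
    obtain ⟨K0, hK0⟩ := hne
    have hcomp : IsCompact (⋂₀ c) := (hc hK0).1.of_isClosed_subset hcl (sInter_subset_of_mem hK0)
    refine ⟨⋂₀ c, ⟨hcomp, ?_, ?_⟩, fun s hs => sInter_subset_of_mem hs⟩
    · have := chain_inter hch ⟨K0, hK0⟩ (T := univ) isClosed_univ (fun K hK => (hc hK).1)
        (fun K hK => by simpa using (hc hK).2.1)
      simpa using this
    · intro x hx
      by_contra hcon
      obtain ⟨f, hf, hfx, ε, c', r, hε, hc', hr, -, h1, h2⟩ := strictify hJ hx hcon zero_lt_one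
      by_cases hcase : ∃ K ∈ c, ¬ (K ∩ (Metric.sphere x r ∩ {y | -ε * r ^ 2 / 2 ≤ f y})).Nonempty
      · obtain ⟨K, hK, hKe⟩ := hcase
        refine max_contra hJ (hc hK).1 hf (x := x) (r := r) (b := -ε * r ^ 2 / 2)
          ⟨x, ⟨hx K hK, Metric.mem_closedBall_self hr.le⟩, ?_⟩ ?_ ?_ ?_
        · rw [hfx]; have : 0 < ε * r ^ 2 := by positivity
          linarith
        · intro y hy ξ h0
          have := h2 y hy ξ
          have h3 := Gq_pos hJ y h0
          nlinarith
        · intro y hy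
          by_contra h3
          exact hKe ⟨y, hy.1, hy.2, (not_le.1 h3).le⟩
        · intro y hy _
          exact (hc hK).2.2 y hy.1
      · push Not at hcase
        obtain ⟨y, hy1, hy2, hy3⟩ := chain_inter hch ⟨K0, hK0⟩ (T := Metric.sphere x r ∩ {y | -ε * r ^ 2 / 2 ≤ f y})
          (Metric.isClosed_sphere.inter (isClosed_le continuous_const hf.continuous))
          (fun K hK => (hc hK).1) hcase
        have := h1 y (Metric.sphere_subset_closedBall hy2) hy1
        have e : ‖y - x‖ = r := by simpa [dist_eq_norm] using hy2
        rw [e] at this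
        simp only [mem_setOf_eq] at hy3
        have : 0 < ε * r ^ 2 := by positivity
        linarith) C ⟨hC, hne, hL⟩
  refine ⟨K, hKC, hmin.1.1, hmin.1.2.1, hmin.1.2.2, fun K' hs h1 h2 h3 => ?_⟩
  exact subset_antisymm hs (hmin.2 ⟨h1, h2, h3⟩ hs)

lemma lap_le {g : E2 → ℝ} {z : E2} (hg : ContDiffAt ℝ ∞ g z) (hm : IsLocalMax g z) (e : E2) :
    fderiv ℝ (fun w => fderiv ℝ g w e) z e ≤ 0 := by
  by_contra hcon
  push Not at hcon
  have hline : Continuous (fun t : ℝ => z + t • e) := by fun_prop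
  have hl0 : Tendsto (fun t : ℝ => z + t • e) (𝓝 0) (𝓝 z) := by
    have := hline.tendsto 0; simpa using this
  have hld : ∀ t : ℝ, HasDerivAt (fun t : ℝ => z + t • e) e t := fun t => by
    simpa using ((hasDerivAt_id t).smul_const e).const_add z
  have hev : ∀ᶠ w in 𝓝 z, ContDiffAt ℝ 2 g w :=
    (hg.of_le (WithTop.coe_le_coe.2 le_top)).eventually (by simp)
  have hd1 : ∀ᶠ t in 𝓝 (0 : ℝ), deriv (fun t : ℝ => g (z + t • e)) t = fderiv ℝ g (z + t • e) e := by
    filter_upwards [hl0.eventually hev] with t ht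
    exact ((ht.differentiableAt (by simp)).hasFDerivAt.comp_hasDerivAt t (hld t)).deriv
  have hfd : DifferentiableAt ℝ (fun w => fderiv ℝ g w e) z := by
    have := (hg.fderiv_right (m := ∞) (by simp)).differentiableAt (by simp)
    exact this.clm_apply (differentiableAt_const e)
  have hd2 : deriv (deriv (fun t : ℝ => g (z + t • e))) 0 = fderiv ℝ (fun w => fderiv ℝ g w e) z e := by
    rw [EventuallyEq.deriv_eq hd1]
    have h0 : HasFDerivAt (fun w => fderiv ℝ g w e) (fderiv ℝ (fun w => fderiv ℝ g w e) z)
      (z + (0 : ℝ) • e) := by simpa using hfd.hasFDerivAt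
    exact (h0.comp_hasDerivAt (0 : ℝ) (hld 0)).deriv
  have hmax : IsLocalMax (fun t : ℝ => g (z + t • e)) 0 := by
    have := hl0.eventually hm
    simpa [IsLocalMax, IsMaxFilter] using this
  have hmin := isLocalMin_of_deriv_deriv_pos (f := fun t : ℝ => g (z + t • e)) (x₀ := 0)
    (by rw [hd2]; exact hcon) hmax.deriv_eq_zero (by
      have h0 : ContinuousAt g (z + (0 : ℝ) • e) := by simpa using hg.continuousAt
      exact ContinuousAt.comp (f := fun t : ℝ => z + t • e) h0 hline.continuousAt)
  have hconst : (fun t : ℝ => g (z + t • e)) =ᶠ[𝓝 0] fun _ => g (z + (0 : ℝ) • e) := by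
    filter_upwards [hmax, hmin] with t h1 h2
    exact le_antisymm h1 h2
  have : deriv (deriv (fun t : ℝ => g (z + t • e))) 0 = 0 := by
    rw [EventuallyEq.deriv_eq hconst.deriv]; simp
  rw [hd2] at this
  exact hcon.ne' this

lemma JH.vx_ne {v : E2 → E4} {Ω : Set E2} (h : JH J v Ω) {z} (hz : z ∈ Ω) (hr : fderiv ℝ v z ≠ 0) :
    vx v z ≠ 0 := by
  intro h0
  apply hr
  refine ContinuousLinearMap.ext fun ζ => ?_
  rw [h.fd_apply hz, h0]; simp

lemma C_LMP (hJ : JS J) {C : Set E4}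
    (h : ∀ x ∈ C, ∃ V : Set E4, IsOpen V ∧ x ∈ V ∧ ∃ D v, JH J v D ∧ IsRegularOn v D ∧ C ∩ V = v '' D) :
    LMP J C := by
  intro x hx f hf hmax
  obtain ⟨V, hV, hxV, D, v, hv, hreg, hCV⟩ := h x hx
  obtain ⟨z, hz, rfl⟩ : x ∈ v '' D := hCV ▸ ⟨hx, hxV⟩
  refine ⟨vx v z, hv.vx_ne hz (hreg z hz), ?_⟩
  have hg : ContDiffAt ℝ ∞ (fun w => f (v w)) z := hf.contDiffAt.comp z (hv.at_ hz)
  have hm : IsLocalMax (fun w => f (v w)) z := by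
    simp only [IsLocalMaxOn, IsMaxFilter] at hmax
    rw [eventually_nhdsWithin_iff] at hmax
    filter_upwards [(hv.at_ hz).continuousAt.eventually hmax, hv.op.mem_nhds hz] with w hw hwD
    exact hw ((hCV ▸ mem_image_of_mem v hwD : v w ∈ C ∩ V).1)
  rw [hv.pullL hJ hz hf]
  have h1 := lap_le hg hm ee1
  have h2 := lap_le hg hm ee2
  linarith

/-- globalize a locally smooth map. -/
lemma glob {E F : Type*} [NormedAddCommGroup E] [NormedSpace ℝ E] [FiniteDimensional ℝ E]
    [NormedAddCommGroup F] [NormedSpace ℝ F] {T : Set E} (hT : IsOpen T) {x0 : E} (hx : x0 ∈ T)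
    {h : E → F} (hh : ContDiffOn ℝ ∞ h T) :
    ∃ g : E → F, ContDiff ℝ ∞ g ∧ HasCompactSupport g ∧
      ∃ ρ > 0, Metric.ball x0 ρ ⊆ T ∧ ∀ x ∈ Metric.ball x0 ρ, g x = h x := by
  obtain ⟨R, hR, hRT⟩ := Metric.isOpen_iff.1 hT x0 hx
  let φ : ContDiffBump x0 := ⟨R / 4, R / 2, by positivity, by linarith⟩
  have hcs : HasCompactSupport (fun x => φ x • h x) := by
    have := φ.hasCompactSupport
    exact this.smul_right
  refine ⟨fun x => φ x • h x, ?_, hcs, R / 4, by positivity, ?_, ?_⟩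
  · rw [contDiff_iff_contDiffAt]
    intro x
    by_cases hx : x ∈ T
    · exact (φ.contDiff.contDiffAt).smul (hh.contDiffAt (hT.mem_nhds hx))
    · have : x ∉ tsupport φ := by
        rw [φ.tsupport_eq]
        intro h'
        apply hx
        apply hRT
        exact Metric.closedBall_subset_ball (by show R / 2 < R; linarith) h'
      have h0 : (fun x => φ x • h x) =ᶠ[𝓝 x] fun _ => 0 := by
        filter_upwards [notMem_tsupport_iff_eventuallyEq.1 this] with y hy
        simp [hy]
      exact contDiffAt_const.congr_of_eventuallyEq h0
  · exact (Metric.ball_subset_ball (by linarith)).trans hRT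
  · intro x hx
    have : φ x = 1 := φ.one_of_mem_closedBall (Metric.ball_subset_closedBall hx)
    simp [this]

lemma lip_ball {E F : Type*} [NormedAddCommGroup E] [NormedSpace ℝ E] [FiniteDimensional ℝ E]
    [NormedAddCommGroup F] [NormedSpace ℝ F] {h : E → F} (hh : ContDiff ℝ ∞ h) (R : ℝ) :
    ∃ C, 0 ≤ C ∧ ∀ a ∈ Metric.closedBall (0 : E) R, ∀ b ∈ Metric.closedBall (0 : E) R,
      ‖h a - h b‖ ≤ C * ‖a - b‖ := by
  haveI := FiniteDimensional.proper ℝ E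
  obtain ⟨C, hC⟩ := (isCompact_closedBall (0 : E) R).exists_bound_of_continuousOn
    ((cdf hh).continuous.continuousOn)
  refine ⟨max C 0, le_max_right _ _, fun a ha b hb => ?_⟩
  exact (convex_closedBall (0 : E) R).norm_image_sub_le_of_norm_fderiv_le
    (fun x _ => cd1 hh x) (fun x hx => (hC x hx).trans (le_max_left _ _)) hb ha

lemma J0_apply (w : E2) : J0 w = (-w.2, w.1) := by simp [J0]

/-- the squared norm -/
def nn (W : E4 → E2) (x : E4) : ℝ := (W x).1 ^ 2 + (W x).2 ^ 2

lemma fst_sm {W : E4 → E2} (h : ContDiff ℝ ∞ W) : ContDiff ℝ ∞ (fun x => (W x).1) := contDiff_fst.comp h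
lemma snd_sm {W : E4 → E2} (h : ContDiff ℝ ∞ W) : ContDiff ℝ ∞ (fun x => (W x).2) := contDiff_snd.comp h
lemma nn_sm {W : E4 → E2} (h : ContDiff ℝ ∞ W) : ContDiff ℝ ∞ (nn W) :=
  ((fst_sm h).pow 2).add ((snd_sm h).pow 2)
lemma nn_nonneg (W : E4 → E2) (x : E4) : 0 ≤ nn W x := by unfold nn; positivity
lemma nn_eq_zero {W : E4 → E2} {x : E4} : nn W x = 0 ↔ W x = 0 := by
  unfold nn
  constructor
  · intro h
    have h1 : (W x).1 = 0 := by nlinarith [sq_nonneg (W x).1, sq_nonneg (W x).2]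
    have h2 : (W x).2 = 0 := by nlinarith [sq_nonneg (W x).1, sq_nonneg (W x).2]
    exact Prod.ext h1 h2
  · intro h; simp [h]

lemma fd_fst {W : E4 → E2} (h : ContDiff ℝ ∞ W) (x ξ : E4) :
    fderiv ℝ (fun x => (W x).1) x ξ = (fderiv ℝ W x ξ).1 := by
  have := (hasFDerivAt_fst (𝕜 := ℝ) (p := W x)).comp x (cd1 h x).hasFDerivAt
  rw [show (fun x => (W x).1) = Prod.fst ∘ W from rfl, this.fderiv]; rfl
lemma fd_snd {W : E4 → E2} (h : ContDiff ℝ ∞ W) (x ξ : E4) :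
    fderiv ℝ (fun x => (W x).2) x ξ = (fderiv ℝ W x ξ).2 := by
  have := (hasFDerivAt_snd (𝕜 := ℝ) (p := W x)).comp x (cd1 h x).hasFDerivAt
  rw [show (fun x => (W x).2) = Prod.snd ∘ W from rfl, this.fderiv]; rfl

lemma fd_nn {W : E4 → E2} (h : ContDiff ℝ ∞ W) (x ξ : E4) :
    fderiv ℝ (nn W) x ξ = 2 * ((W x).1 * (fderiv ℝ W x ξ).1 + (W x).2 * (fderiv ℝ W x ξ).2) := by
  have h1 := (cd1 (fst_sm h) x).hasFDerivAt
  have h2 := (cd1 (snd_sm h) x).hasFDerivAt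
  have := ((h1.mul h1).add (h2.mul h2))
  have e : nn W = (((fun x => (W x).1) * fun x => (W x).1) + (fun x => (W x).2) * fun x => (W x).2) := by
    funext y; simp [nn]; ring
  rw [e, this.fderiv]
  simp [fd_fst h, fd_snd h]; ring

lemma GG_nn {W : E4 → E2} (h : ContDiff ℝ ∞ W) (x ξ : E4) : GG J (nn W) (nn W) x ξ =
    4 * (((W x).1 * (fderiv ℝ W x ξ).1 + (W x).2 * (fderiv ℝ W x ξ).2) ^ 2 +
      ((W x).1 * (fderiv ℝ W x (J x ξ)).1 + (W x).2 * (fderiv ℝ W x (J x ξ)).2) ^ 2) := by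
  simp only [GG, fd_nn h]; ring

lemma LL_nn (hJ : JS J) {W : E4 → E2} (h : ContDiff ℝ ∞ W) (x ξ : E4) : LL J (nn W) x ξ =
    2 * ((fderiv ℝ W x ξ).1 ^ 2 + (fderiv ℝ W x ξ).2 ^ 2 + (fderiv ℝ W x (J x ξ)).1 ^ 2 +
      (fderiv ℝ W x (J x ξ)).2 ^ 2) + 2 * ((W x).1 * LL J (fun x => (W x).1) x ξ +
      (W x).2 * LL J (fun x => (W x).2) x ξ) := by
  have h1 := fst_sm h
  have h2 := snd_sm h
  have e : nn W = fun y => (fun y => (W y).1 * (W y).1) y + (fun y => (W y).2 * (W y).2) y := by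
    funext y; simp [nn]; ring
  rw [e, LL_add hJ (h1.mul h1) (h2.mul h2), LL_mul hJ h1 h1, LL_mul hJ h2 h2]
  simp only [GG, fd_fst h, fd_snd h]; ring

set_option maxHeartbeats 1000000 in
/-- pure inequality for (Q) -/
lemma Q_ineq {C w1 w2 d1 d2 e1 e2 l1 l2 s : ℝ} (hC : 0 ≤ C) (hs : 0 ≤ s) (hs2 : s ^ 2 = w1 ^ 2 + w2 ^ 2)
    (he1 : |e1| ≤ C * s) (he2 : |e2| ≤ C * s)
    (hl1 : |l1| ≤ C * (|d1| + |d2| + s)) (hl2 : |l2| ≤ C * (|d1| + |d2| + s)) {G L : ℝ}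
    (hG : G = 4 * ((w1 * d1 + w2 * d2) ^ 2 + (w1 * (-d2 + e1) + w2 * (d1 + e2)) ^ 2))
    (hL : L = 2 * (d1 ^ 2 + d2 ^ 2 + (-d2 + e1) ^ 2 + (d1 + e2) ^ 2) + 2 * (w1 * l1 + w2 * l2)) :
    G ≤ s ^ 2 * L + (1000 * (C + C ^ 2)) * s ^ 2 * (√G + s ^ 2) := by
  obtain ⟨A, hA, hA2⟩ : ∃ A : ℝ, 0 ≤ A ∧ A ^ 2 = d1 ^ 2 + d2 ^ 2 :=
    ⟨√(d1 ^ 2 + d2 ^ 2), Real.sqrt_nonneg _, Real.sq_sqrt (by positivity)⟩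
  have a1 : |d1| ≤ A := abs_le_of_sq_le_sq (by nlinarith) hA
  have a2 : |d2| ≤ A := abs_le_of_sq_le_sq (by nlinarith) hA
  have b1 : |w1| ≤ s := abs_le_of_sq_le_sq (by nlinarith) hs
  have b2 : |w2| ≤ s := abs_le_of_sq_le_sq (by nlinarith) hs
  have hCs : 0 ≤ C * s := by positivity
  -- cross terms
  set X := w1 * (-d2) + w2 * d1
  set E := w1 * e1 + w2 * e2
  have mulb : ∀ {a b p q : ℝ}, |a| ≤ p → |b| ≤ q → |a * b| ≤ p * q := by
    intro a b p q h1 h2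
    rw [abs_mul]; exact mul_le_mul h1 h2 (abs_nonneg _) ((abs_nonneg _).trans h1)
  have hX : |X| ≤ s * A := by
    apply abs_le_of_sq_le_sq _ (by positivity)
    have : X ^ 2 + (w1 * d1 + w2 * d2) ^ 2 = (w1 ^ 2 + w2 ^ 2) * (d1 ^ 2 + d2 ^ 2) := by simp only [X]; ring
    rw [mul_pow, hs2, hA2]; nlinarith [sq_nonneg (w1 * d1 + w2 * d2)]
  have hE : |E| ≤ 2 * C * s ^ 2 := by
    have := abs_add_le (w1 * e1) (w2 * e2)
    have := mulb b1 he1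
    have := mulb b2 he2
    simp only [E]; nlinarith
  have hG' : G = 4 * (s ^ 2 * A ^ 2 + 2 * (X * E) + E ^ 2) := by
    rw [hG, hs2, hA2]; simp only [X, E]; ring
  have hXE : |X * E| ≤ (s * A) * (2 * C * s ^ 2) := mulb hX hE
  have hE2 : E ^ 2 ≤ (2 * C * s ^ 2) ^ 2 := sq_le_sq' (by linarith [abs_le.1 hE]) (abs_le.1 hE).2
  have hlA : C * (|d1| + |d2| + s) ≤ C * (2 * A + s) := by gcongr; linarith
  have m1 := mulb a2 he1
  have m2 := mulb a1 he2
  have m3 := mulb b1 (hl1.trans hlA)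
  have m4 := mulb b2 (hl2.trans hlA)
  have hL' : L ≥ 4 * A ^ 2 - 4 * (2 * (A * (C * s))) - 2 * (2 * (s * (C * (2 * A + s)))) := by
    have q1 := (abs_le.1 m1).2
    have q2 := (abs_le.1 m2).1
    have q3 := (abs_le.1 m3).1
    have q4 := (abs_le.1 m4).1
    have q5 := sq_nonneg e1
    have q6 := sq_nonneg e2
    have : L = 4 * A ^ 2 - 4 * (d2 * e1) + 4 * (d1 * e2) + 2 * e1 ^ 2 + 2 * e2 ^ 2 +
      2 * (w1 * l1) + 2 * (w2 * l2) := by rw [hL, hA2]; ring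
    linarith
  set t := s * A with ht
  have ht0 : 0 ≤ t := by positivity
  have hGle : G ≤ 4 * t ^ 2 + 16 * C * t * s ^ 2 + 16 * C ^ 2 * s ^ 4 := by
    have q := (abs_le.1 hXE).2
    have : (2 * C * s ^ 2) ^ 2 = 4 * C ^ 2 * s ^ 4 := by ring
    have : t * (2 * C * s ^ 2) = 2 * (C * t * s ^ 2) := by ring
    have : s ^ 2 * A ^ 2 = t ^ 2 := by rw [ht]; ring
    linarith
  have hGge : G ≥ 4 * t ^ 2 - 16 * C * t * s ^ 2 := by
    have q := (abs_le.1 hXE).1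
    have : t * (2 * C * s ^ 2) = 2 * (C * t * s ^ 2) := by ring
    have : s ^ 2 * A ^ 2 = t ^ 2 := by rw [ht]; ring
    linarith [sq_nonneg E]
  have hsL : s ^ 2 * L ≥ 4 * t ^ 2 - 16 * C * t * s ^ 2 - 4 * C * s ^ 4 := by
    have q := mul_le_mul_of_nonneg_left hL' (sq_nonneg s)
    have : s ^ 2 * (4 * A ^ 2 - 4 * (2 * (A * (C * s))) - 2 * (2 * (s * (C * (2 * A + s)))))
      = 4 * t ^ 2 - 16 * C * t * s ^ 2 - 4 * C * s ^ 4 := by rw [ht]; ring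
    linarith
  have htG : t ≤ √G + 8 * C * s ^ 2 := by
    by_cases hc : t ≤ 8 * C * s ^ 2
    · linarith [Real.sqrt_nonneg G]
    · push Not at hc
      have : t ≤ √G := by
        apply Real.le_sqrt_of_sq_le
        have q := mul_le_mul_of_nonneg_left hc.le ht0
        have : t * (8 * C * s ^ 2) = 8 * C * t * s ^ 2 := by ring
        linarith [sq_nonneg t, sq t]
      have : 0 ≤ 8 * C * s ^ 2 := by positivity
      linarith
  have hR := Real.sqrt_nonneg G
  have h5 : 32 * C * t * s ^ 2 ≤ 32 * C * s ^ 2 * (√G + 8 * C * s ^ 2) := by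
    have q := mul_le_mul_of_nonneg_left htG (show 0 ≤ 32 * C * s ^ 2 by positivity)
    have : 32 * C * s ^ 2 * t = 32 * C * t * s ^ 2 := by ring
    linarith
  have h6 : 0 ≤ C * s ^ 2 * √G := by positivity
  have h7 : 0 ≤ C ^ 2 * s ^ 2 * √G := by positivity
  have h8 : 0 ≤ C * s ^ 4 := by positivity
  have h9 : 0 ≤ C ^ 2 * s ^ 4 := by positivity
  have e1 : 1000 * (C + C ^ 2) * s ^ 2 * (√G + s ^ 2) = 1000 * (C * s ^ 2 * √G) +
    1000 * (C ^ 2 * s ^ 2 * √G) + 1000 * (C * s ^ 4) + 1000 * (C ^ 2 * s ^ 4) := by ring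
  have e2 : 32 * C * s ^ 2 * (√G + 8 * C * s ^ 2) = 32 * (C * s ^ 2 * √G) + 256 * (C ^ 2 * s ^ 4) := by ring
  linarith

lemma inv_loc {E F : Type*} [NormedAddCommGroup E] [NormedSpace ℝ E] [FiniteDimensional ℝ E]
    [NormedAddCommGroup F] [NormedSpace ℝ F] [FiniteDimensional ℝ F] {Φ : E → F} {A : Set E}
    (hA : IsOpen A) {p0 : E} (hp : p0 ∈ A) (hΦ : ContDiffOn ℝ ∞ Φ A) (e : E ≃L[ℝ] F)
    (he : HasFDerivAt Φ (e : E →L[ℝ] F) p0) :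
    ∃ g : F → E, ContDiff ℝ ∞ g ∧ HasCompactSupport g ∧ ∃ A0 ⊆ A, IsOpen A0 ∧ p0 ∈ A0 ∧ ∃ ρ > 0,
      (∀ x ∈ Metric.ball (Φ p0) ρ, g x ∈ A0 ∧ Φ (g x) = x) ∧
      ∀ p ∈ A0, Φ p ∈ Metric.ball (Φ p0) ρ → g (Φ p) = p := by
  haveI := FiniteDimensional.complete ℝ E
  have hat : ∀ p ∈ A, ContDiffAt ℝ ∞ Φ p := fun p hp => hΦ.contDiffAt (hA.mem_nhds hp)
  set H := (hat p0 hp).toOpenPartialHomeomorph Φ he (by simp) with hH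
  have hHc : (H : E → F) = Φ := rfl
  have hfd : ContinuousOn (fderiv ℝ Φ) A := hΦ.continuousOn_fderiv_of_isOpen hA (by simp)
  have hop : IsOpen (A ∩ fderiv ℝ Φ ⁻¹' (Set.range ((↑) : (E ≃L[ℝ] F) → E →L[ℝ] F))) :=
    hfd.isOpen_inter_preimage hA (ContinuousLinearEquiv.isOpen)
  set A0 := H.source ∩ (A ∩ fderiv ℝ Φ ⁻¹' (Set.range ((↑) : (E ≃L[ℝ] F) → E →L[ℝ] F))) with hA0
  have hA0o : IsOpen A0 := H.open_source.inter hop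
  have hp0 : p0 ∈ A0 := ⟨(hat p0 hp).mem_toOpenPartialHomeomorph_source he (by simp), hp, e, he.fderiv.symm⟩
  have hTo : IsOpen (H '' A0) := H.isOpen_image_of_subset_source hA0o inter_subset_left
  have hsm : ContDiffOn ℝ ∞ H.symm (H '' A0) := by
    rintro _ ⟨p, hpA, rfl⟩
    obtain ⟨hps, hpA', e', he'⟩ := hpA
    apply ContDiffAt.contDiffWithinAt
    have hl := H.left_inv hps
    apply H.contDiffAt_symm (H.map_source hps) (f₀' := e')
    · rw [hl, he']; exact ((hat p hpA').differentiableAt (by simp)).hasFDerivAt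
    · rw [hl]; exact hat p hpA'
  obtain ⟨g, hg, hgc, ρ, hρ, hsub, heq⟩ := glob hTo (mem_image_of_mem H hp0) hsm
  refine ⟨g, hg, hgc, A0, fun p h => h.2.1, hA0o, hp0, ρ, hρ, ?_, ?_⟩
  · intro x hx
    have hxT := hsub hx
    rw [heq x hx]
    obtain ⟨p, hpA, rfl⟩ := hxT
    rw [H.left_inv hpA.1]; exact ⟨hpA, rfl⟩
  · intro p hpA hb
    rw [heq _ hb]
    exact H.left_inv hpA.1

structure Box (J : E4 → E4 →L[ℝ] E4) where
  (Ω : Set E2) (v : E2 → E4) (V : Set E4) (Z W : E4 → E2)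
  opV : IsOpen V
  jh : JH J v Ω
  Zs : ContDiff ℝ ∞ Z
  Ws : ContDiff ℝ ∞ W
  mV : ∀ z ∈ Ω, v z ∈ V
  zv : ∀ z ∈ Ω, Z (v z) = z
  wv : ∀ z ∈ Ω, W (v z) = 0
  back : ∀ x ∈ V, W x = 0 → Z x ∈ Ω ∧ v (Z x) = x
  dW : ∀ z ∈ Ω, ∀ ξ, fderiv ℝ W (v z) (J (v z) ξ) = J0 (fderiv ℝ W (v z) ξ)
  ker : ∀ z ∈ Ω, ∀ ξ, fderiv ℝ W (v z) ξ = 0 → ξ = fderiv ℝ v z (fderiv ℝ Z (v z) ξ)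
  small : ∀ x, nn W x ≤ 1 / 20
  Q : ∃ C, 0 ≤ C ∧ ∀ x ∈ V, ∀ ξ, Gq J x ξ = 1 → GG J (nn W) (nn W) x ξ ≤
    nn W x * LL J (nn W) x ξ + C * nn W x * (√(GG J (nn W) (nn W) x ξ) + nn W x)

def Box.sub (b : Box J) (O : Set E4) (hO : IsOpen O) : Box J where
  Ω := b.Ω ∩ b.v ⁻¹' O
  v := b.v
  V := b.V ∩ O
  Z := b.Z
  W := b.W
  opV := b.opV.inter hO
  jh := b.jh.mono (b.jh.sm.continuousOn.isOpen_inter_preimage b.jh.op hO) inter_subset_left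
  Zs := b.Zs
  Ws := b.Ws
  mV := fun z hz => ⟨b.mV z hz.1, hz.2⟩
  zv := fun z hz => b.zv z hz.1
  wv := fun z hz => b.wv z hz.1
  back := fun x hx h => by
    have := b.back x hx.1 h
    refine ⟨⟨this.1, ?_⟩, this.2⟩
    show b.v (b.Z x) ∈ O
    rw [this.2]; exact hx.2
  dW := fun z hz => b.dW z hz.1
  ker := fun z hz => b.ker z hz.1
  small := b.small
  Q := by
    obtain ⟨C, h0, h⟩ := b.Q
    exact ⟨C, h0, fun x hx => h x hx.1⟩

def frameL (j : E4 →L[ℝ] E4) (a n : E4) : E2 × E2 →L[ℝ] E4 :=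
  ((ContinuousLinearMap.fst ℝ ℝ ℝ).comp (ContinuousLinearMap.fst ℝ E2 E2)).smulRight a +
  ((ContinuousLinearMap.snd ℝ ℝ ℝ).comp (ContinuousLinearMap.fst ℝ E2 E2)).smulRight (j a) +
  ((ContinuousLinearMap.fst ℝ ℝ ℝ).comp (ContinuousLinearMap.snd ℝ E2 E2)).smulRight n +
  ((ContinuousLinearMap.snd ℝ ℝ ℝ).comp (ContinuousLinearMap.snd ℝ E2 E2)).smulRight (j n)

lemma frameL_apply (j : E4 →L[ℝ] E4) (a n : E4) (p : E2 × E2) :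
    frameL j a n p = p.1.1 • a + p.1.2 • j a + p.2.1 • n + p.2.2 • j n := by
  simp [frameL]

lemma frame_exists (j : E4 →L[ℝ] E4) (hj : ∀ ξ, j (j ξ) = -ξ) {a : E4} (ha : a ≠ 0) :
    ∃ n, ∃ e : (E2 × E2) ≃L[ℝ] E4, (e : E2 × E2 →L[ℝ] E4) = frameL j a n := by
  obtain ⟨n, hn⟩ : ∃ n : E4, n ∉ Submodule.span ℝ ({a, j a} : Set E4) := by
    by_contra hcon
    push Not at hcon
    have htop : Submodule.span ℝ ({a, j a} : Set E4) = ⊤ := Submodule.eq_top_iff'.2 hcon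
    have h1 := finrank_span_le_card (R := ℝ) ({a, j a} : Set E4)
    rw [htop, finrank_top] at h1
    have h2 : ({a, j a} : Set E4).toFinset.card ≤ 2 := by
      rw [Set.toFinset_insert, Set.toFinset_singleton]; exact Finset.card_le_two
    have h3 : Module.finrank ℝ E4 = 4 := by simp
    omega
  have key : ∀ p q : ℝ, ∀ ξ, p • (p • ξ + q • j ξ) - q • j (p • ξ + q • j ξ) = (p ^ 2 + q ^ 2) • ξ := by
    intro p q ξ
    rw [map_add, map_smul, map_smul, hj]; module
  have hinj : Function.Injective (frameL j a n).toLinearMap := by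
    rw [injective_iff_map_eq_zero]
    rintro ⟨⟨a1, a2⟩, w1, w2⟩ h
    have h' : a1 • a + a2 • j a + w1 • n + w2 • j n = 0 := by
      have := frameL_apply j a n ((a1, a2), w1, w2)
      simp only at this; rw [← this]; exact h
    have hw : w1 ^ 2 + w2 ^ 2 = 0 := by
      by_contra hne
      apply hn
      have e1 : w1 • n + w2 • j n = -(a1 • a + a2 • j a) := by
        rw [eq_neg_iff_add_eq_zero, ← h']; abel
      have e2 := key w1 w2 n
      rw [e1] at e2
      have e3 : n = (w1 ^ 2 + w2 ^ 2)⁻¹ • (w1 • -(a1 • a + a2 • j a) - w2 • j (-(a1 • a + a2 • j a))) := by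
        rw [e2, smul_smul, inv_mul_cancel₀ hne, one_smul]
      have ma : a ∈ Submodule.span ℝ ({a, j a} : Set E4) := Submodule.subset_span (by simp)
      have mj : j a ∈ Submodule.span ℝ ({a, j a} : Set E4) := Submodule.subset_span (by simp)
      rw [e3, map_neg, map_add, map_smul, map_smul, hj]
      refine Submodule.smul_mem _ _ (Submodule.sub_mem _ (Submodule.smul_mem _ _ (Submodule.neg_mem _
        (Submodule.add_mem _ (Submodule.smul_mem _ _ ma) (Submodule.smul_mem _ _ mj))))
        (Submodule.smul_mem _ _ (Submodule.neg_mem _ (Submodule.add_mem _ (Submodule.smul_mem _ _ mj)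
        (Submodule.smul_mem _ _ (Submodule.neg_mem _ ma))))))
    have hw1 : w1 = 0 := by nlinarith [sq_nonneg w1, sq_nonneg w2]
    have hw2 : w2 = 0 := by nlinarith [sq_nonneg w1, sq_nonneg w2]
    subst hw1; subst hw2
    have e4 := key a1 a2 a
    have e5 : a1 • a + a2 • j a = 0 := by simpa using h'
    rw [e5] at e4
    have e6 : (a1 ^ 2 + a2 ^ 2) = 0 := by
      by_contra hne
      have : (a1 ^ 2 + a2 ^ 2) • a = 0 := by rw [← e4]; simp
      exact ha ((smul_eq_zero.1 this).resolve_left hne)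
    have ha1 : a1 = 0 := by nlinarith [sq_nonneg a1, sq_nonneg a2]
    have ha2 : a2 = 0 := by nlinarith [sq_nonneg a1, sq_nonneg a2]
    subst ha1; subst ha2; rfl
  let e := LinearMap.linearEquivOfInjective (frameL j a n).toLinearMap hinj (by simp)
  refine ⟨n, e.toContinuousLinearEquiv, ?_⟩
  refine ContinuousLinearMap.ext fun p => ?_
  rfl

def PhiM (J : E4 → E4 →L[ℝ] E4) (v : E2 → E4) (n : E4) (p : E2 × E2) : E4 :=
  v p.1 + p.2.1 • n + p.2.2 • J (v p.1) n

lemma PhiM_sm (hJ : JS J) {v : E2 → E4} {D : Set E2} (h : JH J v D) (n : E4) :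
    ContDiffOn ℝ ∞ (PhiM J v n) (D ×ˢ univ) := by
  have h1 : ContDiffOn ℝ ∞ (fun p : E2 × E2 => v p.1) (D ×ˢ univ) :=
    h.sm.comp contDiff_fst.contDiffOn (fun p hp => hp.1)
  have h2 : ContDiffOn ℝ ∞ (fun p : E2 × E2 => J (v p.1) n) (D ×ˢ univ) :=
    (hJ.sm.comp_contDiffOn h1).clm_apply contDiffOn_const
  have c1 : ContDiff ℝ ∞ (fun p : E2 × E2 => p.2.1) := contDiff_fst.comp contDiff_snd
  have c2 : ContDiff ℝ ∞ (fun p : E2 × E2 => p.2.2) := contDiff_snd.comp contDiff_snd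
  exact (h1.add (c1.contDiffOn.smul contDiffOn_const)).add (c2.contDiffOn.smul h2)

lemma PhiM_fd (hJ : JS J) {v : E2 → E4} {D : Set E2} (h : JH J v D) (n : E4) {z : E2} (hz : z ∈ D) :
    HasFDerivAt (PhiM J v n) (frameL (J (v z)) (vx v z) n) (z, 0) := by
  have h1 : HasFDerivAt (fun p : E2 × E2 => v p.1) ((fderiv ℝ v z).comp (ContinuousLinearMap.fst ℝ E2 E2)) ((z, 0) : E2 × E2) :=
    HasFDerivAt.comp (g := v) (f := Prod.fst) ((z, 0) : E2 × E2) (h.df hz).hasFDerivAt hasFDerivAt_fst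
  have h2 : HasFDerivAt (fun p : E2 × E2 => J (v p.1) n) (fderiv ℝ (fun p : E2 × E2 => J (v p.1) n) (z, 0)) ((z, 0) : E2 × E2) := by
    apply DifferentiableAt.hasFDerivAt
    have hd : DifferentiableAt ℝ (fun p : E2 × E2 => J (v p.1)) (z, 0) :=
      DifferentiableAt.comp (g := J) (f := fun p : E2 × E2 => v p.1) ((z, 0) : E2 × E2)
      (cd1 hJ.sm _) h1.differentiableAt
    exact hd.clm_apply (differentiableAt_const n)
  have c1 : HasFDerivAt (fun p : E2 × E2 => p.2.1) ((ContinuousLinearMap.fst ℝ ℝ ℝ).comp (ContinuousLinearMap.snd ℝ E2 E2)) ((z, 0) : E2 × E2) :=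
    ((ContinuousLinearMap.fst ℝ ℝ ℝ).comp (ContinuousLinearMap.snd ℝ E2 E2)).hasFDerivAt
  have c2 : HasFDerivAt (fun p : E2 × E2 => p.2.2) ((ContinuousLinearMap.snd ℝ ℝ ℝ).comp (ContinuousLinearMap.snd ℝ E2 E2)) ((z, 0) : E2 × E2) :=
    ((ContinuousLinearMap.snd ℝ ℝ ℝ).comp (ContinuousLinearMap.snd ℝ E2 E2)).hasFDerivAt
  have := (h1.add (c1.smul (hasFDerivAt_const n _))).add (c2.smul h2)
  refine HasFDerivAt.congr_fderiv (f := PhiM J v n) this ?_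
  refine ContinuousLinearMap.ext fun p => ?_
  rw [frameL_apply]
  simp [h.fd_apply hz]

lemma frameL_J0 {j : E4 →L[ℝ] E4} (hj : ∀ ξ, j (j ξ) = -ξ) (a n : E4) (p : E2 × E2) :
    j (frameL j a n p) = frameL j a n (J0 p.1, J0 p.2) := by
  rw [frameL_apply, frameL_apply, J0_apply, J0_apply]
  simp only [map_add, map_smul, hj]
  module

lemma raw_box (hJ : JS J) {v : E2 → E4} {D : Set E2} (h : JH J v D) {z0 : E2} (hz0 : z0 ∈ D)
    (hne : vx v z0 ≠ 0) : ∃ (Z W : E4 → E2) (n : E4) (ρ : ℝ) (D0 : Set E2),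
      ContDiff ℝ ∞ Z ∧ ContDiff ℝ ∞ W ∧ 0 < ρ ∧ IsOpen D0 ∧ D0 ⊆ D ∧ z0 ∈ D0 ∧ (∀ x, nn W x ≤ 1 / 20) ∧
      (∀ x ∈ Metric.ball (v z0) ρ, Z x ∈ D ∧ x = v (Z x) + (W x).1 • n + (W x).2 • J (v (Z x)) n) ∧
      (∀ z ∈ D0, v z ∈ Metric.ball (v z0) ρ → Z (v z) = z ∧ W (v z) = 0) ∧
      (∀ x ∈ Metric.ball (v z0) ρ, W x = 0 → Z x ∈ D0 ∧ v (Z x) = x) ∧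
      (∀ z ∈ D0, v z ∈ Metric.ball (v z0) ρ → ∀ ξ, fderiv ℝ W (v z) (J (v z) ξ) = J0 (fderiv ℝ W (v z) ξ)) ∧
      (∀ z ∈ D0, v z ∈ Metric.ball (v z0) ρ → ∀ ξ, fderiv ℝ W (v z) ξ = 0 →
        ξ = fderiv ℝ v z (fderiv ℝ Z (v z) ξ)) := by
  obtain ⟨n, e, he⟩ := frame_exists (J (v z0)) (hJ.sq _) hne
  have hfd := PhiM_fd hJ h n hz0
  rw [← he] at hfd
  have hop : IsOpen (D ×ˢ (univ : Set E2)) := h.op.prod isOpen_univ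
  have hP0 : ∀ z, PhiM J v n (z, 0) = v z := by intro z; simp [PhiM]
  obtain ⟨g, hg, hgc, A0, hA0, hA0o, hp0, ρ, hρ, hg1, hg2⟩ := inv_loc hop (p0 := (z0, 0)) ⟨hz0, mem_univ _⟩
    (PhiM_sm hJ h n) e hfd
  rw [hP0] at hg1 hg2
  obtain ⟨M, hM⟩ := hgc.exists_bound_of_continuous hg.continuous
  have hM0 : 0 ≤ M := (norm_nonneg _).trans (hM 0)
  set σ : ℝ := 1 / (10 * (M + 1)) with hσ
  have hσ0 : 0 < σ := by positivity
  have hD0o : IsOpen {z : E2 | (z, (0 : E2)) ∈ A0} := hA0o.preimage (by fun_prop)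
  have hZs : ContDiff ℝ ∞ (fun x => (g x).1) := contDiff_fst.comp hg
  have hW0s : ContDiff ℝ ∞ (fun x => (g x).2) := contDiff_snd.comp hg
  have hWs : ContDiff ℝ ∞ (fun x => σ • (g x).2) := hW0s.const_smul σ
  have hgd : ∀ x, HasFDerivAt g (fderiv ℝ g x) x := fun x => (cd1 hg x).hasFDerivAt
  have dZ : ∀ x ξ, fderiv ℝ (fun x => (g x).1) x ξ = (fderiv ℝ g x ξ).1 := by
    intro x ξ
    have := (hasFDerivAt_fst (𝕜 := ℝ) (p := g x)).comp x (hgd x)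
    rw [show (fun x => (g x).1) = Prod.fst ∘ g from rfl, this.fderiv]; rfl
  have dW : ∀ x ξ, fderiv ℝ (fun x => σ • (g x).2) x ξ = σ • (fderiv ℝ g x ξ).2 := by
    intro x ξ
    have := ((hasFDerivAt_snd (𝕜 := ℝ) (p := g x)).comp x (hgd x)).const_smul σ
    rw [show (fun x => σ • (g x).2) = σ • (Prod.snd ∘ g) from rfl, this.fderiv]; rfl
  have i1 : ∀ z, (z, (0 : E2)) ∈ A0 → v z ∈ Metric.ball (v z0) ρ → g (v z) = (z, 0) := by
    intro z hz hb
    have := hg2 (z, 0) hz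
    rw [hP0] at this; exact this hb
  have i2 : ∀ z, (z, (0 : E2)) ∈ A0 → v z ∈ Metric.ball (v z0) ρ → ∀ p,
      fderiv ℝ g (v z) (frameL (J (v z)) (vx v z) n p) = p := by
    intro z hz hb p
    have hzD : z ∈ D := (hA0 hz).1
    have hf := PhiM_fd hJ h n hzD
    have hgd' := hgd (v z)
    rw [← hP0] at hgd'
    have hc := hgd'.comp (z, (0 : E2)) hf
    have hid : g ∘ PhiM J v n =ᶠ[𝓝 (z, (0 : E2))] id := by
      have c := hf.continuousAt.preimage_mem_nhds (Metric.isOpen_ball.mem_nhds (by rw [hP0]; exact hb))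
      filter_upwards [hA0o.mem_nhds hz, c] with q hq hqb
      exact hg2 q hq hqb
    have := (hc.congr_of_eventuallyEq hid.symm).unique (hasFDerivAt_id _)
    have := DFunLike.congr_fun this p
    simpa [hP0] using this
  have i3 : ∀ z, (z, (0 : E2)) ∈ A0 → v z ∈ Metric.ball (v z0) ρ → ∀ ξ,
      frameL (J (v z)) (vx v z) n (fderiv ℝ g (v z) ξ) = ξ := by
    intro z hz hb ξ
    have hzD : z ∈ D := (hA0 hz).1
    have hf := PhiM_fd hJ h n hzD
    rw [← i1 z hz hb] at hf
    have hc := hf.comp (v z) (hgd (v z))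
    have hid : PhiM J v n ∘ g =ᶠ[𝓝 (v z)] id := by
      filter_upwards [Metric.isOpen_ball.mem_nhds hb] with q hq
      exact (hg1 q hq).2
    have := (hc.congr_of_eventuallyEq hid.symm).unique (hasFDerivAt_id _)
    exact DFunLike.congr_fun this ξ
  refine ⟨fun x => (g x).1, fun x => σ • (g x).2, σ⁻¹ • n, ρ, {z | (z, (0 : E2)) ∈ A0}, hZs, hWs, hρ,
    hD0o, fun z hz => (hA0 hz).1, hp0, ?_, ?_, ?_, ?_, ?_, ?_⟩
  · intro x
    have h1 : |(g x).2.1| ≤ M := ((norm_fst_le (g x).2).trans (norm_snd_le (g x))).trans (hM x)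
    have h2 : |(g x).2.2| ≤ M := ((norm_snd_le (g x).2).trans (norm_snd_le (g x))).trans (hM x)
    have h3 : σ * M ≤ 1 / 10 := by
      rw [hσ, div_mul_eq_mul_div, div_le_div_iff₀ (by positivity) (by norm_num)]; linarith
    have h4 : |σ * (g x).2.1| ≤ 1 / 10 := by
      rw [abs_mul, abs_of_pos hσ0]; exact (mul_le_mul_of_nonneg_left h1 hσ0.le).trans h3
    have h5 : |σ * (g x).2.2| ≤ 1 / 10 := by
      rw [abs_mul, abs_of_pos hσ0]; exact (mul_le_mul_of_nonneg_left h2 hσ0.le).trans h3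
    have h6 := sq_le_sq' (abs_le.1 h4).1 (abs_le.1 h4).2
    have h7 := sq_le_sq' (abs_le.1 h5).1 (abs_le.1 h5).2
    simp only [nn, Prod.smul_fst, Prod.smul_snd, smul_eq_mul]
    norm_num at h6 h7 ⊢; linarith
  · intro x hx
    obtain ⟨ha, hb⟩ := hg1 x hx
    refine ⟨(hA0 ha).1, ?_⟩
    conv_lhs => rw [← hb, PhiM]
    simp only [Prod.smul_fst, Prod.smul_snd, smul_eq_mul, map_smul, smul_smul]
    have : ∀ t : ℝ, σ * t * σ⁻¹ = t := by intro t; field_simp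
    rw [this, this]
  · intro z hz hb
    simp [i1 z hz hb]
  · intro x hx hw
    obtain ⟨ha, hb⟩ := hg1 x hx
    have h0 : (g x).2 = 0 := (smul_eq_zero.1 hw).resolve_left hσ0.ne'
    have : g x = ((g x).1, 0) := Prod.ext rfl h0
    refine ⟨?_, ?_⟩
    · show ((g x).1, (0 : E2)) ∈ A0
      rw [← this]; exact ha
    · show v (g x).1 = x
      rw [← hP0, ← this, hb]
  · intro z hz hb ξ
    have e1 := i3 z hz hb ξ
    rw [dW, dW, map_smul]
    congr 1
    conv_lhs => rw [← e1]
    rw [frameL_J0 (hJ.sq _), i2 z hz hb]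
  · intro z hz hb ξ h0
    rw [dW] at h0
    have h0 : (fderiv ℝ g (v z) ξ).2 = 0 := (smul_eq_zero.1 h0).resolve_left hσ0.ne'
    have e1 := i3 z hz hb ξ
    rw [dZ, h.fd_apply (hA0 hz).1]
    conv_lhs => rw [← e1, frameL_apply, h0]
    simp

set_option maxHeartbeats 4000000 in
lemma box_exists (hJ : JS J) {v : E2 → E4} {D : Set E2} (h : JH J v D) {z0 : E2} (hz0 : z0 ∈ D)
    (hne : vx v z0 ≠ 0) : ∃ b : Box J, z0 ∈ b.Ω ∧ b.v = v := by
  obtain ⟨Z, W, n, ρ, D0, hZ, hW, hρ, hD0o, hD0, hz00, hsmall, r1, r2, r3, r4, r5⟩ := raw_box hJ h hz0 hne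
  set x0 := v z0 with hx0
  have hx0b : x0 ∈ Metric.ball x0 ρ := Metric.mem_ball_self hρ
  have hvZ : ContDiffOn ℝ ∞ (fun x => v (Z x)) (Metric.ball x0 ρ) :=
    h.sm.comp hZ.contDiffOn (fun x hx => (r1 x hx).1)
  obtain ⟨u, hu, huc, ρ1, hρ1, hsub, heq⟩ := glob Metric.isOpen_ball hx0b hvZ
  have hZ0 : Z x0 = z0 := (r2 z0 hz00 hx0b).1
  have hux0 : u x0 = x0 := by rw [heq x0 (Metric.mem_ball_self hρ1), hZ0]
  obtain ⟨ρ2, hρ2, hb2⟩ : ∃ ρ2 > 0, Metric.ball x0 ρ2 ⊆ Metric.ball x0 ρ1 ∩ Z ⁻¹' D0 ∩ u ⁻¹' (Metric.ball x0 ρ1) := by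
    apply Metric.isOpen_iff.1
    · exact (Metric.isOpen_ball.inter (hD0o.preimage hZ.continuous)).inter (Metric.isOpen_ball.preimage hu.continuous)
    · refine ⟨⟨Metric.mem_ball_self hρ1, ?_⟩, ?_⟩
      · show Z x0 ∈ D0; rw [hZ0]; exact hz00
      · show u x0 ∈ Metric.ball x0 ρ1; rw [hux0]; exact Metric.mem_ball_self hρ1
  have hR : ContDiff ℝ ∞ (fun x => J (u x) n) := (hJ.sm.comp hu).clm_apply contDiff_const
  have hΩo : IsOpen (D0 ∩ v ⁻¹' Metric.ball x0 ρ2) :=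
    (h.sm.continuousOn.mono hD0).isOpen_inter_preimage hD0o Metric.isOpen_ball
  have hVρ : Metric.ball x0 ρ2 ⊆ Metric.ball x0 ρ := fun x hx => hsub (hb2 hx).1.1
  -- constants
  set R0 := ‖x0‖ + ρ1 with hR0
  have hbR : ∀ x ∈ Metric.ball x0 ρ1, ‖x‖ ≤ R0 := by
    intro x hx
    have := norm_add_le (x - x0) x0
    rw [sub_add_cancel] at this
    rw [Metric.mem_ball, dist_eq_norm] at hx
    linarith
  obtain ⟨C0, hC0, hξ⟩ := bdd2 hJ (Ψ := fun x ξ => ‖ξ‖ ^ 2) (by fun_prop)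
    (fun x ξ t => by rw [norm_smul, mul_pow, Real.norm_eq_abs, sq_abs]) (isCompact_closedBall (0 : E4) R0)
  obtain ⟨A1, hA1⟩ := (isCompact_closedBall (0 : E4) R0).exists_bound_of_continuousOn hR.continuous.continuousOn
  obtain ⟨A2, hA2⟩ := (isCompact_closedBall (0 : E4) R0).exists_bound_of_continuousOn (cdf hR).continuous.continuousOn
  obtain ⟨A3, hA3⟩ := (isCompact_closedBall (0 : E4) R0).exists_bound_of_continuousOn (cdf hu).continuous.continuousOn
  have hx0R : x0 ∈ Metric.closedBall (0 : E4) R0 := by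
    rw [mem_closedBall_zero_iff]; exact hbR x0 (Metric.mem_ball_self hρ1)
  have hA1' : 0 ≤ A1 := (norm_nonneg _).trans (hA1 x0 hx0R)
  have hA2' : 0 ≤ A2 := (norm_nonneg _).trans (hA2 x0 hx0R)
  have hA3' : 0 ≤ A3 := (norm_nonneg _).trans (hA3 x0 hx0R)
  set B := √C0 with hB
  have hB0 : 0 ≤ B := Real.sqrt_nonneg _
  set RR := R0 + B + A3 * B with hRR
  have hΨ1 : ContDiff ℝ ∞ (fun p : E4 × E4 => fderiv ℝ W p.1 (J p.1 p.2) - J0 (fderiv ℝ W p.1 p.2)) :=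
    (((cdf hW).comp contDiff_fst).clm_apply (JJ_sm hJ)).sub
      (J0.contDiff.comp (((cdf hW).comp contDiff_fst).clm_apply contDiff_snd))
  obtain ⟨C3, hC3, hL3⟩ := lip_ball hΨ1 RR
  obtain ⟨C4, hC4, hL4⟩ := lip_ball (LL_sm hJ (fst_sm hW)) RR
  obtain ⟨C5, hC5, hL5⟩ := lip_ball (LL_sm hJ (snd_sm hW)) RR
  set C1 := ‖n‖ + A1 with hC1
  set C2 := ‖n‖ + A1 + A2 * B with hC2
  set C := C3 * C1 + (C4 + C5) * (C1 + C2) with hC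
  have hn := norm_nonneg n
  have hC10 : 0 ≤ C1 := by positivity
  have hC20 : 0 ≤ C2 := by positivity
  have hCp : 0 ≤ C := by positivity
  let b : Box J :=
  { Ω := D0 ∩ v ⁻¹' Metric.ball x0 ρ2, v := v, V := Metric.ball x0 ρ2, Z := Z, W := W
    opV := Metric.isOpen_ball
    jh := h.mono hΩo (fun z hz => hD0 hz.1)
    Zs := hZ, Ws := hW
    mV := fun z hz => hz.2
    zv := fun z hz => (r2 z hz.1 (hVρ hz.2)).1
    wv := fun z hz => (r2 z hz.1 (hVρ hz.2)).2
    back := by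
      intro x hx hw
      have := r3 x (hVρ hx) hw
      refine ⟨⟨this.1, ?_⟩, this.2⟩
      show v (Z x) ∈ Metric.ball x0 ρ2; rw [this.2]; exact hx
    dW := fun z hz => r4 z hz.1 (hVρ hz.2)
    ker := fun z hz => r5 z hz.1 (hVρ hz.2)
    small := hsmall
    Q := by
      refine ⟨1000 * (C + C ^ 2), by positivity, ?_⟩
      intro x hx ξ hG
      obtain ⟨⟨hx1, hxD⟩, hxu⟩ := hb2 hx
      have hxD : Z x ∈ D0 := hxD
      have hxu : u x ∈ Metric.ball x0 ρ1 := hxu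
      have hxR := hbR x hx1
      have hxR' : x ∈ Metric.closedBall (0 : E4) R0 := by rwa [mem_closedBall_zero_iff]
      have hyR := hbR _ hxu
      have huv : u x = v (Z x) := heq x hx1
      have hξB : ‖ξ‖ ≤ B := by
        have := hξ x hxR' ξ
        rw [hG, mul_one, abs_of_nonneg (by positivity)] at this
        exact Real.le_sqrt_of_sq_le this
      set s := √(nn W x) with hs
      have hs0 : 0 ≤ s := Real.sqrt_nonneg _
      have hs2 : s ^ 2 = (W x).1 ^ 2 + (W x).2 ^ 2 := Real.sq_sqrt (nn_nonneg W x)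
      have hw1 : |(W x).1| ≤ s := Real.abs_le_sqrt (by unfold nn; nlinarith [sq_nonneg (W x).2])
      have hw2 : |(W x).2| ≤ s := Real.abs_le_sqrt (by unfold nn; nlinarith [sq_nonneg (W x).1])
      set η := fderiv ℝ u x ξ with hη
      set d1 := (fderiv ℝ W x ξ).1 with hd1
      set d2 := (fderiv ℝ W x ξ).2 with hd2
      have hxy : ‖x - u x‖ ≤ C1 * s := by
        have e : x - u x = (W x).1 • n + (W x).2 • J (u x) n := by
          rw [huv]; nth_rewrite 1 [(r1 x (hVρ hx)).2]; abel
        rw [e]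
        refine (norm_add_le _ _).trans ?_
        rw [norm_smul, norm_smul, Real.norm_eq_abs, Real.norm_eq_abs, hC1]
        linarith [mul_le_mul hw2 (hA1 x hxR') (norm_nonneg _) hs0,
          mul_le_mul_of_nonneg_right hw1 hn]
      have hξη : ‖ξ - η‖ ≤ C2 * (|d1| + |d2| + s) := by
        have hev : (fun y => y) =ᶠ[𝓝 x] fun y => u y + ((W y).1 • n + (W y).2 • J (u y) n) := by
          filter_upwards [Metric.isOpen_ball.mem_nhds hx1] with y hy
          rw [heq y hy, ← add_assoc]
          exact (r1 y (hsub hy)).2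
        have f1 := (cd1 (fst_sm hW) x).hasFDerivAt.smul_const n
        have f2 := (cd1 (snd_sm hW) x).hasFDerivAt.smul (cd1 hR x).hasFDerivAt
        have f3 := (cd1 hu x).hasFDerivAt.add (f1.add f2)
        have f4 := (f3.congr_of_eventuallyEq hev).unique (hasFDerivAt_id x)
        have f5 := DFunLike.congr_fun f4 ξ
        simp only [ContinuousLinearMap.add_apply, ContinuousLinearMap.smulRight_apply,
          ContinuousLinearMap.smul_apply, fd_fst hW, fd_snd hW, ContinuousLinearMap.id_apply,
          ContinuousLinearMap.coe_id', id] at f5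
        have e : ξ - η = d1 • n + ((W x).2 • fderiv ℝ (fun x => J (u x) n) x ξ + d2 • J (u x) n) := by
          rw [hη, hd1, hd2]; nth_rewrite 1 [← f5]; abel
        rw [e]
        refine (norm_add_le _ _).trans ((add_le_add_right (norm_add_le _ _) _).trans ?_)
        rw [norm_smul, norm_smul, norm_smul, Real.norm_eq_abs, Real.norm_eq_abs, Real.norm_eq_abs]
        have g1 := ((fderiv ℝ (fun x => J (u x) n) x).le_opNorm ξ).trans
          (mul_le_mul (hA2 x hxR') hξB (norm_nonneg _) hA2')
        have g2 := mul_le_mul hw2 g1 (norm_nonneg _) hs0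
        have g3 := mul_le_mul_of_nonneg_left (hA1 x hxR') (abs_nonneg d2)
        have a1 := abs_nonneg d1
        have a2 := abs_nonneg d2
        have : 0 ≤ A2 * B := by positivity
        rw [hC2]
        linarith [mul_nonneg a1 hA1', mul_nonneg a2 hn, mul_nonneg hs0 hn, mul_nonneg hs0 hA1',
          mul_nonneg a1 this, mul_nonneg a2 this]
      have hyb : v (Z x) ∈ Metric.ball x0 ρ := by rw [← huv]; exact hsub hxu
      have hηB : ‖η‖ ≤ A3 * B := ((fderiv ℝ u x).le_opNorm ξ).trans
          (mul_le_mul (hA3 x hxR') hξB (norm_nonneg _) hA3')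
      have hAB : 0 ≤ A3 * B := by positivity
      have hR0' : 0 ≤ R0 := (norm_nonneg _).trans hxR
      have m1 : (x, ξ) ∈ Metric.closedBall (0 : E4 × E4) RR := by
        rw [mem_closedBall_zero_iff, Prod.norm_def]; exact max_le (by simp only; linarith) (by simp only; linarith)
      have m2 : (u x, ξ) ∈ Metric.closedBall (0 : E4 × E4) RR := by
        rw [mem_closedBall_zero_iff, Prod.norm_def]; exact max_le (by simp only; linarith) (by simp only; linarith)
      have m3 : (u x, η) ∈ Metric.closedBall (0 : E4 × E4) RR := by
        rw [mem_closedBall_zero_iff, Prod.norm_def]; exact max_le (by simp only; linarith) (by simp only; linarith)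
      have k1 := hL3 _ m1 _ m2
      have k0 : fderiv ℝ W (u x) (J (u x) ξ) - J0 (fderiv ℝ W (u x) ξ) = 0 := by
        rw [huv, r4 _ hxD hyb, sub_self]
      simp only [k0, sub_zero, Prod.mk_sub_mk, sub_self, Prod.norm_mk, norm_zero] at k1
      rw [max_eq_left (norm_nonneg _)] at k1
      -- second order
      have hηf : η = fderiv ℝ v (Z x) (fderiv ℝ Z x ξ) := by
        have hev : u =ᶠ[𝓝 x] fun y => v (Z y) := by
          filter_upwards [Metric.isOpen_ball.mem_nhds hx1] with y hy using heq y hy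
        rw [hη, hev.fderiv_eq, show (fun y => v (Z y)) = v ∘ Z from rfl,
          fderiv_comp x (h.df (hD0 hxD)) (cd1 hZ x)]
        rfl
      have hz : ∀ f : E4 → ℝ, ContDiff ℝ ∞ f → (∀ z ∈ D0, v z ∈ Metric.ball x0 ρ → f (v z) = 0) →
          LL J f (u x) η = 0 := by
        intro f hf h0
        rw [hηf, h.fd_apply (hD0 hxD), huv, LL_rot hJ, h.pullL hJ (hD0 hxD) hf]
        have hev : ∀ᶠ w in 𝓝 (Z x), f (v w) = 0 := by
          have o : IsOpen (D0 ∩ v ⁻¹' Metric.ball x0 ρ) :=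
            (h.sm.continuousOn.mono hD0).isOpen_inter_preimage hD0o Metric.isOpen_ball
          filter_upwards [o.mem_nhds ⟨hxD, hyb⟩] with w hw using h0 w hw.1 hw.2
        have hev2 : ∀ e, ∀ᶠ w in 𝓝 (Z x), fderiv ℝ (fun w => f (v w)) w e = 0 := by
          intro e
          filter_upwards [hev.eventually_nhds] with w hw
          have : (fun w => f (v w)) =ᶠ[𝓝 w] fun _ => 0 := hw
          rw [this.fderiv_eq]; simp
        have hev3 : ∀ e, fderiv ℝ (fun w => fderiv ℝ (fun w => f (v w)) w e) (Z x) = 0 := by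
          intro e
          have : (fun w => fderiv ℝ (fun w => f (v w)) w e) =ᶠ[𝓝 (Z x)] fun _ => 0 := hev2 e
          rw [this.fderiv_eq]; simp
        rw [hev3, hev3]; simp
      have k2 := hL4 _ m1 _ m3
      have k3 := hL5 _ m1 _ m3
      simp only [hz _ (fst_sm hW) (fun z hz hb => by rw [(r2 z hz hb).2]; rfl), sub_zero, Prod.mk_sub_mk] at k2
      simp only [hz _ (snd_sm hW) (fun z hz hb => by rw [(r2 z hz hb).2]; rfl), sub_zero, Prod.mk_sub_mk] at k3
      have a1 := abs_nonneg d1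
      have a2 := abs_nonneg d2
      have k4 : ‖(x - u x, ξ - η)‖ ≤ (C1 + C2) * (|d1| + |d2| + s) := by
        rw [Prod.norm_def]
        refine max_le ?_ ?_
        · simp only; linarith [hxy, mul_nonneg hC10 a1, mul_nonneg hC10 a2, mul_nonneg hC20 (by positivity : 0 ≤ |d1| + |d2| + s)]
        · simp only; linarith [hξη, mul_nonneg hC10 (by positivity : 0 ≤ |d1| + |d2| + s)]
      have k5 : ‖fderiv ℝ W x (J x ξ) - J0 (fderiv ℝ W x ξ)‖ ≤ C * s := by
        refine k1.trans ?_
        have := mul_le_mul_of_nonneg_left hxy hC3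
        have : 0 ≤ (C4 + C5) * (C1 + C2) * s := by positivity
        rw [hC]; linarith
      rw [Real.norm_eq_abs] at k2 k3
      have hsum : 0 ≤ |d1| + |d2| + s := by positivity
      have p1 : 0 ≤ C3 * C1 * (|d1| + |d2| + s) := by positivity
      have p2 : 0 ≤ C4 * (C1 + C2) * (|d1| + |d2| + s) := by positivity
      have p3 : 0 ≤ C5 * (C1 + C2) * (|d1| + |d2| + s) := by positivity
      have hl1 : |LL J (fun x => (W x).1) x ξ| ≤ C * (|d1| + |d2| + s) := by
        refine k2.trans ((mul_le_mul_of_nonneg_left k4 hC4).trans ?_)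
        rw [hC]; linarith
      have hl2 : |LL J (fun x => (W x).2) x ξ| ≤ C * (|d1| + |d2| + s) := by
        refine k3.trans ((mul_le_mul_of_nonneg_left k4 hC5).trans ?_)
        rw [hC]; linarith
      set e := fderiv ℝ W x (J x ξ) - J0 (fderiv ℝ W x ξ) with he
      have he1 : |e.1| ≤ C * s := (norm_fst_le e).trans k5
      have he2 : |e.2| ≤ C * s := (norm_snd_le e).trans k5
      have q1 : (fderiv ℝ W x (J x ξ)).1 = -d2 + e.1 := by rw [he, J0_apply]; simp [hd2]
      have q2 : (fderiv ℝ W x (J x ξ)).2 = d1 + e.2 := by rw [he, J0_apply]; simp [hd1]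
      have hGe := GG_nn (J := J) hW x ξ
      have hLe := LL_nn hJ hW x ξ
      rw [q1, q2] at hGe hLe
      have := Q_ineq hCp hs0 hs2 he1 he2 hl1 hl2 hGe hLe
      rw [Real.sq_sqrt (nn_nonneg W x)] at this
      exact this }
  exact ⟨b, ⟨hz00, Metric.mem_ball_self hρ2⟩, rfl⟩

def Box.D (b : Box J) : Set E4 := b.V ∩ {x | b.W x = 0}

lemma Box.mD (b : Box J) {z : E2} (hz : z ∈ b.Ω) : b.v z ∈ b.D := ⟨b.mV z hz, b.wv z hz⟩

lemma cover (hJ : JS J) {C : Set E4}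
    (h : ∀ x ∈ C, ∃ V : Set E4, IsOpen V ∧ x ∈ V ∧ ∃ D v, JH J v D ∧ IsRegularOn v D ∧ C ∩ V = v '' D)
    (hne : C.Nonempty) : ∃ b : ℕ → Box J, C ⊆ ⋃ k, (b k).D := by
  choose! V hVo hxV D v hv hr hC using h
  obtain ⟨T, hTC, hTc, hT⟩ := TopologicalSpace.isOpen_biUnion_countable C V hVo
  have hbx : ∀ x ∈ C, ∃ B : Set (Box J), B.Countable ∧ C ∩ V x ⊆ ⋃ b ∈ B, Box.D b := by
    intro x hx
    have hb : ∀ z ∈ D x, ∃ b : Box J, z ∈ b.Ω ∧ b.v = v x := fun z hz =>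
      box_exists hJ (hv x hx) hz ((hv x hx).vx_ne hz (hr x hx z hz))
    obtain ⟨x', hx'⟩ := hne
    have hbne : Nonempty (Box J) := by
      obtain ⟨z, hz, _⟩ : x ∈ v x '' D x := hC x hx ▸ ⟨hx, hxV x hx⟩
      exact ⟨(hb z hz).choose⟩
    choose! b hbΩ hbv using hb
    obtain ⟨S, hSD, hSc, hS⟩ := TopologicalSpace.isOpen_biUnion_countable (D x) (fun z => (b z).Ω)
      (fun z _ => (b z).jh.op)
    refine ⟨b '' S, hSc.image _, ?_⟩
    rw [hC x hx]
    rintro _ ⟨z, hz, rfl⟩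
    have : z ∈ ⋃ i ∈ S, (b i).Ω := by rw [hS]; exact mem_biUnion hz (hbΩ z hz)
    obtain ⟨s, hs, hzs⟩ := mem_iUnion₂.1 this
    refine mem_biUnion (mem_image_of_mem _ hs) ?_
    rw [← hbv s (hSD hs)]
    exact (b s).mD hzs
  choose! B hBc hB using hbx
  have hcount : (⋃ x ∈ T, B x).Countable := hTc.biUnion fun x hx => hBc x (hTC hx)
  have hcov : C ⊆ ⋃ b ∈ (⋃ x ∈ T, B x), Box.D b := by
    intro x hx
    have : x ∈ ⋃ i ∈ T, V i := by rw [hT]; exact mem_biUnion hx (hxV x hx)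
    obtain ⟨t, ht, hxt⟩ := mem_iUnion₂.1 this
    obtain ⟨b, hb, hxb⟩ := mem_iUnion₂.1 (hB t (hTC ht) ⟨hx, hxt⟩)
    exact mem_biUnion (mem_biUnion ht hb) hxb
  have hne2 : (⋃ x ∈ T, B x).Nonempty := by
    obtain ⟨x, hx⟩ := hne
    obtain ⟨b, hb, _⟩ := mem_iUnion₂.1 (hcov hx)
    exact ⟨b, hb⟩
  obtain ⟨f, hf⟩ := hcount.exists_eq_range hne2
  refine ⟨f, ?_⟩
  rw [hf, biUnion_range] at hcov
  exact hcov

lemma baire_box {b : ℕ → Box J} {F G : Set E4} (hF : IsClosed F) (hG : IsOpen G)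
    (hne : (F ∩ G).Nonempty) (hc : F ∩ G ⊆ ⋃ k, (b k).D) :
    ∃ c : Box J, (∃ k, c.D ⊆ (b k).D) ∧ (F ∩ c.V).Nonempty ∧ c.V ⊆ G ∧ F ∩ c.V ⊆ {x | c.W x = 0} := by
  haveI : LocallyCompactSpace (F ∩ G : Set E4) :=
    (hF.isLocallyClosed.inter hG.isLocallyClosed).locallyCompactSpace
  haveI : Nonempty (F ∩ G : Set E4) := hne.to_subtype
  choose A hAc hAs hAU _ using fun k => (b k).opV.exists_iUnion_isClosed
  obtain ⟨⟨k, j⟩, x, hx⟩ := nonempty_interior_of_iUnion_of_closed (X := (F ∩ G : Set E4)) (ι := ℕ × ℕ)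
    (f := fun i => Subtype.val ⁻¹' (A i.1 i.2 ∩ {x | (b i.1).W x = 0}))
    (fun i => (((hAc _ _)).inter (isClosed_singleton.preimage (b i.1).Ws.continuous)).preimage continuous_subtype_val)
    (by
      rw [eq_univ_iff_forall]
      rintro ⟨x, hx⟩
      obtain ⟨k, hk⟩ := mem_iUnion.1 (hc hx)
      have := hk.1
      rw [← hAU k] at this
      obtain ⟨j, hj⟩ := mem_iUnion.1 this
      exact mem_iUnion.2 ⟨(k, j), hj, hk.2⟩)
  obtain ⟨t, hts, hto, hxt⟩ := mem_interior.1 hx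
  obtain ⟨O, hO, rfl⟩ := isOpen_induced_iff.1 hto
  refine ⟨(b k).sub (O ∩ G) (hO.inter hG), ⟨k, fun y hy => ⟨hy.1.1, hy.2⟩⟩, ⟨x.1, x.2.1, ?_, hxt, x.2.2⟩, fun y hy => hy.2.2, ?_⟩
  · have := (interior_subset hx).1
    exact hAs k j this
  · rintro y ⟨hyF, hyV, hyO, hyG⟩
    exact (hts (show (⟨y, hyF, hyG⟩ : (F ∩ G : Set E4)) ∈ Subtype.val ⁻¹' O from hyO)).2

lemma quad_pos {A B : E4 → ℝ} (hA : Continuous A) (hB : Continuous B)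
    (sA : ∀ t ξ, A (t • ξ) = t ^ 2 * A ξ) (sB : ∀ t ξ, B (t • ξ) = t ^ 2 * B ξ) (hB0 : ∀ ξ, 0 ≤ B ξ)
    (h : ∀ ξ, ξ ≠ 0 → B ξ = 0 → 0 < A ξ) : ∃ c : ℝ, ∀ ξ, ξ ≠ 0 → 0 < A ξ + c * B ξ := by
  have key : ∃ c : ℝ, ∀ ξ ∈ Metric.sphere (0 : E4) 1, 0 < A ξ + c * B ξ := by
    have hS : IsCompact (Metric.sphere (0 : E4) 1 ∩ {ξ | A ξ ≤ 0}) :=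
      (isCompact_sphere 0 1).inter_right (isClosed_le hA continuous_const)
    have ne0 : ∀ ξ ∈ Metric.sphere (0 : E4) 1, ξ ≠ 0 := by
      rintro ξ hξ rfl; simp at hξ
    by_cases hne : (Metric.sphere (0 : E4) 1 ∩ {ξ | A ξ ≤ 0}).Nonempty
    · obtain ⟨p, hp, hpm⟩ := hS.exists_isMinOn hne hB.continuousOn
      obtain ⟨q, hq, hqm⟩ := hS.exists_isMinOn hne hA.continuousOn
      have hBp : 0 < B p := lt_of_le_of_ne (hB0 p) fun h0 => absurd (h p (ne0 p hp.1) h0.symm) (not_lt.2 hp.2)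
      have hq0 : A q ≤ 0 := hq.2
      refine ⟨(1 - A q) / B p, fun ξ hξ => ?_⟩
      by_cases hA0 : A ξ ≤ 0
      · have h1 : B p ≤ B ξ := hpm ⟨hξ, hA0⟩
        have h2 : A q ≤ A ξ := hqm ⟨hξ, hA0⟩
        have h3 : (1 - A q) / B p * B p ≤ (1 - A q) / B p * B ξ := by
          apply mul_le_mul_of_nonneg_left h1; apply div_nonneg _ hBp.le; linarith
        rw [div_mul_cancel₀ _ hBp.ne'] at h3
        linarith
      · have : 0 ≤ (1 - A q) / B p * B ξ := mul_nonneg (div_nonneg (by linarith) hBp.le) (hB0 ξ)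
        push Not at hA0
        linarith
    · refine ⟨0, fun ξ hξ => ?_⟩
      by_contra hc
      exact hne ⟨ξ, hξ, by simpa using hc⟩
  obtain ⟨c, hc⟩ := key
  refine ⟨c, fun ξ hξ => ?_⟩
  have hn : ‖ξ‖ ≠ 0 := by simpa using hξ
  have e : ξ = ‖ξ‖ • (‖ξ‖⁻¹ • ξ) := by rw [smul_smul, mul_inv_cancel₀ hn, one_smul]
  have := hc (‖ξ‖⁻¹ • ξ) (by simp [norm_smul, hn])
  rw [e, sA, sB]
  have h2 : 0 < ‖ξ‖ ^ 2 := by positivity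
  have := mul_pos h2 this
  linarith

def lap (g : E2 → ℝ) (z : E2) : ℝ :=
  fderiv ℝ (fun w => fderiv ℝ g w ee1) z ee1 + fderiv ℝ (fun w => fderiv ℝ g w ee2) z ee2

lemma lap_congr {g g' : E2 → ℝ} {z : E2} (h : g =ᶠ[𝓝 z] g') : lap g z = lap g' z := by
  have h2 := h.fderiv (𝕜 := ℝ)
  have k : ∀ e : E2, (fun w => fderiv ℝ g w e) =ᶠ[𝓝 z] fun w => fderiv ℝ g' w e := fun e => by
    filter_upwards [h2] with w hw; rw [hw]
  simp only [lap, (k _).fderiv_eq]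

lemma Box.LLnn (hJ : JS J) (b : Box J) {z : E2} (hz : z ∈ b.Ω) (ξ : E4) : LL J (nn b.W) (b.v z) ξ =
    4 * ((fderiv ℝ b.W (b.v z) ξ).1 ^ 2 + (fderiv ℝ b.W (b.v z) ξ).2 ^ 2) := by
  rw [LL_nn hJ b.Ws, b.dW z hz, b.wv z hz, J0_apply]
  simp; ring

lemma Box.LLZ (hJ : JS J) (b : Box J) {z : E2} (hz : z ∈ b.Ω) {g : E2 → ℝ} (hg : ContDiff ℝ ∞ g) :
    LL J (fun y => g (b.Z y)) (b.v z) (vx b.v z) = lap g z := by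
  rw [b.jh.pullL hJ hz (f := fun y => g (b.Z y)) (hg.comp b.Zs)]
  refine lap_congr ?_
  filter_upwards [b.jh.op.mem_nhds hz] with w hw
  rw [b.zv w hw]

lemma planar (hJ : JS J) (b : Box J) {K : Set E4} (hb : K ∩ b.V ⊆ {x | b.W x = 0}) {z : E2} (hz : z ∈ b.Ω)
    (hL : LMPat J K (b.v z)) {g : E2 → ℝ} (hg : ContDiff ℝ ∞ g)
    (hm : ∀ᶠ w in 𝓝 z, b.v w ∈ K → g w ≤ g z) : lap g z ≤ 0 := by
  by_contra hcon
  push Not at hcon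
  have hgZ : ContDiff ℝ ∞ (fun y => g (b.Z y)) := hg.comp b.Zs
  have hN := nn_sm b.Ws
  have hi : Continuous (fun ξ : E4 => (b.v z, ξ)) := by fun_prop
  obtain ⟨c, hc⟩ := quad_pos (A := LL J (fun y => g (b.Z y)) (b.v z)) (B := LL J (nn b.W) (b.v z))
    ((LL_sm hJ hgZ).continuous.comp hi) ((LL_sm hJ hN).continuous.comp hi)
    (fun t ξ => LL_sc hJ _ _ _ _) (fun t ξ => LL_sc hJ _ _ _ _)
    (fun ξ => by rw [b.LLnn hJ hz]; positivity) (by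
      intro ξ hξ h0
      rw [b.LLnn hJ hz] at h0
      have hw : fderiv ℝ b.W (b.v z) ξ = 0 := by
        ext <;> simp <;> nlinarith [sq_nonneg (fderiv ℝ b.W (b.v z) ξ).1, sq_nonneg (fderiv ℝ b.W (b.v z) ξ).2]
      have e := b.ker z hz ξ hw
      rw [b.jh.fd_apply hz] at e
      set p := fderiv ℝ b.Z (b.v z) ξ
      rw [e, LL_rot hJ, b.LLZ hJ hz hg]
      refine mul_pos ?_ hcon
      by_contra h1
      have h3 : p.1 = 0 := by nlinarith [sq_nonneg p.1, sq_nonneg p.2]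
      have h4 : p.2 = 0 := by nlinarith [sq_nonneg p.1, sq_nonneg p.2]
      rw [h3, h4] at e
      exact hξ (by simpa using e))
  obtain ⟨ξ, hξ, hle⟩ := hL (fun y => g (b.Z y) + c * nn b.W y) (hgZ.add (contDiff_const.mul hN)) (by
    have hZt : Tendsto b.Z (𝓝 (b.v z)) (𝓝 z) := by
      have := b.Zs.continuous.tendsto (b.v z); rwa [b.zv z hz] at this
    have h1 : ∀ᶠ y in 𝓝 (b.v z), y ∈ b.V := b.opV.mem_nhds (b.mV z hz)
    refine eventually_nhdsWithin_iff.2 ?_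
    filter_upwards [h1, hZt.eventually hm] with y hyV hy hyK
    have hw : b.W y = 0 := hb ⟨hyK, hyV⟩
    have h2 := b.back y hyV hw
    rw [h2.2] at hy
    simp only [nn_eq_zero.2 hw, nn_eq_zero.2 (b.wv z hz), b.zv z hz]
    linarith [hy hyK])
  rw [LL_add hJ hgZ (contDiff_const.mul hN), LL_cmul hJ hN] at hle
  linarith [hc ξ hξ]

lemma fill (hJ : JS J) (b : Box J) {K : Set E4} (hK : IsClosed K) (hL : LMP J K)
    (hb : K ∩ b.V ⊆ {x | b.W x = 0}) {z : E2} (hz : z ∈ b.Ω) (hzK : b.v z ∈ K) :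
    ∀ᶠ w in 𝓝 z, b.v w ∈ K := by
  obtain ⟨R, hR, hRs⟩ := Metric.nhds_basis_closedBall.mem_iff.1 (b.jh.op.mem_nhds hz)
  filter_upwards [Metric.ball_mem_nhds z (show 0 < R / 3 by positivity)] with s hs
  by_contra hsK
  set e : E2 → ℝ := fun w => (w.1 - s.1) ^ 2 + (w.2 - s.2) ^ 2 with he
  have hec : Continuous e := by fun_prop
  have hvc : ContinuousOn b.v (Metric.closedBall z R) := b.jh.sm.continuousOn.mono hRs
  have hcp : IsCompact (Metric.closedBall z R ∩ b.v ⁻¹' K) :=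
    (isCompact_closedBall z R).of_isClosed_subset (hvc.preimage_isClosed_of_isClosed Metric.isClosed_closedBall hK)
      inter_subset_left
  obtain ⟨y, hy, hmin⟩ := hcp.exists_isMinOn ⟨z, Metric.mem_closedBall_self hR.le, hzK⟩ hec.continuousOn
  have hyz : e y ≤ e z := hmin ⟨Metric.mem_closedBall_self hR.le, hzK⟩
  rw [Metric.mem_ball, Prod.dist_eq, max_lt_iff, Real.dist_eq, Real.dist_eq, abs_lt, abs_lt] at hs
  obtain ⟨⟨a1, a2⟩, a3, a4⟩ := hs
  have hez : e z ≤ 2 * (R / 3) ^ 2 := by simp only [he]; nlinarith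
  have hyb : y ∈ Metric.ball z R := by
    have b1 : |y.1 - s.1| ≤ 2 * R / 3 := abs_le_of_sq_le_sq (by simp only [he] at hyz hez; nlinarith [sq_nonneg (y.2 - s.2)]) (by positivity)
    have b2 : |y.2 - s.2| ≤ 2 * R / 3 := abs_le_of_sq_le_sq (by simp only [he] at hyz hez; nlinarith [sq_nonneg (y.1 - s.1)]) (by positivity)
    rw [abs_le] at b1 b2
    rw [Metric.mem_ball, Prod.dist_eq, max_lt_iff, Real.dist_eq, Real.dist_eq, abs_lt, abs_lt]
    refine ⟨⟨?_, ?_⟩, ?_, ?_⟩ <;> linarith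
  have hd : 0 < e y := by
    rcases (show 0 ≤ e y by positivity).lt_or_eq with h | h
    · exact h
    · exfalso
      have h1 : y.1 = s.1 := by simp only [he] at h; nlinarith [sq_nonneg (y.1 - s.1), sq_nonneg (y.2 - s.2)]
      have h2 : y.2 = s.2 := by simp only [he] at h; nlinarith [sq_nonneg (y.1 - s.1), sq_nonneg (y.2 - s.2)]
      exact hsK (by rw [← Prod.ext h1 h2]; exact hy.2)
  set M := 1 / e y with hM
  have hM0 : 0 < M := by positivity
  set g : E2 → ℝ := fun w => -(e w - e y) + M * (e w - e y) ^ 2 with hg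
  have hgs : ContDiff ℝ ∞ g := by simp only [hg, he]; fun_prop
  have h1 := planar hJ b hb (hRs hy.1) (hL _ hy.2) hgs (by
    have h1 : ∀ᶠ w in 𝓝 y, e w < e y + e y := (hec.tendsto y).eventually (gt_mem_nhds (by linarith))
    filter_upwards [Metric.isOpen_ball.mem_nhds hyb, h1] with w hw hw1 hwK
    have h2 : e y ≤ e w := hmin ⟨Metric.ball_subset_closedBall hw, hwK⟩
    have h3 : M * (e w - e y) ≤ 1 := by rw [hM, one_div_mul_eq_div, div_le_one hd]; linarith
    simp only [hg]
    nlinarith)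
  have hE : ∀ w, HasFDerivAt e ((2 * (w.1 - s.1)) • ContinuousLinearMap.fst ℝ ℝ ℝ + (2 * (w.2 - s.2)) • ContinuousLinearMap.snd ℝ ℝ ℝ) w := by
    intro w
    have := (((hasFDerivAt_fst (𝕜 := ℝ) (p := w)).sub_const s.1).pow 2).add (((hasFDerivAt_snd (𝕜 := ℝ) (p := w)).sub_const s.2).pow 2)
    refine this.congr_fderiv ?_
    ext <;> simp
  have hG : ∀ w, HasFDerivAt g ((-1 + 2 * M * (e w - e y)) • ((2 * (w.1 - s.1)) • ContinuousLinearMap.fst ℝ ℝ ℝ + (2 * (w.2 - s.2)) • ContinuousLinearMap.snd ℝ ℝ ℝ)) w := by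
    intro w
    have := ((hE w).sub_const (e y)).neg.add ((((hE w).sub_const (e y)).pow 2).const_mul M)
    refine this.congr_fderiv ?_
    ext <;> simp <;> ring
  have g1 : (fun w => fderiv ℝ g w ee1) = fun w => (-1 + 2 * M * (e w - e y)) * (2 * (w.1 - s.1)) := by
    ext w; rw [(hG w).fderiv]; simp [ee1]
  have g2 : (fun w => fderiv ℝ g w ee2) = fun w => (-1 + 2 * M * (e w - e y)) * (2 * (w.2 - s.2)) := by
    ext w; rw [(hG w).fderiv]; simp [ee2]
  have hp1 := (((((hE y).sub_const (e y)).const_mul (2 * M)).const_add (-1)).mul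
    (((hasFDerivAt_fst (𝕜 := ℝ) (p := y)).sub_const s.1).const_mul 2)).fderiv
  have hp2 := (((((hE y).sub_const (e y)).const_mul (2 * M)).const_add (-1)).mul
    (((hasFDerivAt_snd (𝕜 := ℝ) (p := y)).sub_const s.2).const_mul 2)).fderiv
  have : lap g y = -4 + 8 * M * e y := by
    rw [lap, g1, g2]
    erw [hp1, hp2]
    simp [ee1, ee2, he]
    ring
  rw [this, hM, mul_assoc, one_div_mul_cancel hd.ne'] at h1
  norm_num at h1

def Clean (K : Set E4) (b : Box J) : Prop := ∀ x ∈ b.V, (x ∈ K ↔ b.W x = 0)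

def OK (J : E4 → E4 →L[ℝ] E4) (K : Set E4) : Set E4 := ⋃ b ∈ {b : Box J | Clean K b}, b.V
def UK (J : E4 → E4 →L[ℝ] E4) (K : Set E4) : Set E4 := K ∩ OK J K

lemma OK_open (K : Set E4) : IsOpen (OK J K) := isOpen_biUnion fun b _ => b.opV

lemma UK_iff {K : Set E4} {x : E4} : x ∈ UK J K ↔ ∃ b : Box J, Clean K b ∧ x ∈ b.D := by
  constructor
  · rintro ⟨hx, hO⟩
    obtain ⟨b, hb, hxb⟩ := mem_iUnion₂.1 hO
    exact ⟨b, hb, hxb, (hb x hxb).1 hx⟩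
  · rintro ⟨b, hb, hx, hw⟩
    exact ⟨(hb x hx).2 hw, mem_biUnion (show b ∈ {b | Clean K b} from hb) hx⟩

lemma clean_of (hJ : JS J) (b : Box J) {K : Set E4} (hK : IsClosed K) (hL : LMP J K)
    (hb : K ∩ b.V ⊆ {x | b.W x = 0}) {z : E2} (hz : z ∈ b.Ω) (hzK : b.v z ∈ K) :
    ∃ O, ∃ hO : IsOpen O, b.v z ∈ O ∧ Clean K (b.sub O hO) := by
  obtain ⟨A, hA, hAo, hzA⟩ := eventually_nhds_iff.1 (fill hJ b hK hL hb hz hzK)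
  refine ⟨b.Z ⁻¹' A, hAo.preimage b.Zs.continuous, by simpa [b.zv z hz] using hzA, ?_⟩
  rintro x ⟨hxV, hxA⟩
  refine ⟨fun h => hb ⟨h, hxV⟩, fun h => ?_⟩
  have := b.back x hxV h
  rw [← this.2]
  exact hA _ hxA

lemma UK_dense (hJ : JS J) {K : Set E4} (hK : IsClosed K) (hL : LMP J K) {b : ℕ → Box J}
    (hc : K ⊆ ⋃ k, (b k).D) : K ⊆ closure (UK J K) := by
  intro x hx
  rw [mem_closure_iff]
  intro O hO hxO
  obtain ⟨c, -, ⟨y, hyK, hyV⟩, hcO, hcW⟩ := baire_box hK hO ⟨x, hx, hxO⟩ (inter_subset_left.trans hc)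
  have h := c.back y hyV (hcW ⟨hyK, hyV⟩)
  obtain ⟨A, hA, hyA, hcl⟩ := clean_of hJ c hK hL hcW h.1 (by rwa [h.2])
  rw [h.2] at hyA
  exact ⟨y, hcO hyV, UK_iff.2 ⟨_, hcl, ⟨hyV, hyA⟩, hcW ⟨hyK, hyV⟩⟩⟩

namespace Box
variable (b : Box J)
def gz (z : E2) : ℝ := Gq J (b.v z) (vx b.v z)
lemma vx_ne {z} (hz : z ∈ b.Ω) : vx b.v z ≠ 0 := by
  intro h0
  have h1 : (fun w => b.Z (b.v w)) =ᶠ[𝓝 z] id := by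
    filter_upwards [b.jh.op.mem_nhds hz] with w hw; exact b.zv w hw
  have h2 := h1.fderiv_eq (𝕜 := ℝ)
  rw [show (fun w => b.Z (b.v w)) = b.Z ∘ b.v from rfl, fderiv_comp z (cd1 b.Zs _) (b.jh.df hz), fderiv_id] at h2
  have := congrArg (fun L => (L ee1).1) h2
  simp [ee1] at this
  simp [vx, ee1] at h0
  rw [h0] at this
  simp at this
lemma ZV {z} (hz : z ∈ b.Ω) (ζ : E2) : fderiv ℝ b.Z (b.v z) (fderiv ℝ b.v z ζ) = ζ := by
  have h1 : (fun w => b.Z (b.v w)) =ᶠ[𝓝 z] id := by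
    filter_upwards [b.jh.op.mem_nhds hz] with w hw; exact b.zv w hw
  have h2 := h1.fderiv_eq (𝕜 := ℝ)
  rw [show (fun w => b.Z (b.v w)) = b.Z ∘ b.v from rfl, fderiv_comp z (cd1 b.Zs _) (b.jh.df hz), fderiv_id] at h2
  exact congrArg (fun L => L ζ) h2
lemma gz_pos (hJ : JS J) {z} (hz : z ∈ b.Ω) : 0 < b.gz z := Gq_pos hJ _ (b.vx_ne hz)
lemma v_cont : ContinuousOn b.v b.Ω := b.jh.sm.continuousOn
lemma vx_cont : ContinuousOn (vx b.v) b.Ω := fun z hz =>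
  ((b.jh.fd hz).continuousAt.clm_apply continuousAt_const).continuousWithinAt
lemma gz_cont (hJ : JS J) : ContinuousOn b.gz b.Ω :=
  (Gq_sm hJ).continuous.comp_continuousOn (b.v_cont.prodMk b.vx_cont)
open Classical in
def sel : E2 → E4 × E4 := b.Ω.piecewise (fun z => (b.v z, (√(b.gz z))⁻¹ • vx b.v z)) (fun _ => 0)
open Classical in
def den : E2 → ℝ := b.Ω.piecewise b.gz (fun _ => 0)
lemma sel_of {z} (hz : z ∈ b.Ω) : b.sel z = (b.v z, (√(b.gz z))⁻¹ • vx b.v z) := by simp [sel, hz]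
lemma den_of {z} (hz : z ∈ b.Ω) : b.den z = b.gz z := by simp [den, hz]
lemma den_out {z} (hz : z ∉ b.Ω) : b.den z = 0 := by simp [den, hz]
lemma sel_meas (hJ : JS J) : Measurable b.sel := by
  classical
  refine ContinuousOn.measurable_piecewise ?_ continuousOn_const b.jh.op.measurableSet
  refine b.v_cont.prodMk (ContinuousOn.smul (ContinuousOn.inv₀ (b.gz_cont hJ).sqrt ?_) b.vx_cont)
  intro z hz
  exact (Real.sqrt_pos.2 (b.gz_pos hJ hz)).ne'
lemma den_meas (hJ : JS J) : Measurable b.den := by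
  classical
  exact ContinuousOn.measurable_piecewise (b.gz_cont hJ) continuousOn_const b.jh.op.measurableSet
def pre (X : Set E4) : Set E2 := b.Ω ∩ b.v ⁻¹' X
lemma pre_meas (hJ : JS J) {X : Set E4} (hX : MeasurableSet X) : MeasurableSet (b.pre X) := by
  have : b.pre X = b.Ω ∩ (fun z => (b.sel z).1) ⁻¹' X := by
    ext z; simp only [pre, mem_inter_iff, mem_preimage]
    refine and_congr_right fun hz => ?_
    rw [b.sel_of hz]
  rw [this]
  exact b.jh.op.measurableSet.inter ((b.sel_meas hJ).fst hX)
lemma D_meas : MeasurableSet b.D :=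
  b.opV.measurableSet.inter (b.Ws.continuous.measurable (measurableSet_singleton 0))

/-- area measure with tangent direction -/
def am (X : Set E4) : Measure (E4 × E4) :=
  ((volume.withDensity (fun z => ENNReal.ofReal (b.den z))).map b.sel).restrict (Prod.fst ⁻¹' X)

lemma am_lint (hJ : JS J) {X : Set E4} (hX : MeasurableSet X) {Ψ : E4 × E4 → ENNReal} (hΨ : Measurable Ψ) :
    ∫⁻ p, Ψ p ∂(b.am X) = ∫⁻ z in b.pre X, ENNReal.ofReal (b.gz z) * Ψ (b.sel z) := by
  have h1 := b.sel_meas hJ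
  have h2 := (b.den_meas hJ).ennreal_ofReal
  have hX' : MeasurableSet (Prod.fst ⁻¹' X : Set (E4 × E4)) := measurable_fst hX
  rw [am, ← lintegral_indicator hX', lintegral_map (hΨ.indicator hX') h1,
    lintegral_withDensity_eq_lintegral_mul _ h2 (g := fun a => (Prod.fst ⁻¹' X).indicator Ψ (b.sel a)) ((hΨ.indicator hX').comp h1),
    ← lintegral_indicator (b.pre_meas hJ hX)]
  congr 1; ext z
  by_cases hz : z ∈ b.Ω
  · by_cases hx : b.v z ∈ X
    · simp [pre, indicator, hz, hx, b.sel_of hz, b.den_of hz]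
    · simp [pre, indicator, hz, hx, b.sel_of hz, b.den_of hz]
  · simp [pre, indicator, hz, b.den_out hz]
end Box

def Rot {R : Type*} (J : E4 → E4 →L[ℝ] E4) (Ψ : E4 × E4 → R) : Prop :=
  ∀ x ξ (a b : ℝ), a ^ 2 + b ^ 2 = 1 → Ψ (x, a • ξ + b • J x ξ) = Ψ (x, ξ)

lemma det2 (L : E2 →L[ℝ] E2) (a b : ℝ) (h1 : L ee1 = (a, b)) (h2 : L ee2 = (-b, a)) : L.det = a ^ 2 + b ^ 2 := by
  rw [ContinuousLinearMap.det, ← LinearMap.det_toMatrix (Module.Basis.finTwoProd ℝ), Matrix.det_fin_two]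
  simp only [LinearMap.toMatrix_apply, Module.Basis.finTwoProd_zero, Module.Basis.finTwoProd_one]
  rw [show ((1, 0) : ℝ × ℝ) = ee1 from rfl, show ((0, 1) : ℝ × ℝ) = ee2 from rfl]
  simp [h1, h2]
  ring

lemma am_cmp (hJ : JS J) (c1 c2 : Box J) {X : Set E4} (hX : MeasurableSet X) (hX1 : X ⊆ c1.D) (hX2 : X ⊆ c2.D)
    {Ψ : E4 × E4 → ENNReal} (hΨ : Measurable Ψ) (hR : Rot J Ψ) :
    ∫⁻ p, Ψ p ∂(c1.am X) = ∫⁻ p, Ψ p ∂(c2.am X) := by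
  rw [c1.am_lint hJ hX hΨ, c2.am_lint hJ hX hΨ]
  set τ : E2 → E2 := fun z => c2.Z (c1.v z) with hτ
  have t1 : ∀ z ∈ c1.pre X, τ z ∈ c2.Ω ∧ c2.v (τ z) = c1.v z := fun z hz =>
    c2.back _ (hX2 hz.2).1 (hX2 hz.2).2
  have hinj : InjOn τ (c1.pre X) := by
    intro z hz w hw h
    have := (t1 z hz).2
    rw [h, (t1 w hw).2] at this
    rw [← c1.zv z hz.1, ← this, c1.zv w hw.1]
  have himg : τ '' (c1.pre X) = c2.pre X := by
    ext w; constructor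
    · rintro ⟨z, hz, rfl⟩
      exact ⟨(t1 z hz).1, by show c2.v (τ z) ∈ X; rw [(t1 z hz).2]; exact hz.2⟩
    · intro hw
      have h := c1.back _ (hX1 hw.2).1 (hX1 hw.2).2
      refine ⟨c1.Z (c2.v w), ⟨h.1, by show c1.v _ ∈ X; rw [h.2]; exact hw.2⟩, ?_⟩
      simp only [hτ, h.2, c2.zv w hw.1]
  have hτd : ∀ z ∈ c1.Ω, HasFDerivAt τ ((fderiv ℝ c2.Z (c1.v z)).comp (fderiv ℝ c1.v z)) z := fun z hz =>
    (cd1 c2.Zs _).hasFDerivAt.comp z (c1.jh.df hz).hasFDerivAt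
  set T : Set E2 := {z | fderiv ℝ c2.W (c1.v z) (vx c1.v z) = 0} with hT
  have hTm : MeasurableSet (c1.pre X ∩ T) := by
    have hc : ContinuousOn (fun z => fderiv ℝ c2.W (c1.v z) (vx c1.v z)) c1.Ω :=
      ((cdf c2.Ws).continuous.comp_continuousOn c1.v_cont).clm_apply c1.vx_cont
    obtain ⟨U, hU, hUe⟩ := continuousOn_iff'.1 hc {0}ᶜ isOpen_compl_singleton
    have : c1.pre X ∩ T = c1.pre X ∩ (c1.Ω ∩ U)ᶜ := by
      ext z
      simp only [mem_inter_iff, and_congr_right_iff]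
      intro hz
      have h3 := Set.ext_iff.1 hUe z
      simp only [mem_inter_iff, mem_preimage, mem_compl_iff, mem_singleton_iff, hz.1, and_true] at h3
      simp only [hT, mem_setOf_eq, mem_compl_iff, mem_inter_iff, hz.1, true_and, ← h3, not_not]
    rw [this]
    exact (c1.pre_meas hJ hX).inter ((c1.jh.op.inter hU).measurableSet.compl)
  have hnull : volume (c1.pre X \ T) = 0 := by
    refine measure_null_of_locally_null _ fun z hz => ⟨{z}, ?_, measure_singleton z⟩
    obtain ⟨hzX, hzT⟩ := hz
    set w := fderiv ℝ c2.W (c1.v z) (vx c1.v z) with hw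
    have hd : HasFDerivAt (fun z => c2.W (c1.v z)) ((fderiv ℝ c2.W (c1.v z)).comp (fderiv ℝ c1.v z)) z :=
      (cd1 c2.Ws _).hasFDerivAt.comp z (c1.jh.df hzX.1).hasFDerivAt
    have hform : ∀ ζ : E2, (fderiv ℝ c2.W (c1.v z)) (fderiv ℝ c1.v z ζ) = ζ.1 • w + ζ.2 • J0 w := by
      intro ζ
      rw [c1.jh.fd_apply hzX.1, map_add, map_smul, map_smul]
      have := c2.dW _ (t1 z hzX).1 (vx c1.v z)
      rw [(t1 z hzX).2] at this
      rw [this]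
    obtain ⟨C, -, hC⟩ := LinearMap.exists_antilipschitzWith
      (((fderiv ℝ c2.W (c1.v z)).comp (fderiv ℝ c1.v z) : E2 →L[ℝ] E2) : E2 →ₗ[ℝ] E2) (by
        rw [LinearMap.ker_eq_bot']
        intro ζ hζ
        have hζ' : ζ.1 • w + ζ.2 • J0 w = 0 := by rw [← hform]; exact hζ
        rw [J0_apply] at hζ'
        have e1 : ζ.1 * w.1 - ζ.2 * w.2 = 0 := by have := congrArg Prod.fst hζ'; simp at this; linarith
        have e2 : ζ.1 * w.2 + ζ.2 * w.1 = 0 := by have := congrArg Prod.snd hζ'; simpa using this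
        have hw0 : 0 < w.1 ^ 2 + w.2 ^ 2 := by
          by_contra hc
          exact hzT (Prod.ext (by simp; nlinarith [sq_nonneg w.1, sq_nonneg w.2]) (by simp; nlinarith [sq_nonneg w.1, sq_nonneg w.2]))
        have f1 : ζ.1 * (w.1 ^ 2 + w.2 ^ 2) = 0 := by linear_combination w.1 * e1 + w.2 * e2
        have f2 : ζ.2 * (w.1 ^ 2 + w.2 ^ 2) = 0 := by linear_combination w.1 * e2 - w.2 * e1
        exact Prod.ext ((mul_eq_zero.1 f1).resolve_right hw0.ne') ((mul_eq_zero.1 f2).resolve_right hw0.ne'))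
    have hne := hd.eventually_ne (c := 0) ⟨C, hC⟩
    rw [eventually_nhdsWithin_iff] at hne
    rw [mem_nhdsWithin_iff_eventually]
    filter_upwards [hne] with y hy hyA
    by_contra hyz
    exact hy hyz (hX2 hyA.1.2).2
  have hnull2 : volume (τ '' (c1.pre X \ T)) = 0 :=
    addHaar_image_eq_zero_of_differentiableOn_of_addHaar_eq_zero _
      (fun z hz => (hτd z hz.1.1).differentiableAt.differentiableWithinAt) hnull
  have e1 : (c1.pre X : Set E2) =ᵐ[volume] (c1.pre X ∩ T : Set E2) := by
    rw [ae_eq_set]; simp [hnull]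
    rw [diff_eq_empty.2 inter_subset_left, measure_empty]
  have e2 : (c2.pre X : Set E2) =ᵐ[volume] (τ '' (c1.pre X ∩ T) : Set E2) := by
    rw [← himg, ae_eq_set]
    constructor
    · refine measure_mono_null ?_ hnull2
      rintro _ ⟨⟨z, hz, rfl⟩, h⟩
      exact ⟨z, ⟨hz, fun hT' => h ⟨z, ⟨hz, hT'⟩, rfl⟩⟩, rfl⟩
    · rw [diff_eq_empty.2 (image_mono inter_subset_left), measure_empty]
  rw [setLIntegral_congr e1, setLIntegral_congr e2, lintegral_image_eq_lintegral_abs_det_fderiv_mul volume hTm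
    (fun z hz => (hτd z hz.1.1).hasFDerivWithinAt) (hinj.mono inter_subset_left)]
  refine setLIntegral_congr_fun hTm fun z hz => ?_
  obtain ⟨hzX, hzT⟩ := hz
  obtain ⟨hw, hvw⟩ := t1 z hzX
  simp only [c1.sel_of hzX.1, c2.sel_of hw]
  set p := fderiv ℝ c2.Z (c1.v z) (vx c1.v z) with hp
  have k1 : vx c1.v z = p.1 • vx c2.v (τ z) + p.2 • J (c2.v (τ z)) (vx c2.v (τ z)) := by
    have := c2.ker _ hw (vx c1.v z) (by rw [hvw]; exact hzT)
    rw [c2.jh.fd_apply hw, hvw] at this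
    rw [hvw]; exact this
  have k2 : J (c1.v z) (vx c1.v z) = fderiv ℝ c2.v (τ z) (-p.2, p.1) := by
    rw [c2.jh.fd_apply hw]
    conv_lhs => rw [k1, ← hvw]
    rw [map_add, map_smul, map_smul, hJ.sq]
    simp [add_comm]
  have k3 : fderiv ℝ c2.Z (c1.v z) (J (c1.v z) (vx c1.v z)) = (-p.2, p.1) := by
    rw [k2, ← hvw, c2.ZV hw]
  rw [det2 _ p.1 p.2 (by simp [← hp]; rfl) (by
    rw [ContinuousLinearMap.comp_apply, c1.jh.vy hzX.1, k3])]
  have hg : c1.gz z = (p.1 ^ 2 + p.2 ^ 2) * c2.gz (τ z) := by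
    simp only [Box.gz]
    rw [k1, ← hvw, Gq_rot hJ]
  have h0 : 0 ≤ p.1 ^ 2 + p.2 ^ 2 := by positivity
  set s := p.1 ^ 2 + p.2 ^ 2 with hs
  have hg2 := c2.gz_pos hJ hw
  have hs0 : 0 < s := by
    have := c1.gz_pos hJ hzX.1
    rw [hg] at this
    exact pos_of_mul_pos_left this hg2.le
  rw [hg, abs_of_nonneg h0, ENNReal.ofReal_mul h0, mul_assoc]
  congr 2
  have hq : √s ≠ 0 := (Real.sqrt_pos.2 hs0).ne'
  have := hR (c2.v (τ z)) ((√(c2.gz (τ z)))⁻¹ • vx c2.v (τ z)) (p.1 / √s) (p.2 / √s) (by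
    rw [div_pow, div_pow, Real.sq_sqrt h0, ← add_div, ← hs, div_self hs0.ne'])
  rw [← this]
  rw [hvw, k1, ← hvw]
  congr 2
  rw [Real.sqrt_mul h0, mul_inv, map_smul, smul_add, smul_smul, smul_smul, smul_smul, smul_smul]
  congr 2 <;> ring

lemma fst_pre {X : Set E4} (hX : MeasurableSet X) : MeasurableSet (Prod.fst ⁻¹' X : Set (E4 × E4)) := measurable_fst hX

lemma Box.am_restrict (b : Box J) {X Y : Set E4} (hY : MeasurableSet Y) :
    (b.am X).restrict (Prod.fst ⁻¹' Y) = b.am (Y ∩ X) := by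
  rw [Box.am, Box.am, Measure.restrict_restrict (fst_pre hY)]; rfl

lemma UK_meas {K : Set E4} (hK : IsClosed K) : MeasurableSet (UK J K) :=
  hK.measurableSet.inter (OK_open K).measurableSet

def mset (b : ℕ → Box J) (K : Set E4) (k : ℕ) : Set E4 := disjointed (fun k => (b k).D) k ∩ UK J K
def mm (b : ℕ → Box J) (K : Set E4) : Measure (E4 × E4) := Measure.sum fun k => (b k).am (mset b K k)

lemma mset_meas (b : ℕ → Box J) {K : Set E4} (hK : IsClosed K) (k : ℕ) : MeasurableSet (mset b K k) :=
  (MeasurableSet.disjointed (fun k => (b k).D_meas) k).inter (UK_meas hK)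

lemma mm_ae (hJ : JS J) (b : ℕ → Box J) {K : Set E4} (hK : IsClosed K) :
    ∀ᵐ p ∂(mm b K), p.1 ∈ UK J K ∧ Gq J p.1 p.2 = 1 := by
  have hms : MeasurableSet {p : E4 × E4 | p.1 ∈ UK J K ∧ Gq J p.1 p.2 = 1} :=
    (fst_pre (UK_meas hK)).inter ((Gq_sm hJ).continuous.measurable (measurableSet_singleton 1))
  show (mm b K) {p : E4 × E4 | p.1 ∈ UK J K ∧ Gq J p.1 p.2 = 1}ᶜ = 0
  rw [mm, Measure.sum_apply _ hms.compl, ENNReal.tsum_eq_zero]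
  intro k
  rw [← lintegral_indicator_one hms.compl, (b k).am_lint hJ (mset_meas b hK k) (measurable_one.indicator hms.compl)]
  refine (setLIntegral_congr_fun ((b k).pre_meas hJ (mset_meas b hK k)) (g := fun _ => 0) fun z hz => ?_).trans (by simp)
  have hg := (b k).gz_pos hJ hz.1
  have : (b k).sel z ∈ {p : E4 × E4 | p.1 ∈ UK J K ∧ Gq J p.1 p.2 = 1} := by
    rw [(b k).sel_of hz.1]
    refine ⟨hz.2.2, ?_⟩
    rw [Gq_sc hJ]
    show _ * (b k).gz z = 1
    rw [inv_pow, Real.sq_sqrt hg.le, inv_mul_cancel₀ hg.ne']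
  rw [indicator_of_notMem (by simpa using this), mul_zero]

lemma mm_box (hJ : JS J) {b : ℕ → Box J} {K : Set E4} (hK : IsClosed K) (hc : K ⊆ ⋃ k, (b k).D)
    (c : Box J) {X : Set E4} (hX : MeasurableSet X) (hXc : X ⊆ c.D) (hXU : X ⊆ UK J K)
    {Ψ : E4 × E4 → ENNReal} (hΨ : Measurable Ψ) (hR : Rot J Ψ) :
    ∫⁻ p in Prod.fst ⁻¹' X, Ψ p ∂(mm b K) = ∫⁻ p, Ψ p ∂(c.am X) := by
  rw [mm, Measure.restrict_sum _ (fst_pre hX), lintegral_sum_measure]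
  have hm := mset_meas b hK
  have hXe : X = ⋃ k, X ∩ mset b K k := by
    rw [← inter_iUnion, eq_comm, inter_eq_left]
    intro x hx
    have := hc (hXU hx).1
    rw [← iUnion_disjointed] at this
    obtain ⟨k, hk⟩ := mem_iUnion.1 this
    exact mem_iUnion.2 ⟨k, hk, hXU hx⟩
  have e : ∀ k, ∫⁻ p, Ψ p ∂(((b k).am (mset b K k)).restrict (Prod.fst ⁻¹' X)) = ∫⁻ p, Ψ p ∂(c.am (X ∩ mset b K k)) := by
    intro k
    rw [(b k).am_restrict hX]
    exact am_cmp hJ _ _ (hX.inter (hm k)) (fun x hx => disjointed_subset (fun k => (b k).D) k hx.2.1) (fun x hx => hXc hx.1) hΨ hR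
  simp_rw [e]
  conv_rhs => rw [hXe]
  simp only [Box.am]
  rw [preimage_iUnion, lintegral_iUnion (fun k => fst_pre (hX.inter (hm k)))]
  intro i j hij
  refine Disjoint.preimage _ ?_
  exact (disjoint_disjointed (fun k => (b k).D) hij).mono (fun x hx => hx.2.1) (fun x hx => hx.2.1)

lemma int_eq_of_lint {α : Type*} [MeasurableSpace α] {μ ν : Measure α} {f : α → ℝ} (hf : Measurable f)
    (h : ∀ k : ℝ → ENNReal, Measurable k → ∫⁻ a, k (f a) ∂μ = ∫⁻ a, k (f a) ∂ν) :
    (Integrable f μ ↔ Integrable f ν) ∧ ∫ a, f a ∂μ = ∫ a, f a ∂ν := by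
  have h1 : Integrable f μ ↔ Integrable f ν := by
    simp only [Integrable, hf.aestronglyMeasurable, true_and, HasFiniteIntegral]
    rw [h (fun t => ‖t‖ₑ) measurable_enorm]
  refine ⟨h1, ?_⟩
  by_cases hi : Integrable f μ
  · rw [integral_eq_lintegral_pos_part_sub_lintegral_neg_part hi,
      integral_eq_lintegral_pos_part_sub_lintegral_neg_part (h1.1 hi), h (fun t => ENNReal.ofReal t) ENNReal.measurable_ofReal,
      h (fun t => ENNReal.ofReal (-t)) (ENNReal.measurable_ofReal.comp measurable_neg)]
  · rw [integral_undef hi, integral_undef (fun h2 => hi (h1.2 h2))]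

lemma mm_box_int (hJ : JS J) {b : ℕ → Box J} {K : Set E4} (hK : IsClosed K) (hc : K ⊆ ⋃ k, (b k).D)
    (c : Box J) {X : Set E4} (hX : MeasurableSet X) (hXc : X ⊆ c.D) (hXU : X ⊆ UK J K)
    {Ψ : E4 × E4 → ℝ} (hΨ : Measurable Ψ) (hR : Rot J Ψ) :
    ∫ p in Prod.fst ⁻¹' X, Ψ p ∂(mm b K) = ∫ p, Ψ p ∂(c.am X) :=
  (int_eq_of_lint hΨ fun k hk => mm_box hJ hK hc c hX hXc hXU (Ψ := fun p => k (Ψ p)) (hk.comp hΨ)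
    fun x ξ s t h => by show k (Ψ _) = k (Ψ _); rw [hR x ξ s t h]).2

lemma Box.am_int (hJ : JS J) (c : Box J) {X : Set E4} (hX : MeasurableSet X) {Ψ : E4 × E4 → ℝ}
    (hΨ : Measurable Ψ) (hs : ∀ x ξ (t : ℝ), Ψ (x, t • ξ) = t ^ 2 * Ψ (x, ξ)) :
    ∫ p, Ψ p ∂(c.am X) = ∫ z in c.pre X, Ψ (c.v z, vx c.v z) := by
  have h1 := c.sel_meas hJ
  have h2 := (c.den_meas hJ).ennreal_ofReal
  have hX' := fst_pre hX
  rw [am, ← integral_indicator hX', integral_map h1.aemeasurable (hΨ.indicator hX').aestronglyMeasurable,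
    integral_withDensity_eq_integral_toReal_smul h2 (by simp), ← integral_indicator (c.pre_meas hJ hX)]
  congr 1; ext z
  by_cases hz : z ∈ c.Ω
  · have hg := c.gz_pos hJ hz
    by_cases hx : c.v z ∈ X
    · simp [pre, indicator, hz, hx, c.sel_of hz, c.den_of hz, hs, ENNReal.toReal_ofReal hg.le, Real.sq_sqrt hg.le, mul_inv_cancel_left₀ hg.ne']
    · simp [pre, indicator, hz, hx, c.sel_of hz, c.den_of hz]
  · simp [pre, indicator, hz, c.den_out hz]

lemma cut {S U : Set E4} (hS : IsCompact S) (hU : IsOpen U) (h : S ⊆ U) : ∃ χ : E4 → ℝ, ContDiff ℝ ∞ χ ∧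
    (∀ x, 0 ≤ χ x ∧ χ x ≤ 1) ∧ HasCompactSupport χ ∧ tsupport χ ⊆ U ∧ ∀ᶠ x in 𝓝ˢ S, χ x = 1 := by
  obtain ⟨L, hL, h1, h2⟩ := exists_compact_between hS hU h
  obtain ⟨f, hf0, hf1, hf⟩ := exists_contMDiffMap_zero_one_nhds_of_isClosed (n := ⊤) (modelWithCornersSelf ℝ E4)
    (s := (interior L)ᶜ) (t := S) isOpen_interior.isClosed_compl hS.isClosed
    (by rw [← subset_compl_iff_disjoint_left, compl_compl]; exact h1)
  have hs : tsupport f ⊆ L := by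
    refine closure_minimal (fun x hx => ?_) hL.isClosed
    by_contra hn
    exact hx (hf0.self_of_nhdsSet x (fun h => hn (interior_subset h)))
  exact ⟨f, f.contMDiff.contDiff, hf, HasCompactSupport.of_support_subset_isCompact hL ((subset_tsupport _).trans hs), hs.trans h2, hf1⟩

structure CL (J : E4 → E4 →L[ℝ] E4) (μ : Measure (E4 × E4)) (O : Set E4) : Prop where
  fin : ∀ S ⊆ O, IsCompact S → μ (Prod.fst ⁻¹' S) < ⊤
  cl : ∀ α : E4 → E4 →L[ℝ] ℝ, ContDiff ℝ ∞ α → HasCompactSupport α → tsupport α ⊆ O →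
    ∫ p, dd J α p.1 p.2 ∂μ = 0

lemma intg (hJ : JS J) {μ : Measure (E4 × E4)} (hae : ∀ᵐ p ∂μ, Gq J p.1 p.2 = 1) {Ψ : E4 → E4 → ℝ}
    (hc : Continuous (fun p : E4 × E4 => Ψ p.1 p.2)) (hs : ∀ x ξ t, Ψ x (t • ξ) = t ^ 2 * Ψ x ξ) {S : Set E4}
    (hS : IsCompact S) (hf : μ (Prod.fst ⁻¹' S) < ⊤) (h0 : ∀ x ∉ S, ∀ ξ, Ψ x ξ = 0) :
    Integrable (fun p => Ψ p.1 p.2) μ := by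
  obtain ⟨C, hC, hb⟩ := bdd2 hJ hc hs hS
  rw [← integrableOn_iff_integrable_of_support_subset (s := Prod.fst ⁻¹' S) (fun p hp => by
    by_contra hn; exact hp (h0 _ hn _))]
  refine Measure.integrableOn_of_bounded (M := C) hf.ne hc.aestronglyMeasurable ?_
  filter_upwards [ae_restrict_of_ae hae, ae_restrict_mem (fst_pre hS.measurableSet)] with p hp hpS
  have := hb p.1 hpS p.2
  rwa [hp, mul_one] at this

lemma dd_sc (hJ : JS J) (α : E4 → E4 →L[ℝ] ℝ) (x ξ : E4) (t : ℝ) : dd J α x (t • ξ) = t ^ 2 * dd J α x ξ :=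
  sc_of_rot (dd_rot hJ α) x ξ t
lemma GG_sc (hJ : JS J) (f g : E4 → ℝ) (x ξ : E4) (t : ℝ) : GG J f g x (t • ξ) = t ^ 2 * GG J f g x ξ :=
  sc_of_rot (GG_rot hJ f g) x ξ t
lemma dd_off {α : E4 → E4 →L[ℝ] ℝ} {x : E4} (h : x ∉ tsupport α) (ξ : E4) : dd J α x ξ = 0 := by
  have : fderiv ℝ α x = 0 := by
    by_contra hn; exact h (support_fderiv_subset ℝ hn)
  simp [dd, this]
lemma GG_off {f : E4 → ℝ} (g : E4 → ℝ) {x : E4} (h : x ∉ tsupport f) (ξ : E4) : GG J f g x ξ = 0 := by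
  have : fderiv ℝ f x = 0 := by
    by_contra hn; exact h (support_fderiv_subset ℝ hn)
  simp [GG, this]
lemma LL_off {f : E4 → ℝ} {x : E4} (h : x ∉ tsupport f) (ξ : E4) : LL J f x ξ = 0 := by
  rw [LL_congr (notMem_tsupport_iff_eventuallyEq.1 h)]; exact LL_const 0 x ξ

lemma dd_int (hJ : JS J) {μ : Measure (E4 × E4)} (hae : ∀ᵐ p ∂μ, Gq J p.1 p.2 = 1) {O : Set E4}
    (hfin : ∀ S ⊆ O, IsCompact S → μ (Prod.fst ⁻¹' S) < ⊤) {α : E4 → E4 →L[ℝ] ℝ} (hα : ContDiff ℝ ∞ α)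
    (hc : HasCompactSupport α) (hs : tsupport α ⊆ O) : Integrable (fun p => dd J α p.1 p.2) μ :=
  intg hJ hae (dd_sm hJ hα).continuous (dd_sc hJ α) hc (hfin _ hs hc) fun _ hx => dd_off hx

lemma CL.mono {μ : Measure (E4 × E4)} {O O' : Set E4} (h : CL J μ O) (hs : O' ⊆ O) : CL J μ O' :=
  ⟨fun S hS => h.fin S (hS.trans hs), fun α h1 h2 h3 => h.cl α h1 h2 (h3.trans hs)⟩

lemma CL.union (hJ : JS J) {μ : Measure (E4 × E4)} (hae : ∀ᵐ p ∂μ, Gq J p.1 p.2 = 1) {O1 O2 : Set E4}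
    (o1 : IsOpen O1) (o2 : IsOpen O2) (h1 : CL J μ O1) (h2 : CL J μ O2) : CL J μ (O1 ∪ O2) := by
  refine ⟨fun S hS hc => ?_, fun α hα hc hs => ?_⟩
  · obtain ⟨S1, S2, c1, c2, s1, s2, rfl⟩ := hc.binary_compact_cover o1 o2 hS
    rw [preimage_union]
    exact (measure_union_le _ _).trans_lt (ENNReal.add_lt_top.2 ⟨h1.fin _ s1 c1, h2.fin _ s2 c2⟩)
  · obtain ⟨S1, S2, c1, c2, s1, s2, e⟩ := IsCompact.binary_compact_cover hc o1 o2 hs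
    obtain ⟨χ, sm, -, χc, χs, χ1⟩ := cut c1 o1 s1
    have k1 : tsupport (fun x => χ x • α x) ⊆ O1 := (tsupport_smul_subset_left _ _).trans χs
    have k2 : tsupport (fun x => (1 - χ x) • α x) ⊆ O2 := by
      refine Subset.trans (fun x hx => ?_) s2
      have hx' := tsupport_smul_subset_right (fun x => 1 - χ x) α hx
      rw [e] at hx'
      rcases hx' with h | h
      · exfalso
        have := (mem_nhdsSet_iff_forall.1 χ1) x h
        refine notMem_tsupport_iff_eventuallyEq.2 ?_ hx
        filter_upwards [this] with y hy
        have : χ y = 1 := hy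
        simp [this]
      · exact h
    have e1 : HasCompactSupport (fun x => χ x • α x) := HasCompactSupport.smul_left (f := χ) hc
    have e2 : HasCompactSupport (fun x => (1 - χ x) • α x) := HasCompactSupport.smul_left (f := fun x => 1 - χ x) hc
    have m1 : ContDiff ℝ ∞ (fun x => χ x • α x) := sm.smul hα
    have m2 : ContDiff ℝ ∞ (fun x => (1 - χ x) • α x) := (contDiff_const.sub sm).smul hα
    have ed : ∀ x ξ, dd J α x ξ = dd J (fun x => χ x • α x) x ξ + dd J (fun x => (1 - χ x) • α x) x ξ := by
      intro x ξ
      rw [← dd_add (cd1 m1 x) (cd1 m2 x)]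
      congr 1; ext1 y; rw [← add_smul]; simp
    simp_rw [ed]
    rw [integral_add (dd_int hJ hae h1.fin m1 e1 k1) (dd_int hJ hae h2.fin m2 e2 k2), h1.cl _ m1 e1 k1, h2.cl _ m2 e2 k2, add_zero]

lemma CL.sUnion (hJ : JS J) {μ : Measure (E4 × E4)} (hae : ∀ᵐ p ∂μ, Gq J p.1 p.2 = 1) {G : Set E4}
    (h : ∀ x ∈ G, ∃ O, IsOpen O ∧ x ∈ O ∧ CL J μ O) : CL J μ G := by
  have key : ∀ S ⊆ G, IsCompact S → ∃ O, IsOpen O ∧ S ⊆ O ∧ CL J μ O := by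
    intro S hSG hS
    refine hS.induction_on (p := fun S => ∃ O, IsOpen O ∧ S ⊆ O ∧ CL J μ O) ?_ ?_ ?_ ?_
    · refine ⟨∅, isOpen_empty, subset_rfl, fun S hS _ => ?_, fun α _ _ hs => ?_⟩
      · simp [subset_empty_iff.1 hS]
      · have : α = 0 := by
          rw [← Function.support_eq_empty_iff]; exact subset_empty_iff.1 ((subset_tsupport α).trans hs)
        simp [this, dd]
    · rintro s t hst ⟨O, h1, h2, h3⟩; exact ⟨O, h1, hst.trans h2, h3⟩
    · rintro s t ⟨O, h1, h2, h3⟩ ⟨O', h1', h2', h3'⟩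
      exact ⟨O ∪ O', h1.union h1', union_subset_union h2 h2', h3.union hJ hae h1 h1' h3'⟩
    · intro x hx
      obtain ⟨O, h1, h2, h3⟩ := h x (hSG hx)
      exact ⟨O, mem_nhdsWithin_of_mem_nhds (h1.mem_nhds h2), O, h1, subset_rfl, h3⟩
  refine ⟨fun S hS hc => ?_, fun α hα hc hs => ?_⟩
  · obtain ⟨O, _, h2, h3⟩ := key S hS hc
    exact h3.fin S h2 hc
  · obtain ⟨O, _, h2, h3⟩ := key _ hs hc
    exact h3.cl α hα hc h2

/-- integration by parts -/
lemma CL.ibp (hJ : JS J) {μ : Measure (E4 × E4)} {O : Set E4} (hC : CL J μ O) (hae : ∀ᵐ p ∂μ, Gq J p.1 p.2 = 1)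
    {h φ : E4 → ℝ} (hh : ContDiff ℝ ∞ h) (hφ : ContDiff ℝ ∞ φ) (hc : HasCompactSupport h) (hs : tsupport h ⊆ O) :
    Integrable (fun p => h p.1 * LL J φ p.1 p.2) μ ∧ Integrable (fun p => φ p.1 * LL J h p.1 p.2) μ ∧
    Integrable (fun p => GG J h φ p.1 p.2) μ ∧
    ∫ p, h p.1 * LL J φ p.1 p.2 ∂μ = - ∫ p, GG J h φ p.1 p.2 ∂μ ∧
    ∫ p, h p.1 * LL J φ p.1 p.2 ∂μ = ∫ p, φ p.1 * LL J h p.1 p.2 ∂μ := by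
  have hf := hC.fin _ hs hc
  have i1 := intg hJ hae (Ψ := fun x ξ => h x * LL J φ x ξ) ((hh.continuous.comp continuous_fst).mul (LL_sm hJ hφ).continuous)
    (fun x ξ t => by rw [LL_sc hJ]; ring) hc hf (fun x hx ξ => by rw [image_eq_zero_of_notMem_tsupport hx, zero_mul])
  have i2 := intg hJ hae (Ψ := fun x ξ => φ x * LL J h x ξ) ((hφ.continuous.comp continuous_fst).mul (LL_sm hJ hh).continuous)
    (fun x ξ t => by rw [LL_sc hJ]; ring) hc hf (fun x hx ξ => by rw [LL_off hx, mul_zero])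
  have i3 := intg hJ hae (Ψ := GG J h φ) (GG_sm hJ hh hφ).continuous (GG_sc hJ h φ) hc hf (fun x hx ξ => GG_off φ hx ξ)
  have m1 : ContDiff ℝ ∞ (fun x => h x • dc J φ x) := hh.smul (dc_sm hJ hφ)
  have m2 : ContDiff ℝ ∞ (fun x => φ x • dc J h x) := hφ.smul (dc_sm hJ hh)
  have hd : tsupport (dc J h) ⊆ tsupport h := by
    refine closure_minimal (fun x hx => support_fderiv_subset ℝ (fun h0 => hx ?_)) (isClosed_tsupport h)
    simp [dc, h0]
  have a1 := hC.cl _ m1 (HasCompactSupport.smul_right (f := h) (f' := dc J φ) hc) ((tsupport_smul_subset_left _ _).trans hs)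
  have a2 := hC.cl _ m2 (hc.mono' (((subset_tsupport _).trans (tsupport_smul_subset_right φ (dc J h))).trans hd))
    (((tsupport_smul_subset_right φ (dc J h)).trans hd).trans hs)
  simp_rw [dd_smul_dc hJ hh hφ, integral_neg] at a1
  simp_rw [dd_smul_dc hJ hφ hh, integral_neg, GG_comm φ h] at a2
  rw [integral_add i1 i3] at a1
  rw [integral_add i2 i3] at a2
  exact ⟨i1, i2, i3, by linarith, by linarith⟩

lemma int_fd_zero {h : E2 → ℝ} (hh : ContDiff ℝ ∞ h) (hc : HasCompactSupport h) (e : E2) :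
    Integrable (fun z => fderiv ℝ h z e) ∧ ∫ z, fderiv ℝ h z e = 0 := by
  have c1 : Continuous (fun z => fderiv ℝ h z e) := (cdf hh).continuous.clm_apply continuous_const
  have i1 : Integrable (fun z => fderiv ℝ h z e) := by
    refine c1.integrable_of_hasCompactSupport ?_
    exact (hc.fderiv ℝ).mono (fun z hz h0 => hz (by simp [h0]))
  refine ⟨i1, ?_⟩
  have := integral_mul_fderiv_eq_neg_fderiv_mul_of_integrable (𝕜 := ℝ) (μ := (volume : Measure E2)) (f := fun _ => (1 : ℝ)) (g := h) (v := e)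
    (by simp) (by simpa using i1) (by simpa using hh.continuous.integrable_of_hasCompactSupport hc) (fun x _ => by fun_prop) (fun x _ => cd1 hh x)
  simpa using this

lemma ext0 {Ω T : Set E2} (hΩ : IsOpen Ω) (hT : IsCompact T) (hTΩ : T ⊆ Ω) {h : E2 → ℝ}
    (hh : ∀ z ∈ Ω, ContDiffAt ℝ ∞ h z) (h0 : ∀ z ∈ Ω, z ∉ T → h z = 0) :
    ContDiff ℝ ∞ (Ω.indicator h) ∧ HasCompactSupport (Ω.indicator h) := by
  have hz0 : ∀ z ∉ T, Ω.indicator h z = 0 := fun z hz => by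
    by_cases hΩ : z ∈ Ω
    · rw [indicator_of_mem hΩ, h0 z hΩ hz]
    · rw [indicator_of_notMem hΩ]
  refine ⟨contDiff_iff_contDiffAt.2 fun z => ?_, HasCompactSupport.intro hT hz0⟩
  by_cases hz : z ∈ T
  · refine (hh z (hTΩ hz)).congr_of_eventuallyEq ?_
    filter_upwards [hΩ.mem_nhds (hTΩ hz)] with w hw
    rw [indicator_of_mem hw]
  · refine (contDiffAt_const (c := (0 : ℝ))).congr_of_eventuallyEq ?_
    filter_upwards [hT.isClosed.isOpen_compl.mem_nhds hz] with w hw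
    exact hz0 w hw

lemma Box.pre_cpt (b : Box J) {S : Set E4} (hS : IsCompact S) (hSV : S ⊆ b.V) :
    IsCompact (b.pre S) := by
  have : b.pre S = b.Z '' (S ∩ {x | b.W x = 0}) := by
    ext z; constructor
    · rintro ⟨h1, h2⟩; exact ⟨b.v z, ⟨h2, b.wv z h1⟩, b.zv z h1⟩
    · rintro ⟨x, ⟨h1, h2⟩, rfl⟩
      obtain ⟨h3, h4⟩ := b.back x (hSV h1) h2
      exact ⟨h3, by rwa [mem_preimage, h4]⟩
  rw [this]
  exact (hS.inter_right (isClosed_eq b.Ws.continuous continuous_const)).image b.Zs.continuous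

lemma stokes (b : Box J) {α : E4 → E4 →L[ℝ] ℝ} (hα : ContDiff ℝ ∞ α)
    (hc : HasCompactSupport α) (hs : tsupport α ⊆ b.V) : ∫ z in b.Ω, dd J α (b.v z) (vx b.v z) = 0 := by
  have key := fun e : E2 => ext0 b.jh.op (b.pre_cpt hc hs) inter_subset_left (h := fun w => α (b.v w) (fderiv ℝ b.v w e))
    (fun z hz => ((hα.contDiffAt).comp z (b.jh.at_ hz)).clm_apply ((b.jh.fd hz).clm_apply contDiffAt_const))
    (fun z hz hn => by
      have : α (b.v z) = 0 := image_eq_zero_of_notMem_tsupport (fun h => hn ⟨hz, h⟩)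
      simp [this])
  obtain ⟨i1, e1⟩ := int_fd_zero (key ee2).1 (key ee2).2 ee1
  obtain ⟨i2, e2⟩ := int_fd_zero (key ee1).1 (key ee1).2 ee2
  have := integral_sub i1 i2
  rw [e1, e2, sub_zero] at this
  rw [← this, ← integral_indicator b.jh.op.measurableSet]
  congr 1; ext z
  by_cases hz : z ∈ b.Ω
  · rw [indicator_of_mem hz, b.jh.pull hz hα]
    have q : ∀ e, (fun w => α (b.v w) (fderiv ℝ b.v w e)) =ᶠ[𝓝 z] b.Ω.indicator (fun w => α (b.v w) (fderiv ℝ b.v w e)) := fun e => by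
      filter_upwards [b.jh.op.mem_nhds hz] with w hw
      rw [indicator_of_mem hw]
    rw [(q ee1).fderiv_eq, (q ee2).fderiv_eq]
  · rw [indicator_of_notMem hz]
    have q : ∀ e, fderiv ℝ (b.Ω.indicator (fun w => α (b.v w) (fderiv ℝ b.v w e))) z = 0 := fun e => by
      have : z ∈ (b.pre (tsupport α))ᶜ := fun h => hz h.1
      have h2 : (b.Ω.indicator (fun w => α (b.v w) (fderiv ℝ b.v w e))) =ᶠ[𝓝 z] fun _ => (0 : ℝ) := by
        filter_upwards [(b.pre_cpt hc hs).isClosed.isOpen_compl.mem_nhds this] with w hw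
        by_cases hΩ : w ∈ b.Ω
        · have : α (b.v w) = 0 := image_eq_zero_of_notMem_tsupport (fun h => hw ⟨hΩ, h⟩)
          simp [hΩ, this]
        · rw [indicator_of_notMem hΩ]
      rw [h2.fderiv_eq]; simp
    rw [q, q]; simp

lemma Box.am_fin (hJ : JS J) (b : Box J) {S X : Set E4} (hS : IsCompact S) (hSV : S ⊆ b.V) (hX : MeasurableSet X) (hXS : X ⊆ S) :
    b.am X univ < ⊤ := by
  rw [← lintegral_one, b.am_lint hJ hX measurable_const]
  have hp := b.pre_cpt hS hSV
  refine (lintegral_mono_set (t := b.pre S) (inter_subset_inter_right _ (preimage_mono hXS))).trans_lt ?_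
  obtain ⟨C, hC⟩ := hp.exists_bound_of_continuousOn ((b.gz_cont hJ).mono inter_subset_left)
  refine (setLIntegral_mono' hp.measurableSet (g := fun _ => ENNReal.ofReal C) fun z hz => ?_).trans_lt ?_
  · rw [mul_one]; exact ENNReal.ofReal_le_ofReal ((le_abs_self _).trans (hC z hz))
  · rw [setLIntegral_const]; exact ENNReal.mul_lt_top ENNReal.ofReal_lt_top hp.measure_lt_top

lemma dd_Rot (hJ : JS J) (α : E4 → E4 →L[ℝ] ℝ) : Rot J (fun p : E4 × E4 => dd J α p.1 p.2) := fun x ξ a b h => by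
  show dd J α x _ = dd J α x ξ
  rw [dd_rot hJ, h, one_mul]

lemma mm_fin (hJ : JS J) {b : ℕ → Box J} {K : Set E4} (hK : IsClosed K) (hc : K ⊆ ⋃ k, (b k).D)
    (c : Box J) {X S : Set E4} (hX : MeasurableSet X) (hXc : X ⊆ c.D) (hXU : X ⊆ UK J K) (hS : IsCompact S)
    (hSV : S ⊆ c.V) (hXS : X ⊆ S) : mm b K (Prod.fst ⁻¹' X) < ⊤ := by
  have := mm_box hJ hK hc c hX hXc hXU (Ψ := fun _ => 1) measurable_const (fun _ _ _ _ _ => rfl)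
  simp only [lintegral_one, Measure.restrict_apply_univ] at this
  rw [this]
  exact c.am_fin hJ hS hSV hX hXS

lemma CL_clean (hJ : JS J) {b : ℕ → Box J} {K : Set E4} (hK : IsClosed K) (hc : K ⊆ ⋃ k, (b k).D)
    (c : Box J) (hcl : Clean K c) : CL J (mm b K) c.V := by
  have hDU : c.D ⊆ UK J K := fun x hx => UK_iff.2 ⟨c, hcl, hx⟩
  have hae := mm_ae hJ b hK
  have hae2 : ∀ᵐ p ∂mm b K, p.1 ∈ UK J K := hae.mono fun p hp => hp.1
  refine ⟨fun S hS hSc => ?_, fun α hα hα2 hs => ?_⟩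
  · have : mm b K (Prod.fst ⁻¹' S) = mm b K (Prod.fst ⁻¹' (S ∩ c.D)) := by
      refine measure_congr ?_
      filter_upwards [hae2] with p hp
      refine propext ⟨fun h => ⟨h, hS h, (hcl _ (hS h)).1 hp.1⟩, fun h => h.1⟩
    rw [this]
    exact mm_fin hJ hK hc c (hSc.measurableSet.inter c.D_meas) inter_subset_right (inter_subset_right.trans hDU) hSc hS inter_subset_left
  · have m := (dd_sm hJ hα).continuous.measurable
    have : ∫ p, dd J α p.1 p.2 ∂mm b K = ∫ p in Prod.fst ⁻¹' c.D, dd J α p.1 p.2 ∂mm b K := by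
      rw [← integral_indicator (fst_pre c.D_meas)]
      refine integral_congr_ae ?_
      filter_upwards [hae2] with p hp
      by_cases hpD : p.1 ∈ c.D
      · rw [indicator_of_mem (by exact hpD)]
      · rw [indicator_of_notMem (by exact hpD)]
        exact dd_off (fun h => hpD ⟨hs h, (hcl _ (hs h)).1 hp.1⟩) _
    rw [this, mm_box_int hJ hK hc c c.D_meas subset_rfl hDU m (dd_Rot hJ α),
      c.am_int hJ c.D_meas m (fun x ξ t => dd_sc hJ α x ξ t)]
    have : c.pre c.D = c.Ω := inter_eq_left.2 fun z hz => c.mD hz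
    rw [this]
    exact stokes c hα hα2 hs

local notation "σf" => Real.smoothTransition
def kap (t : ℝ) : ℝ := ∫ x in (0 : ℝ)..t, Real.smoothTransition x
lemma kap_deriv (t : ℝ) : HasDerivAt kap (σf t) t :=
  intervalIntegral.integral_hasDerivAt_right (Real.smoothTransition.continuous.intervalIntegrable _ _)
    (Real.smoothTransition.continuous.stronglyMeasurableAtFilter _ _) Real.smoothTransition.continuousAt
lemma sig_sm : ContDiff ℝ ∞ Real.smoothTransition := Real.smoothTransition.contDiff (n := ⊤)
lemma kap_d : deriv kap = σf := funext fun t => (kap_deriv t).deriv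
lemma kap_sm : ContDiff ℝ ∞ kap :=
  contDiff_infty_iff_deriv.2 ⟨fun t => (kap_deriv t).differentiableAt, by rw [kap_d]; exact sig_sm⟩
lemma kap_le {s t : ℝ} (h : s ≤ t) : 0 ≤ kap t - kap s ∧ kap t - kap s ≤ t - s := by
  have i := fun a b : ℝ => Real.smoothTransition.continuous.intervalIntegrable (μ := volume) a b
  have e : kap t - kap s = ∫ x in s..t, σf x := intervalIntegral.integral_interval_sub_left (i _ _) (i _ _)
  rw [e]
  refine ⟨intervalIntegral.integral_nonneg h fun x _ => Real.smoothTransition.nonneg x, ?_⟩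
  have := intervalIntegral.integral_mono_on h (i s t) (intervalIntegrable_const (c := (1 : ℝ))) fun x _ => Real.smoothTransition.le_one x
  simpa using this
lemma kap_zero {t : ℝ} (h : t ≤ 0) : kap t = 0 := by
  rw [kap, intervalIntegral.integral_symm, neg_eq_zero]
  refine intervalIntegral.integral_zero_ae (ae_of_all _ fun x hx => Real.smoothTransition.zero_of_nonpos ?_)
  rw [uIoc_of_le h] at hx; exact hx.2
lemma kap_nonneg (t : ℝ) : 0 ≤ kap t := by
  rcases le_total t 0 with h | h
  · rw [kap_zero h]
  · have := (kap_le h).1; rwa [kap_zero le_rfl, sub_zero] at this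
lemma kap_pos {t : ℝ} (h : 0 < t) : 0 < kap t :=
  intervalIntegral.intervalIntegral_pos_of_pos_on (Real.smoothTransition.continuous.intervalIntegrable _ _)
    (fun x hx => Real.smoothTransition.pos_of_pos hx.1) h
lemma sig_d (t : ℝ) : 0 ≤ deriv σf t := Real.smoothTransition.monotone.deriv_nonneg

/-- the profile in terms of `s = log t` -/
def hh (s : ℝ) : ℝ := -(1 / 2) * Real.log (1 + s ^ 2)
lemma hh_deriv (s : ℝ) : HasDerivAt hh (-s / (1 + s ^ 2)) s := by
  have h : HasDerivAt (fun s : ℝ => 1 + s ^ 2) (2 * s) s := by simpa using (hasDerivAt_pow 2 s).const_add 1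
  have := (h.log (by positivity)).const_mul (-(1 / 2 : ℝ))
  exact HasDerivAt.congr_deriv (f := hh) this (by field_simp)
lemma hh_sm : ContDiff ℝ ∞ hh := contDiff_const.mul (ContDiff.log (by fun_prop) fun s => by positivity)
def ww (m : ℝ) (s : ℝ) : ℝ := m * (kap (1 + hh s / m) - kap 1)
lemma ww_sm (m : ℝ) : ContDiff ℝ ∞ (ww m) :=
  contDiff_const.mul ((kap_sm.comp (contDiff_const.add (hh_sm.div_const m))).sub contDiff_const)
lemma ww_deriv {m : ℝ} (hm : m ≠ 0) (s : ℝ) : HasDerivAt (ww m) (σf (1 + hh s / m) * (-s / (1 + s ^ 2))) s := by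
  have h := ((kap_deriv (1 + hh s / m)).comp s (((hh_deriv s).div_const m).const_add 1)).sub_const (kap 1) |>.const_mul m
  exact HasDerivAt.congr_deriv (f := ww m) h (by field_simp)
lemma ww_deriv2 {m : ℝ} (hm : 0 < m) (s : ℝ) : ∃ d, HasDerivAt (deriv (ww m)) d s ∧
    σf (1 + hh s / m) * ((s ^ 2 - 1) / (1 + s ^ 2) ^ 2) ≤ d := by
  rw [funext fun s => (ww_deriv hm.ne' s).deriv]
  have h1 := ((cd1 sig_sm (1 + hh s / m)).hasDerivAt).comp s (((hh_deriv s).div_const m).const_add 1)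
  have h2 : HasDerivAt (fun s : ℝ => 1 + s ^ 2) (2 * s) s := by simpa using (hasDerivAt_pow 2 s).const_add 1
  have h3 := (hasDerivAt_id s).neg.div h2 (by positivity)
  refine ⟨_, h1.mul h3, ?_⟩
  have e := sig_d (1 + hh s / m)
  simp only [Function.comp_apply, Pi.neg_apply, id]
  have e2 : σf (1 + hh s / m) * ((-1 * (1 + s ^ 2) - -s * (2 * s)) / (1 + s ^ 2) ^ 2) = σf (1 + hh s / m) * ((s ^ 2 - 1) / (1 + s ^ 2) ^ 2) := by ring
  have : 0 ≤ deriv σf (1 + hh s / m) * (-s / (1 + s ^ 2) / m) * (-s / (1 + s ^ 2)) := by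
    have : deriv σf (1 + hh s / m) * (-s / (1 + s ^ 2) / m) * (-s / (1 + s ^ 2)) = deriv σf (1 + hh s / m) * (-s / (1 + s ^ 2)) ^ 2 / m := by ring
    rw [this]; positivity
  linarith [show id (-s) = -s from rfl]
lemma hh_np (s : ℝ) : hh s ≤ 0 := by
  have := Real.log_nonneg (show (1 : ℝ) ≤ 1 + s ^ 2 by nlinarith [sq_nonneg s])
  unfold hh; linarith
lemma ww_bd {m : ℝ} (hm : 0 < m) (s : ℝ) : -m * kap 1 ≤ ww m s ∧ ww m s ≤ 0 ∧ hh s ≤ ww m s := by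
  have h1 := kap_nonneg (1 + hh s / m)
  have h2 : hh s / m ≤ 0 := div_nonpos_of_nonpos_of_nonneg (hh_np s) hm.le
  have h3 := kap_le (show 1 + hh s / m ≤ 1 by linarith)
  have e : hh s = m * (hh s / m) := by field_simp
  unfold ww
  refine ⟨by nlinarith, by nlinarith, ?_⟩
  conv_lhs => rw [e]
  exact mul_le_mul_of_nonneg_left (by linarith) hm.le
lemma ww_const {m : ℝ} (hm : 0 < m) {s : ℝ} (hs : s ≤ -Real.exp m) : ww m s = -m * kap 1 := by
  have : hh s ≤ -m := by
    have h1 : Real.exp m ^ 2 ≤ 1 + s ^ 2 := by nlinarith [Real.exp_pos m]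
    have h2 := Real.log_le_log (by positivity) h1
    rw [Real.log_pow, Real.log_exp] at h2
    unfold hh; push_cast at h2; linarith
  have h2 : 1 + hh s / m ≤ 0 := by
    have : hh s / m ≤ -1 := by rw [div_le_iff₀ hm]; linarith
    linarith
  rw [ww, kap_zero h2]; ring

def kk (m t : ℝ) : ℝ := if t < Real.exp (-Real.exp m) then -m * kap 1 else ww m (Real.log t)
lemma kk_lt {m t : ℝ} (h : t < Real.exp (-Real.exp m)) : kk m t = -m * kap 1 := if_pos h
lemma kk_pos {m : ℝ} (hm : 0 < m) {t : ℝ} (ht : 0 < t) : kk m t = ww m (Real.log t) := by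
  unfold kk; split_ifs with h
  · rw [ww_const hm]; rw [← Real.log_exp (-Real.exp m)]; exact Real.log_le_log ht h.le
  · rfl
lemma kk_sm {m : ℝ} (hm : 0 < m) : ContDiff ℝ ∞ (kk m) := by
  refine contDiff_iff_contDiffAt.2 fun t => ?_
  by_cases h : t < Real.exp (-Real.exp m)
  · refine (contDiffAt_const (c := -m * kap 1)).congr_of_eventuallyEq ?_
    filter_upwards [Iio_mem_nhds h] with u hu using kk_lt hu
  · have ht : 0 < t := (Real.exp_pos _).trans_le (not_lt.1 h)
    refine ((ww_sm m).contDiffAt.comp t (Real.contDiffAt_log.2 ht.ne')).congr_of_eventuallyEq ?_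
    filter_upwards [Ioi_mem_nhds ht] with u hu using kk_pos hm hu
lemma kk_d1 {m : ℝ} (hm : 0 < m) {t : ℝ} (ht : 0 < t) : deriv (kk m) t = deriv (ww m) (Real.log t) / t := by
  have : kk m =ᶠ[𝓝 t] fun u => ww m (Real.log u) := by
    filter_upwards [Ioi_mem_nhds ht] with u hu using kk_pos hm hu
  rw [this.deriv_eq]
  have := ((cd1 (ww_sm m) (Real.log t)).hasDerivAt.comp t (Real.hasDerivAt_log ht.ne')).deriv
  rw [div_eq_mul_inv, ← this]; rfl
lemma kk_d2 {m : ℝ} (hm : 0 < m) {t : ℝ} (ht : 0 < t) {d : ℝ} (hd : HasDerivAt (deriv (ww m)) d (Real.log t)) :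
    deriv (deriv (kk m)) t = (d - deriv (ww m) (Real.log t)) / t ^ 2 := by
  have : deriv (kk m) =ᶠ[𝓝 t] fun u => deriv (ww m) (Real.log u) / u := by
    filter_upwards [Ioi_mem_nhds ht] with u hu using kk_d1 hm hu
  rw [this.deriv_eq]
  have := ((hd.comp t (Real.hasDerivAt_log ht.ne')).div (hasDerivAt_id t) ht.ne').deriv
  simp only [Function.comp_apply, id] at this
  refine Eq.trans ?_ (this.trans ?_)
  · rfl
  · field_simp

lemma cut_ineq {C t L G g s a σ d : ℝ} (hC : 0 ≤ C) (ht : 0 < t) (hg : 0 ≤ g) (hG : G = g ^ 2)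
    (hQ : G ≤ t * L + C * t * (g + t)) (hσ : 0 ≤ σ) (hσ1 : σ ≤ 1) (ha0 : 0 ≤ a) (ha : a ≤ 1) (hd : σ * (3 / 4 * a ^ 2) ≤ d) :
    1 / 2 * ((σ * a / t) * ((σ * a / t) * G)) - (2 * C ^ 2 + C) ≤ (σ * a / t) * L + (d - σ * a) / t ^ 2 * G := by
  subst hG
  set y := g / t with hy
  have hgy : g = y * t := by rw [hy]; field_simp
  have hy0 : 0 ≤ y := by positivity
  have hL : y ^ 2 * t - C * (y * t + t) ≤ L := by
    rw [hgy] at hQ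
    have : t * (y ^ 2 * t - C * (y * t + t)) ≤ t * L := by linarith [mul_pow y t 2]
    exact le_of_mul_le_mul_left this ht
  have e1 : (σ * a / t) * ((σ * a / t) * g ^ 2) = σ ^ 2 * (a * y) ^ 2 := by rw [hgy]; field_simp
  have e2 : (d - σ * a) / t ^ 2 * g ^ 2 = (d - σ * a) * y ^ 2 := by rw [hgy]; field_simp
  have e3 : σ * a * (y ^ 2 - C * (y + 1)) ≤ σ * a / t * L := by
    have := mul_le_mul_of_nonneg_left hL (show 0 ≤ σ * a / t by positivity)
    refine le_trans (le_of_eq ?_) this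
    field_simp
  rw [e1, e2]
  set X := a * y
  have hX : 0 ≤ X := by positivity
  have f1 : σ * (3 / 4 * X ^ 2) ≤ d * y ^ 2 := by
    have := mul_le_mul_of_nonneg_right hd (sq_nonneg y)
    calc _ = σ * (3 / 4 * a ^ 2) * y ^ 2 := by simp only [X]; ring
      _ ≤ _ := this
  have f2 : σ ^ 2 * X ^ 2 ≤ σ * X ^ 2 := mul_le_mul_of_nonneg_right (pow_le_of_le_one hσ hσ1 two_ne_zero) (sq_nonneg X)
  have f3 : σ * a * (y ^ 2 - C * (y + 1)) = σ * a * y ^ 2 - σ * (C * X) - σ * a * C := by simp only [X]; ring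
  have f4 : σ * (1 / 4 * X ^ 2 - C * X + C ^ 2) ≥ 0 := mul_nonneg hσ (by linarith [sq_nonneg (X / 2 - C)])
  have f5 : σ * a * C ≤ C := mul_le_of_le_one_left hC (mul_le_one₀ hσ1 ha0 ha)
  have f6 : σ * C ^ 2 ≤ C ^ 2 := mul_le_of_le_one_left (sq_nonneg C) hσ1
  linarith [sq_nonneg C]

lemma log20 : Real.log (1 / 20) ≤ -(2.7 : ℝ) := by
  rw [one_div, Real.log_inv]
  have h1 : Real.log 20 = 2 * Real.log 2 + Real.log 5 := by
    rw [show (20 : ℝ) = 2 ^ 2 * 5 by norm_num, Real.log_mul (by norm_num) (by norm_num), Real.log_pow]; norm_num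
  have h2 : Real.log 4 = 2 * Real.log 2 := by
    rw [show (4 : ℝ) = 2 ^ 2 by norm_num, Real.log_pow]; norm_num
  have h3 : Real.log 4 ≤ Real.log 5 := Real.log_le_log (by norm_num) (by norm_num)
  have := Real.log_two_gt_d9
  linarith

lemma cutoff (hJ : JS J) (b : Box J) : ∃ (C κ : ℝ) (P : ℕ → E4 → ℝ) (t : ℕ → ℝ), 0 ≤ C ∧ 0 < κ ∧ (∀ n, ContDiff ℝ ∞ (P n)) ∧
    (∀ n x, -(n + 1) * κ ≤ P n x ∧ P n x ≤ 0) ∧ (∀ n, 0 < t n) ∧ (∀ n x, nn b.W x < t n → P n x = -(n + 1) * κ) ∧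
    (∀ δ > 0, ∃ M, ∀ n x, δ ≤ nn b.W x → -M ≤ P n x) ∧
    ∀ n, ∀ x ∈ b.V, ∀ ξ, Gq J x ξ = 1 → 1 / 2 * GG J (P n) (P n) x ξ - C ≤ LL J (P n) x ξ := by
  obtain ⟨C, hC, hQ⟩ := b.Q
  have hm : ∀ n : ℕ, (0 : ℝ) < n + 1 := fun n => by positivity
  refine ⟨2 * C ^ 2 + C, kap 1, fun n x => kk (n + 1) (nn b.W x), fun n => Real.exp (-Real.exp (n + 1)), by positivity, kap_pos one_pos,
    fun n => (kk_sm (hm n)).comp (nn_sm b.Ws), fun n x => ?_, fun n => Real.exp_pos _, fun n x hx => kk_lt hx, fun δ hδ => ?_, fun n x hx ξ hξ => ?_⟩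
  · dsimp only; unfold kk; split_ifs with h
    · exact ⟨le_rfl, by nlinarith [hm n, kap_pos one_pos]⟩
    · exact ⟨(ww_bd (hm n) _).1, (ww_bd (hm n) _).2.1⟩
  · refine ⟨1 / 2 * Real.log (1 + Real.log δ ^ 2), fun n x hx => ?_⟩
    have h0 : 0 < nn b.W x := hδ.trans_le hx
    dsimp only; rw [kk_pos (hm n) h0]
    refine le_trans ?_ (ww_bd (hm n) _).2.2
    have h1 := Real.log_le_log hδ hx
    have h2 := Real.log_le_log h0 (b.small x)
    have h3 := log20
    have : Real.log (1 + Real.log (nn b.W x) ^ 2) ≤ Real.log (1 + Real.log δ ^ 2) := Real.log_le_log (by positivity) (by nlinarith)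
    unfold hh; linarith
  · have e1 : GG J (fun x => kk (n + 1) (nn b.W x)) (fun x => kk (n + 1) (nn b.W x)) x ξ =
        deriv (kk (n + 1)) (nn b.W x) * (deriv (kk (n + 1)) (nn b.W x) * GG J (nn b.W) (nn b.W) x ξ) := by
      rw [GG_comp (nn_sm b.Ws) (kk_sm (hm n)), GG_comm, GG_comp (nn_sm b.Ws) (kk_sm (hm n))]
    rw [LL_comp hJ (nn_sm b.Ws) (kk_sm (hm n)), e1]
    rcases (nn_nonneg b.W x).lt_or_eq with h0 | h0
    · obtain ⟨d, hd, hdσ⟩ := ww_deriv2 (hm n) (Real.log (nn b.W x))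
      rw [kk_d1 (hm n) h0, kk_d2 (hm n) h0 hd, (ww_deriv (hm n).ne' _).deriv]
      have h2 : Real.log (nn b.W x) ≤ -2.7 := (Real.log_le_log h0 (b.small x)).trans log20
      set s := Real.log (nn b.W x)
      refine cut_ineq (g := √(GG J (nn b.W) (nn b.W) x ξ)) (s := s) hC h0 (Real.sqrt_nonneg _) (Real.sq_sqrt (GG_nonneg _ _ _)).symm (hQ x hx ξ hξ)
        (Real.smoothTransition.nonneg _) (Real.smoothTransition.le_one _) (div_nonneg (by linarith) (by positivity)) ?_ ?_
      · rw [div_le_one (by positivity)]; nlinarith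
      · refine (mul_le_mul_of_nonneg_left ?_ (Real.smoothTransition.nonneg _)).trans hdσ
        rw [div_pow, ← mul_div_assoc]
        gcongr
        nlinarith
    · have : kk ((n : ℝ) + 1) =ᶠ[𝓝 (nn b.W x)] fun _ => -((n : ℝ) + 1) * kap 1 := by
        rw [← h0]
        filter_upwards [Iio_mem_nhds (Real.exp_pos (-Real.exp ((n : ℝ) + 1)))] with u hu using kk_lt hu
      rw [this.deriv.deriv_eq, this.deriv_eq]
      simp only [deriv_const, deriv_const', zero_mul, mul_zero, add_zero]
      nlinarith [sq_nonneg C]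

structure Cut (b : Box J) (C κ : ℝ) (P : ℕ → E4 → ℝ) (t : ℕ → ℝ) : Prop where
  C0 : 0 ≤ C
  κ0 : 0 < κ
  sm : ∀ n, ContDiff ℝ ∞ (P n)
  lo : ∀ n x, -(n + 1) * κ ≤ P n x
  np : ∀ n x, P n x ≤ 0
  t0 : ∀ n, 0 < t n
  near : ∀ n x, nn b.W x < t n → P n x = -(n + 1) * κ
  bd : ∀ δ > 0, ∃ M, ∀ n x, δ ≤ nn b.W x → -M ≤ P n x
  LLP : ∀ n, ∀ x ∈ b.V, ∀ ξ, 1 / 2 * GG J (P n) (P n) x ξ - C * Gq J x ξ ≤ LL J (P n) x ξ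

lemma cutE (hJ : JS J) (b : Box J) : ∃ C κ P t, Cut b C κ P t := by
  obtain ⟨C, κ, P, t, h1, h2, h3, h4, h5, h6, h7, h8⟩ := cutoff hJ b
  refine ⟨C, κ, P, t, h1, h2, h3, fun n x => (h4 n x).1, fun n x => (h4 n x).2, h5, h6, h7, fun n x hx ξ => ?_⟩
  by_cases h0 : ξ = 0
  · have e1 := GG_sc hJ (P n) (P n) x 0 0
    have e2 := Gq_sc hJ x 0 0
    have e3 := LL_sc hJ (P n) x 0 0
    simp only [zero_smul] at e1 e2 e3
    rw [h0, e1, e2, e3]; simp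
  · have hg := Gq_pos hJ x h0
    have := h8 n x hx ((√(Gq J x ξ))⁻¹ • ξ) (by
      rw [Gq_sc hJ, inv_pow, Real.sq_sqrt hg.le, inv_mul_cancel₀ hg.ne'])
    rw [GG_sc hJ, LL_sc hJ, inv_pow, Real.sq_sqrt hg.le] at this
    have h9 := mul_le_mul_of_nonneg_left this hg.le
    have e1 : Gq J x ξ * (1 / 2 * ((Gq J x ξ)⁻¹ * GG J (P n) (P n) x ξ) - C) = 1 / 2 * GG J (P n) (P n) x ξ - C * Gq J x ξ := by field_simp
    have e2 : Gq J x ξ * ((Gq J x ξ)⁻¹ * LL J (P n) x ξ) = LL J (P n) x ξ := by field_simp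
    rwa [e1, e2] at h9

lemma step1 (hJ : JS J) (b : Box J) {N : Set E4} (hN : IsCompact N) {x1 : E4} {f : E4 → ℝ} {r ε c : ℝ} (hf : ContDiff ℝ ∞ f)
    (hV : Metric.closedBall x1 r ⊆ b.V) (hc : 0 < c) (hε : 0 < ε) (hr : 0 < r)
    (h1 : ∀ y ∈ Metric.closedBall x1 r, y ∈ N → f y ≤ -ε * ‖y - x1‖ ^ 2)
    (h2 : ∀ y ∈ Metric.closedBall x1 r, ∀ ξ, c * Gq J y ξ ≤ LL J f y ξ)
    (hL : ∀ y ∈ Metric.closedBall x1 r, y ∈ N → b.W y ≠ 0 → LMPat J N y) :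
    ∀ y ∈ Metric.closedBall x1 r, y ∈ N → b.W y ≠ 0 → f y ≤ -ε * r ^ 2 := by
  intro y0 hy0 hy0N hW
  by_contra hcon
  push Not at hcon
  obtain ⟨C, κ, P, t, h⟩ := cutE hJ b
  have hn0 : 0 < nn b.W y0 := lt_of_le_of_ne (nn_nonneg _ _) (fun h => hW (nn_eq_zero.1 h.symm))
  obtain ⟨M, hM⟩ := h.bd _ hn0
  obtain ⟨τ, hτ, t1, t2⟩ : ∃ τ > 0, τ * C < c ∧ τ * |M| < f y0 + ε * r ^ 2 := by
    have hd : 0 < f y0 + ε * r ^ 2 := by linarith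
    have a1 : ∀ᶠ τ in 𝓝[>] (0 : ℝ), τ * C < c := by
      refine (Tendsto.eventually_lt_const (v := (0 : ℝ)) hc ?_)
      exact tendsto_nhdsWithin_of_tendsto_nhds (by simpa using (continuous_id.mul continuous_const).tendsto (0 : ℝ) (f := fun τ => τ * C))
    have a2 : ∀ᶠ τ in 𝓝[>] (0 : ℝ), τ * |M| < f y0 + ε * r ^ 2 := by
      refine (Tendsto.eventually_lt_const (v := (0 : ℝ)) hd ?_)
      exact tendsto_nhdsWithin_of_tendsto_nhds (by simpa using (continuous_id.mul continuous_const).tendsto (0 : ℝ) (f := fun τ => τ * |M|))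
    obtain ⟨τ, q⟩ := (a1.and (a2.and self_mem_nhdsWithin)).exists
    exact ⟨τ, q.2.2, q.1, q.2.1⟩
  obtain ⟨n, hn⟩ := exists_nat_gt (ε * r ^ 2 / (τ * κ))
  have hκ := h.κ0
  rw [div_lt_iff₀ (by positivity)] at hn
  refine max_contra hJ hN (f := fun y => f y + τ * P n y) (x := x1) (r := r) (b := -ε * r ^ 2) (hf.add (contDiff_const.mul (h.sm n)))
    ⟨y0, ⟨hy0N, hy0⟩, ?_⟩ ?_ ?_ ?_
  · have := mul_le_mul_of_nonneg_left (hM n y0 le_rfl) hτ.le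
    have h3 := mul_le_mul_of_nonneg_left (le_abs_self M) hτ.le
    linarith
  · intro y hy ξ hξ
    rw [LL_add hJ hf (contDiff_const.mul (h.sm n)), LL_cmul hJ (h.sm n)]
    have e1 := h2 y hy ξ
    have e2 := mul_le_mul_of_nonneg_left (h.LLP n y (hV hy) ξ) hτ.le
    have e3 := mul_nonneg hτ.le (GG_nonneg (J := J) (P n) y ξ)
    have e4 := mul_pos (sub_pos.2 t1) (Gq_pos hJ y hξ)
    linarith
  · rintro y ⟨hyN, hy⟩
    have e1 := h1 y (Metric.sphere_subset_closedBall hy) hyN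
    rw [mem_sphere_iff_norm.1 hy] at e1
    have := mul_nonpos_of_nonneg_of_nonpos hτ.le (h.np n y)
    linarith
  · rintro y ⟨hyN, hy⟩ hlt
    refine hL y hy hyN fun h0 => ?_
    rw [h.near n y (by rw [nn_eq_zero.2 h0]; exact h.t0 n)] at hlt
    have e1 := h1 y hy hyN
    have e2 : 0 ≤ ε * ‖y - x1‖ ^ 2 := by positivity
    have e3 : 0 < τ * κ := by positivity
    linarith

structure Cf (b : Box J) (μ : Measure (E4 × E4)) (N : Set E4) (x1 : E4) (f : E4 → ℝ) (r ε c : ℝ) : Prop where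
  hN : IsClosed N
  cl : CL J μ Nᶜ
  ae : ∀ᵐ p ∂μ, Gq J p.1 p.2 = 1
  V : Metric.closedBall x1 r ⊆ b.V
  sm : ContDiff ℝ ∞ f
  f0 : f x1 = 0
  r0 : 0 < r
  e0 : 0 < ε
  c0 : 0 < c
  h1 : ∀ y ∈ Metric.closedBall x1 r, y ∈ N → f y ≤ -ε * ‖y - x1‖ ^ 2
  h2 : ∀ y ∈ Metric.closedBall x1 r, ∀ ξ, c * Gq J y ξ ≤ LL J f y ξ
  off : ∀ y ∈ Metric.closedBall x1 r, y ∈ N → b.W y ≠ 0 → f y ≤ -ε * r ^ 2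

lemma ineq4 {η g a p : ℝ} (ha : 0 ≤ a) (hp : 0 ≤ p) (h : g ^ 2 ≤ a * p) : |4 * η * g| ≤ 1 / 2 * η ^ 2 * p + 8 * a := by
  refine abs_le_of_sq_le_sq ?_ (by positivity)
  nlinarith [mul_le_mul_of_nonneg_left h (sq_nonneg η), sq_nonneg (1 / 2 * η ^ 2 * p - 8 * a)]

lemma step2_alg {k k1 k2 η F Lf LP a g1 g2 p q Le c τ C B : ℝ} (hk : 0 ≤ k) (hk1 : 0 ≤ k1) (hk11 : k1 ≤ 1) (hk2 : 0 ≤ k2) (hF : 0 ≤ F)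
    (hLf : c ≤ Lf) (hLP : 1 / 2 * p - C ≤ LP) (hτ0 : 0 ≤ τ) (hτ1 : τ ≤ 1) (hτ : τ * C ≤ c / 2) (ha : 0 ≤ a) (hp : 0 ≤ p)
    (h2 : g2 ^ 2 ≤ a * p) :
    c / 2 * (η ^ 2 * k1) - (8 * a + 4 * |η| * |g1| + k * |Le|) ≤
      η ^ 2 * (k1 * (Lf + τ * LP) + k2 * F) + 4 * η * k1 * (g1 + τ * g2) + k * Le := by
  have i4 := (abs_le.1 (ineq4 (η := η) ha hp h2)).1
  have e1 : 0 ≤ η ^ 2 * (k2 * F) := by positivity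
  have e2 : -(4 * |η| * |g1|) ≤ 4 * η * k1 * g1 := by
    have : |4 * η * k1 * g1| ≤ 4 * |η| * |g1| := by
      rw [abs_mul, abs_mul, abs_mul, abs_of_nonneg hk1]
      have : |4 * η| = 4 * |η| := by rw [abs_mul]; norm_num
      rw [← abs_mul, this]
      have : 0 ≤ 4 * |η| * |g1| := by positivity
      nlinarith
    linarith [(abs_le.1 this).1]
  have e3 : -(k * |Le|) ≤ k * Le := by
    rw [← mul_neg]; exact mul_le_mul_of_nonneg_left (neg_abs_le _) hk
  have e4 : k1 * η ^ 2 * (c + τ * (1 / 2 * p - C)) ≤ k1 * η ^ 2 * (Lf + τ * LP) :=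
    mul_le_mul_of_nonneg_left (add_le_add hLf (mul_le_mul_of_nonneg_left hLP hτ0)) (by positivity)
  have e5 : k1 * τ * (-(1 / 2 * η ^ 2 * p + 8 * a)) ≤ k1 * τ * (4 * η * g2) := mul_le_mul_of_nonneg_left i4 (by positivity)
  have e6 : k1 * τ * (8 * a) ≤ 8 * a := mul_le_of_le_one_left (by positivity) (mul_le_one₀ hk11 hτ0 hτ1)
  have e7 : k1 * η ^ 2 * (τ * C) ≤ k1 * η ^ 2 * (c / 2) := mul_le_mul_of_nonneg_left hτ (by positivity)
  linarith

lemma LLu (hJ : JS J) {η f P : E4 → ℝ} (hη : ContDiff ℝ ∞ η) (hf : ContDiff ℝ ∞ f) (hP : ContDiff ℝ ∞ P) (τ a : ℝ) (x ξ : E4) :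
    LL J (fun y => (η y * η y) * kap (f y + τ * P y - a)) x ξ =
      η x ^ 2 * (Real.smoothTransition (f x + τ * P x - a) * (LL J f x ξ + τ * LL J P x ξ) +
        deriv Real.smoothTransition (f x + τ * P x - a) * GG J (fun y => f y + τ * P y) (fun y => f y + τ * P y) x ξ) +
      4 * η x * Real.smoothTransition (f x + τ * P x - a) * (GG J η f x ξ + τ * GG J η P x ξ) +
      kap (f x + τ * P x - a) * LL J (fun y => η y * η y) x ξ := by
  have hF : ContDiff ℝ ∞ (fun y => f y + τ * P y) := hf.add (contDiff_const.mul hP)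
  have hk : ContDiff ℝ ∞ (fun t => kap (t - a)) := kap_sm.comp (contDiff_id.sub contDiff_const)
  have d1 : deriv (fun t => kap (t - a)) = fun t => Real.smoothTransition (t - a) := by
    funext t; rw [deriv_comp_sub_const, kap_d]
  have d2 : deriv (fun t => Real.smoothTransition (t - a)) = fun t => deriv Real.smoothTransition (t - a) := by
    funext t; rw [deriv_comp_sub_const]
  have hkF : ContDiff ℝ ∞ (fun y => kap (f y + τ * P y - a)) := hk.comp hF
  have e := LL_comp hJ hF hk x ξ
  have e2 := GG_comp (J := J) (g := η) hF hk x ξ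
  rw [d1] at e e2
  rw [d2] at e
  beta_reduce at e e2
  rw [LL_mul hJ (hη.mul hη) (hkF), GG_mul hη hη, GG_comm η]
  rw [e, e2, LL_add hJ hf (contDiff_const.mul hP), LL_cmul hJ hP, GG_add (h := η) hf (contDiff_const.mul hP), GG_mul (h := η) contDiff_const hP,
    GG_comm f η, GG_comm P η]
  have : GG J (fun _ => τ) η x ξ = 0 := by simp [GG]
  rw [this]; ring

lemma tau_exists {a b c d : ℝ} (h1 : 0 < b) (h2 : 0 < d) : ∃ τ : ℝ, 0 < τ ∧ τ ≤ 1 ∧ τ * a ≤ b ∧ τ * c ≤ d := by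
  have a1 : ∀ {a b : ℝ}, 0 < b → ∀ᶠ τ in 𝓝[>] (0 : ℝ), τ * a < b := fun {a b} h => by
    refine nhdsWithin_le_nhds ?_
    have : Tendsto (fun τ : ℝ => τ * a) (𝓝 0) (𝓝 (0 * a)) := (continuous_id.mul continuous_const).tendsto 0
    rw [zero_mul] at this
    exact this.eventually_lt_const h
  obtain ⟨τ, h⟩ := ((a1 (a := a) h1).and ((a1 (a := c) h2).and ((a1 (a := 1) one_pos).and self_mem_nhdsWithin))).exists
  exact ⟨τ, h.2.2.2, by linarith [h.2.2.1], h.1.le, h.2.1.le⟩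

lemma Cf.step2 (hJ : JS J) {b : Box J} {μ : Measure (E4 × E4)} {N : Set E4} {x1 : E4} {f : E4 → ℝ} {r ε c : ℝ}
    (h : Cf b μ N x1 f r ε c) : ∃ ρ > 0, ρ ≤ r / 2 ∧ (∀ y ∈ Metric.closedBall x1 ρ, y ∈ N → b.W y = 0) ∧
      μ (Prod.fst ⁻¹' (Metric.closedBall x1 ρ ∩ {y | b.W y ≠ 0})) < ⊤ := by
  have hβ : 0 < ε * r ^ 2 := mul_pos h.e0 (pow_pos h.r0 2)
  have hr := h.r0
  set a : ℝ := -(ε * r ^ 2) / 8 with ha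
  obtain ⟨C, κ, P, t, hP⟩ := cutE hJ b
  obtain ⟨η, hη, h01, hηc, hηs, hη1⟩ := cut (isCompact_closedBall x1 (r / 2)) (Metric.isOpen_ball (x := x1) (ε := r))
    (Metric.closedBall_subset_ball (by linarith))
  have hη1' : ∀ y ∈ Metric.closedBall x1 (r / 2), ∀ᶠ x in 𝓝 y, η x = 1 := fun y hy => by
    rw [eventually_nhdsSet_iff_forall] at hη1; exact hη1 y hy
  have hsB : tsupport η ⊆ Metric.closedBall x1 r := hηs.trans Metric.ball_subset_closedBall
  -- radius
  obtain ⟨ρ, hρ, hρr, hρf⟩ : ∃ ρ > 0, ρ ≤ r / 2 ∧ ∀ y ∈ Metric.closedBall x1 ρ, a / 4 < f y := by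
    have : ∀ᶠ y in 𝓝 x1, a / 4 < f y := h.sm.continuous.continuousAt.eventually_const_lt (by rw [h.f0]; linarith)
    obtain ⟨s, hs, h2⟩ := Metric.eventually_nhds_iff.1 this
    exact ⟨min (s / 2) (r / 2), lt_min (by linarith) (by linarith), min_le_right _ _, fun y hy => h2 (lt_of_le_of_lt hy
      (lt_of_le_of_lt (min_le_left _ _) (by linarith)))⟩
  have hρsub : Metric.closedBall x1 ρ ⊆ Metric.closedBall x1 r := Metric.closedBall_subset_closedBall (by linarith)
  have hNW : ∀ y ∈ Metric.closedBall x1 ρ, y ∈ N → b.W y = 0 := fun y hy hyN => by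
    by_contra hW
    have := h.off y (hρsub hy) hyN hW
    linarith [hρf y hy]
  refine ⟨ρ, hρ, hρr, hNW, ?_⟩
  set A : Set E4 := Metric.closedBall x1 r ∩ {y | r / 2 ≤ ‖y - x1‖ ∧ a ≤ f y} with hA
  have hAc : IsCompact A := (isCompact_closedBall x1 r).inter_right
    ((isClosed_le continuous_const (continuous_id.sub continuous_const).norm : IsClosed {y : E4 | r / 2 ≤ ‖y - x1‖}).inter
      (isClosed_le continuous_const h.sm.continuous : IsClosed {y | a ≤ f y}))
  have hAN : A ⊆ Nᶜ := fun y hy hyN => by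
    have h3 := h.h1 y hy.1 hyN
    have h4 : (r / 2) ^ 2 ≤ ‖y - x1‖ ^ 2 := pow_le_pow_left₀ (by linarith) hy.2.1 2
    have h5 := mul_le_mul_of_nonneg_left h4 h.e0.le
    have h6 := hy.2.2
    linarith
  have hAf := h.cl.fin A hAN hAc
  obtain ⟨M0, hM0⟩ := (isCompact_closedBall x1 r).exists_bound_of_continuousOn h.sm.continuous.continuousOn
  have hM00 : 0 ≤ M0 := (norm_nonneg _).trans (hM0 x1 (Metric.mem_closedBall_self hr.le))
  obtain ⟨Ca, hCa, ba⟩ := bdd2 hJ (GG_sm hJ hη hη).continuous (fun x ξ t => GG_sc hJ η η x ξ t) (isCompact_closedBall x1 r)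
  obtain ⟨Cg, hCg, bg⟩ := bdd2 hJ (GG_sm hJ hη h.sm).continuous (fun x ξ t => GG_sc hJ η f x ξ t) (isCompact_closedBall x1 r)
  obtain ⟨Cl, hCl, bl⟩ := LL_bdd hJ (hη.mul hη) (isCompact_closedBall x1 r)
  set C2 : ℝ := 8 * Ca + 4 * Cg + (M0 + |a|) * Cl with hC2
  have hC20 : 0 ≤ C2 := by positivity
  set s0 := Real.smoothTransition (-a / 2) with hs0
  have hs0p : 0 < s0 := Real.smoothTransition.pos_of_pos (by linarith)
  set B : ℕ → Set E4 := fun j => Metric.closedBall x1 ρ ∩ {y | 1 / ((j : ℝ) + 1) ≤ nn b.W y} with hB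
  have hBc : ∀ j, IsCompact (B j) := fun j => (isCompact_closedBall x1 ρ).inter_right
    (isClosed_le continuous_const (nn_sm b.Ws).continuous)
  have hBW : ∀ j, ∀ y ∈ B j, b.W y ≠ 0 := fun j y hy h0 => by
    have h1 := hy.2
    have h2 : (0:ℝ) < 1 / ((j : ℝ) + 1) := by positivity
    rw [mem_setOf_eq, nn_eq_zero.2 h0] at h1
    linarith
  have hBN : ∀ j, B j ⊆ Nᶜ := fun j y hy hyN => hBW j y hy (hNW y hy.1 hyN)
  have key : ∀ j, c / 2 * s0 * μ.real (Prod.fst ⁻¹' (B j)) ≤ C2 * μ.real (Prod.fst ⁻¹' A) := by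
    intro j
    obtain ⟨M, hM⟩ := hP.bd (1 / ((j : ℝ) + 1)) (by positivity)
    obtain ⟨τ, τ0, τ1, τC, τM⟩ := tau_exists (a := C) (b := c / 2) (c := M) (d := -a / 4) (by linarith [h.c0]) (by linarith)
    obtain ⟨n, hn⟩ : ∃ n : ℕ, M0 - τ * ((n + 1) * κ) < a := by
      obtain ⟨n, hn⟩ := exists_nat_gt ((M0 - a) / (τ * κ))
      refine ⟨n, ?_⟩
      have hk := mul_pos τ0 hP.κ0
      rw [div_lt_iff₀ hk] at hn
      linarith
    set u : E4 → ℝ := fun y => (η y * η y) * kap (f y + τ * P n y - a) with hu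
    have hFs : ContDiff ℝ ∞ (fun y => f y + τ * P n y - a) := (h.sm.add (contDiff_const.mul (hP.sm n))).sub contDiff_const
    have hus : ContDiff ℝ ∞ u := (hη.mul hη).mul (kap_sm.comp hFs)
    have hFf : ∀ y, f y + τ * P n y ≤ f y := fun y => by linarith [mul_nonneg τ0.le (neg_nonneg.2 (hP.np n y))]
    have hsu : tsupport u ⊆ tsupport η ∩ {y | 0 ≤ f y + τ * P n y - a} := by
      refine closure_minimal (fun y hy => ⟨?_, ?_⟩) ((isClosed_tsupport _).inter (isClosed_le continuous_const hFs.continuous))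
      · refine subset_tsupport _ fun h0 => hy ?_
        simp [hu, h0]
      · by_contra hn
        exact hy (by simp only [hu]; rw [kap_zero (not_le.1 hn).le, mul_zero])
    have huc : HasCompactSupport u := hηc.of_isClosed_subset (isClosed_tsupport _) (hsu.trans inter_subset_left)
    have huN : tsupport u ⊆ Nᶜ := fun y hy hyN => by
      obtain ⟨h3, h4⟩ := hsu hy
      have h4 : 0 ≤ f y + τ * P n y - a := h4
      by_cases hW : b.W y = 0
      · rw [hP.near n y (by rw [nn_eq_zero.2 hW]; exact hP.t0 n)] at h4
        have := le_of_abs_le (hM0 y (hsB h3))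
        linarith
      · have := h.off y (hsB h3) hyN hW
        linarith [hFf y]
    obtain ⟨-, i2, -, -, i5⟩ := h.cl.ibp hJ h.ae hus (contDiff_const (c := (1:ℝ))) huc huN
    have i6 : ∫ p, LL J u p.1 p.2 ∂μ = 0 := by
      have e : ∀ x ξ, LL J (fun _ : E4 => (1:ℝ)) x ξ = 0 := fun x ξ => LL_const 1 x ξ
      simp only [e, mul_zero, integral_zero, one_mul] at i5
      exact i5.symm
    simp only [one_mul] at i2
    have hpt : ∀ᵐ p ∂μ, (Prod.fst ⁻¹' (B j)).indicator (fun _ => c / 2 * s0) p ≤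
        LL J u p.1 p.2 + (Prod.fst ⁻¹' A).indicator (fun _ => C2) p := by
      filter_upwards [h.ae] with p hp
      obtain ⟨x, ξ⟩ := p
      simp only at hp
      have hind : 0 ≤ (Prod.fst ⁻¹' A).indicator (fun _ : E4 × E4 => C2) (x, ξ) := indicator_nonneg (fun _ _ => hC20) _
      have hBx : (Prod.fst ⁻¹' (B j)).indicator (fun _ : E4 × E4 => c / 2 * s0) (x, ξ) ≤
          c / 2 * (η x ^ 2 * Real.smoothTransition (f x + τ * P n x - a)) := by
        have hc0 := h.c0
        by_cases hxB : x ∈ B j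
        · rw [indicator_of_mem (by exact hxB), (hη1' x (Metric.closedBall_subset_closedBall hρr hxB.1)).self_of_nhds, one_pow, one_mul]
          refine mul_le_mul_of_nonneg_left (Real.smoothTransition.monotone ?_) (by linarith)
          have m1 := mul_le_mul_of_nonneg_left (hM n x hxB.2) τ0.le
          linarith [hρf x hxB.1]
        · rw [indicator_of_notMem (by exact hxB)]
          have := Real.smoothTransition.nonneg (f x + τ * P n x - a)
          positivity
      simp only
      by_cases hx : x ∈ tsupport η
      swap
      · have h1 : x ∉ tsupport u := fun h => hx (hsu h).1
        rw [LL_off h1]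
        rw [image_eq_zero_of_notMem_tsupport hx] at hBx
        simp at hBx
        linarith
      have hxr := hsB hx
      simp only [hu]
      rw [LLu hJ hη h.sm (hP.sm n)]
      have hLf := h.h2 x hxr ξ
      have hLP := hP.LLP n x (h.V hxr) ξ
      rw [hp, mul_one] at hLf hLP
      have alg := step2_alg (η := η x) (B := 0) (q := 0) (kap_nonneg (f x + τ * P n x - a)) (Real.smoothTransition.nonneg _)
        (Real.smoothTransition.le_one (f x + τ * P n x - a)) (sig_d (f x + τ * P n x - a))
        (GG_nonneg (J := J) (fun y => f y + τ * P n y) x ξ) hLf hLP τ0.le τ1 τC (GG_nonneg η x ξ) (GG_nonneg (P n) x ξ)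
        (GG_cs η (P n) x ξ) (g1 := GG J η f x ξ) (Le := LL J (fun y => η y * η y) x ξ)
      suffices hs : 8 * GG J η η x ξ + 4 * |η x| * |GG J η f x ξ| + kap (f x + τ * P n x - a) * |LL J (fun y => η y * η y) x ξ|
          ≤ (Prod.fst ⁻¹' A).indicator (fun _ : E4 × E4 => C2) (x, ξ) ∨ f x < a by
        rcases hs with hs | hs
        · linarith
        · have h0 : f x + τ * P n x - a < 0 := by linarith [hFf x]
          have hd : deriv Real.smoothTransition (f x + τ * P n x - a) = 0 := by
            have : Real.smoothTransition =ᶠ[𝓝 (f x + τ * P n x - a)] fun _ => 0 := by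
              filter_upwards [Iio_mem_nhds h0] with s hs
              exact Real.smoothTransition.zero_of_nonpos (le_of_lt hs)
            rw [this.deriv_eq, deriv_const]
          rw [hd, kap_zero h0.le, Real.smoothTransition.zero_of_nonpos h0.le]
          rw [Real.smoothTransition.zero_of_nonpos h0.le] at hBx
          linarith
      by_cases hfx : f x < a
      · exact Or.inr hfx
      left
      by_cases hxh : x ∈ Metric.closedBall x1 (r / 2)
      · have e1 : η =ᶠ[𝓝 x] fun _ => 1 := hη1' x hxh
        have e2 : (fun y => η y * η y) =ᶠ[𝓝 x] fun _ => 1 := by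
          filter_upwards [e1] with y hy; rw [hy, one_mul]
        have e3 : ∀ g : E4 → ℝ, GG J η g x ξ = 0 := fun g => by
          simp [GG, e1.fderiv_eq]
        rw [e3, e3, LL_congr e2, LL_const]
        simpa using hind
      · have hxA : x ∈ A := ⟨hxr, by rw [Metric.mem_closedBall, dist_eq_norm] at hxh; linarith, not_lt.1 hfx⟩
        rw [indicator_of_mem (by exact hxA)]
        have b1 := le_of_abs_le (ba x hxr ξ)
        have b2 := bg x hxr ξ
        have b3 := bl x hxr ξ
        rw [hp, mul_one] at b1 b2 b3
        have b4 : |η x| ≤ 1 := by rw [abs_of_nonneg (h01 x).1]; exact (h01 x).2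
        have b5 : kap (f x + τ * P n x - a) ≤ M0 + |a| := by
          have k1 : f x + τ * P n x - a ≤ M0 + |a| := by
            have := le_of_abs_le (hM0 x hxr)
            linarith [hFf x, neg_abs_le a]
          have k2 := (kap_le k1).1
          have k3 := (kap_le (s := 0) (t := M0 + |a|) (by positivity)).2
          rw [kap_zero le_rfl] at k3
          linarith
        have b6 : |η x| * |GG J η f x ξ| ≤ 1 * Cg := mul_le_mul b4 b2 (abs_nonneg _) zero_le_one
        have b7 := mul_le_mul b5 b3 (abs_nonneg _) (by positivity)
        linarith
    have hm1 : MeasurableSet (Prod.fst ⁻¹' (B j) : Set (E4 × E4)) := fst_pre (hBc j).measurableSet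
    have hm2 : MeasurableSet (Prod.fst ⁻¹' A : Set (E4 × E4)) := fst_pre hAc.measurableSet
    have j1 : Integrable ((Prod.fst ⁻¹' (B j)).indicator (fun _ : E4 × E4 => c / 2 * s0)) μ :=
      (integrable_indicator_iff hm1).2 (integrableOn_const (h.cl.fin _ (hBN j) (hBc j)).ne)
    have j2 : Integrable ((Prod.fst ⁻¹' A).indicator (fun _ : E4 × E4 => C2)) μ :=
      (integrable_indicator_iff hm2).2 (integrableOn_const hAf.ne)
    have := integral_mono_ae j1 (i2.add j2) hpt
    simp only [Pi.add_apply] at this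
    rw [integral_add i2 j2, i6, integral_indicator hm1, integral_indicator hm2, setIntegral_const, setIntegral_const] at this
    simp only [smul_eq_mul] at this
    linarith
  have hU : (Prod.fst ⁻¹' (Metric.closedBall x1 ρ ∩ {y | b.W y ≠ 0}) : Set (E4 × E4)) = ⋃ j, Prod.fst ⁻¹' (B j) := by
    ext p
    simp only [mem_preimage, mem_iUnion]
    refine ⟨fun hp => ?_, fun ⟨j, hj⟩ => ⟨hj.1, hBW j _ hj⟩⟩
    have : 0 < nn b.W p.1 := lt_of_le_of_ne (nn_nonneg _ _) (fun h => hp.2 (nn_eq_zero.1 h.symm))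
    obtain ⟨j, hj⟩ := exists_nat_one_div_lt this
    exact ⟨j, hp.1, hj.le⟩
  have hmono : Monotone fun j => (Prod.fst ⁻¹' (B j) : Set (E4 × E4)) := fun i j hij p hp =>
    ⟨hp.1, le_trans (one_div_le_one_div_of_le (by positivity : (0:ℝ) < (i:ℝ) + 1) (by exact_mod_cast Nat.succ_le_succ hij)) hp.2⟩
  rw [hU, hmono.measure_iUnion]
  refine lt_of_le_of_lt (iSup_le (a := ENNReal.ofReal (C2 * μ.real (Prod.fst ⁻¹' A) / (c / 2 * s0))) fun j => ?_) ENNReal.ofReal_lt_top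
  rw [ENNReal.le_ofReal_iff_toReal_le (h.cl.fin _ (hBN j) (hBc j)).ne
    (div_nonneg (mul_nonneg hC20 measureReal_nonneg) (mul_nonneg (by linarith [h.c0]) hs0p.le)),
    le_div_iff₀ (mul_pos (by linarith [h.c0]) hs0p)]
  have := key j
  rw [measureReal_def] at this
  linarith

structure Pn (b : Box J) (C κ : ℝ) (p : ℕ → E4 → ℝ) (t : ℕ → ℝ) : Prop where
  C0 : 0 ≤ C
  κ0 : 0 < κ
  sm : ∀ n, ContDiff ℝ ∞ (p n)
  lo : ∀ n x, 0 ≤ p n x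
  up : ∀ n x, p n x ≤ κ
  t0 : ∀ n, 0 < t n
  near : ∀ n x, nn b.W x < t n → p n x = 0
  lim : ∀ x, b.W x ≠ 0 → Tendsto (fun n => p n x) atTop (𝓝 κ)
  LLp : ∀ n : ℕ, ∀ x ∈ b.V, ∀ ξ, ((n : ℝ) + 1) / 2 * GG J (p n) (p n) x ξ - C / ((n : ℝ) + 1) * Gq J x ξ ≤ LL J (p n) x ξ

lemma pnE (hJ : JS J) (b : Box J) : ∃ C κ p t, Pn b C κ p t := by
  obtain ⟨C, κ, P, t, h⟩ := cutE hJ b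
  have hp : ∀ n : ℕ, (0:ℝ) < (n:ℝ) + 1 := fun n => by positivity
  have hs : ∀ n : ℕ, ContDiff ℝ ∞ (fun x => (1 / ((n:ℝ) + 1)) * P n x) := fun n => contDiff_const.mul (h.sm n)
  refine ⟨C, κ, fun n x => κ + (1 / ((n:ℝ) + 1)) * P n x, t, h.C0, h.κ0, fun n => contDiff_const.add (hs n), fun n x => ?_,
    fun n x => ?_, h.t0, fun n x hx => ?_, fun x hx => ?_, fun n x hx ξ => ?_⟩
  · have := h.lo n x
    have h2 : (1 / ((n:ℝ) + 1)) * (-(n + 1) * κ) ≤ (1 / ((n:ℝ) + 1)) * P n x := mul_le_mul_of_nonneg_left this (by positivity)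
    have h3 : (1 / ((n:ℝ) + 1)) * (-(n + 1) * κ) = -κ := by have := (hp n).ne'; field_simp
    linarith
  · have : (1 / ((n:ℝ) + 1)) * P n x ≤ 0 := mul_nonpos_of_nonneg_of_nonpos (by positivity) (h.np n x)
    linarith
  · rw [h.near n x hx]; have := (hp n).ne'; field_simp; ring
  · have hn0 : 0 < nn b.W x := lt_of_le_of_ne (nn_nonneg _ _) (fun h => hx (nn_eq_zero.1 h.symm))
    obtain ⟨M, hM⟩ := h.bd _ hn0
    have l1 : Tendsto (fun n : ℕ => (1 / ((n:ℝ) + 1)) * P n x) atTop (𝓝 0) := by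
      refine squeeze_zero_norm (a := fun n : ℕ => (1 / ((n:ℝ) + 1)) * M) (fun n => ?_) ?_
      · rw [norm_mul, Real.norm_of_nonneg (by positivity)]
        refine mul_le_mul_of_nonneg_left ?_ (by positivity)
        rw [Real.norm_eq_abs, abs_of_nonpos (h.np n x)]
        linarith [hM n x le_rfl]
      · simpa using (tendsto_one_div_add_atTop_nhds_zero_nat (𝕜 := ℝ)).mul_const M
    simpa using l1.const_add κ
  · have e := h.LLP n x hx ξ
    rw [LL_add hJ contDiff_const (hs n), LL_const, LL_cmul hJ (h.sm n)]
    have e2 : ∀ g : E4 → ℝ, GG J (fun x => κ + (1 / ((n:ℝ) + 1)) * P n x) g x ξ = (1 / ((n:ℝ) + 1)) * GG J (P n) g x ξ := fun g => by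
      rw [GG_add contDiff_const (hs n), GG_mul contDiff_const (h.sm n)]
      simp [GG]
    rw [e2, GG_comm, e2]
    have e3 := mul_le_mul_of_nonneg_left e (one_div_nonneg.2 (hp n).le)
    refine le_trans (le_of_eq ?_) (e3.trans (le_of_eq (by ring)))
    have := (hp n).ne'
    field_simp

structure Mo (b : Box J) (ν : Measure (E4 × E4)) (x1 : E4) (ρ : ℝ) : Prop where
  ae : ∀ᵐ p ∂ν, Gq J p.1 p.2 = 1
  off : ∀ᵐ p ∂ν, b.W p.1 ≠ 0
  fin : ν (Prod.fst ⁻¹' Metric.closedBall x1 ρ) < ⊤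
  cl : CL J ν (Metric.ball x1 ρ ∩ {y | b.W y ≠ 0})
  V : Metric.closedBall x1 ρ ⊆ b.V

section
variable {b : Box J} {ν : Measure (E4 × E4)} {x1 : E4} {ρ C κ : ℝ} {p : ℕ → E4 → ℝ} {t : ℕ → ℝ}

lemma Mo.int (hJ : JS J) (h : Mo b ν x1 ρ) {Ψ : E4 → E4 → ℝ} (hc : Continuous (fun p : E4 × E4 => Ψ p.1 p.2))
    (hs : ∀ x ξ t, Ψ x (t • ξ) = t ^ 2 * Ψ x ξ) {S : Set E4} (hS : S ⊆ Metric.ball x1 ρ) (h0 : ∀ x ∉ S, ∀ ξ, Ψ x ξ = 0) :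
    Integrable (fun p => Ψ p.1 p.2) ν :=
  intg hJ h.ae hc hs (isCompact_closedBall x1 ρ) h.fin fun x hx ξ => h0 x (fun h => hx (Metric.ball_subset_closedBall (hS h))) ξ

lemma Mo.lim (h : Mo b ν x1 ρ) (P : Pn b C κ p t) {Θ : E4 × E4 → ℝ} (hΘ : Integrable Θ ν) :
    Tendsto (fun n => ∫ q, p n q.1 * Θ q ∂ν) atTop (𝓝 (κ * ∫ q, Θ q ∂ν)) := by
  rw [← integral_const_mul]
  refine tendsto_integral_of_dominated_convergence (fun q => κ * |Θ q|) (fun n => ?_) (hΘ.abs.const_mul κ) (fun n => ?_) ?_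
  · exact ((P.sm n).continuous.comp continuous_fst).aestronglyMeasurable.mul hΘ.1
  · refine Eventually.of_forall fun q => ?_
    rw [norm_mul, Real.norm_of_nonneg (P.lo n _)]
    exact mul_le_mul_of_nonneg_right (P.up n _) (abs_nonneg _)
  · filter_upwards [h.off] with q hq
    exact (P.lim _ hq).mul_const _

lemma mul_off {g : E4 → ℝ} {F : E4 → E4 → ℝ} : ∀ x ∉ tsupport g, ∀ ξ, g x * F x ξ = 0 := fun x hx ξ => by
  rw [image_eq_zero_of_notMem_tsupport hx, zero_mul]

lemma Mo.ibp (hJ : JS J) (h : Mo b ν x1 ρ) (P : Pn b C κ p t) {g : E4 → ℝ} (hg : ContDiff ℝ ∞ g) (hgc : HasCompactSupport g)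
    (hgs : tsupport g ⊆ Metric.ball x1 ρ) (n : ℕ) : Integrable (fun q => g q.1 * LL J (p n) q.1 q.2) ν ∧
      Integrable (fun q => LL J g q.1 q.2) ν ∧ ∫ q, p n q.1 * LL J g q.1 q.2 ∂ν = ∫ q, g q.1 * LL J (p n) q.1 q.2 ∂ν := by
  obtain ⟨χ, hχ, -, hχc, hχs, hχ1⟩ := cut hgc Metric.isOpen_ball hgs
  rw [eventually_nhdsSet_iff_forall] at hχ1
  refine ⟨h.int hJ (Ψ := fun x ξ => g x * LL J (p n) x ξ) ((hg.continuous.comp continuous_fst).mul (LL_sm hJ (P.sm n)).continuous)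
    (fun x ξ t => by rw [LL_sc hJ]; ring) hgs mul_off, h.int hJ (LL_sm hJ hg).continuous (LL_sc hJ g) hgs
    (fun x hx => LL_off hx), ?_⟩
  have hs : tsupport (fun y => χ y * p n y) ⊆ tsupport χ ∩ {y | t n ≤ nn b.W y} := by
    refine closure_minimal (fun y hy => ⟨subset_tsupport _ fun h0 => hy (by simp [h0]), ?_⟩)
      ((isClosed_tsupport _).inter (isClosed_le continuous_const (nn_sm b.Ws).continuous))
    by_contra hn
    exact hy (by simp only; rw [P.near n y (not_le.1 hn), mul_zero])
  have := (h.cl.ibp hJ h.ae (hχ.mul (P.sm n)) hg (hχc.of_isClosed_subset (isClosed_tsupport _) (hs.trans inter_subset_left))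
    (fun y hy => ⟨hχs (hs hy).1, fun h0 => by
      have h1 : t n ≤ nn b.W y := (hs hy).2
      rw [nn_eq_zero.2 h0] at h1; linarith [P.t0 n]⟩)).2.2.2.2
  refine Eq.trans (integral_congr_ae (Eventually.of_forall fun q => ?_)) (this.trans (integral_congr_ae (Eventually.of_forall fun q => ?_)))
  · by_cases hq : q.1 ∈ tsupport g
    · simp only; rw [(hχ1 _ hq).self_of_nhds, one_mul]
    · simp only; rw [LL_off hq, mul_zero, mul_zero]
  · by_cases hq : q.1 ∈ tsupport g
    · simp only
      rw [LL_congr (g := p n) ((hχ1 _ hq).mono fun y hy => by rw [hy, one_mul])]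
    · simp only; rw [image_eq_zero_of_notMem_tsupport hq, zero_mul, zero_mul]

/-- the density of the measures `ν_n` -/
def Dn (J : E4 → E4 →L[ℝ] E4) (C : ℝ) (p : ℕ → E4 → ℝ) (n : ℕ) (x ξ : E4) : ℝ := LL J (p n) x ξ + C / ((n:ℝ) + 1) * Gq J x ξ

lemma Mo.D_lim (hJ : JS J) (h : Mo b ν x1 ρ) (P : Pn b C κ p t) {g : E4 → ℝ} (hg : ContDiff ℝ ∞ g) (hgc : HasCompactSupport g)
    (hgs : tsupport g ⊆ Metric.ball x1 ρ) : (∀ n, Integrable (fun q => g q.1 * Dn J C p n q.1 q.2) ν) ∧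
      Tendsto (fun n => ∫ q, g q.1 * Dn J C p n q.1 q.2 ∂ν) atTop (𝓝 (κ * ∫ q, LL J g q.1 q.2 ∂ν)) := by
  have i1 := h.int hJ (Ψ := fun x ξ => g x * Gq J x ξ) ((hg.continuous.comp continuous_fst).mul (Gq_sm hJ).continuous)
    (fun x ξ t => by rw [Gq_sc hJ]; ring) hgs mul_off
  have e : ∀ n, (fun q : E4 × E4 => g q.1 * Dn J C p n q.1 q.2) =
      fun q => g q.1 * LL J (p n) q.1 q.2 + C / ((n:ℝ) + 1) * (g q.1 * Gq J q.1 q.2) := fun n => by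
    funext q; simp only [Dn]; ring
  have i2 := fun n => h.ibp hJ P hg hgc hgs n
  refine ⟨fun n => by rw [e]; exact (i2 n).1.add (i1.const_mul _), ?_⟩
  have e2 : ∀ n, ∫ q, g q.1 * Dn J C p n q.1 q.2 ∂ν = ∫ q, p n q.1 * LL J g q.1 q.2 ∂ν +
      C / ((n:ℝ) + 1) * ∫ q, g q.1 * Gq J q.1 q.2 ∂ν := fun n => by
    rw [e, integral_add (i2 n).1 (i1.const_mul _), integral_const_mul, (i2 n).2.2]
  simp_rw [e2]
  have l1 : Tendsto (fun n : ℕ => C / ((n:ℝ) + 1)) atTop (𝓝 0) := by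
    simpa [div_eq_mul_inv] using (tendsto_one_div_add_atTop_nhds_zero_nat (𝕜 := ℝ)).const_mul C
  simpa using (h.lim P (i2 0).2.1).add (l1.mul_const _)

lemma Mo.G_lim (hJ : JS J) (h : Mo b ν x1 ρ) (P : Pn b C κ p t) {g : E4 → ℝ} (hg : ContDiff ℝ ∞ g) (hgc : HasCompactSupport g)
    (hgs : tsupport g ⊆ Metric.ball x1 ρ) (hg0 : ∀ x, 0 ≤ g x) : (∀ n, Integrable (fun q => g q.1 * GG J (p n) (p n) q.1 q.2) ν) ∧
      Tendsto (fun n => ∫ q, g q.1 * GG J (p n) (p n) q.1 q.2 ∂ν) atTop (𝓝 0) := by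
  obtain ⟨i1, l1⟩ := h.D_lim hJ P hg hgc hgs
  have i2 : ∀ n, Integrable (fun q => g q.1 * GG J (p n) (p n) q.1 q.2) ν := fun n =>
    h.int hJ (Ψ := fun x ξ => g x * GG J (p n) (p n) x ξ) ((hg.continuous.comp continuous_fst).mul (GG_sm hJ (P.sm n) (P.sm n)).continuous)
    (fun x ξ t => by rw [GG_sc hJ]; ring) hgs mul_off
  refine ⟨i2, squeeze_zero (fun n => integral_nonneg fun q => mul_nonneg (hg0 _) (GG_nonneg _ _ _)) (g := fun n : ℕ =>
    2 * (1 / ((n:ℝ) + 1)) * ∫ q, g q.1 * Dn J C p n q.1 q.2 ∂ν) (fun n => ?_) (by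
      simpa using ((tendsto_one_div_add_atTop_nhds_zero_nat (𝕜 := ℝ)).const_mul 2).mul l1)⟩
  rw [← integral_const_mul]
  refine integral_mono (i2 n) ((i1 n).const_mul _) fun q => ?_
  simp only
  by_cases hq : q.1 ∈ tsupport g
  · have h1 := P.LLp n q.1 (h.V (Metric.ball_subset_closedBall (hgs hq))) q.2
    have h2 : ((n : ℝ) + 1) / 2 * GG J (p n) (p n) q.1 q.2 ≤ Dn J C p n q.1 q.2 := by unfold Dn; linarith
    have hp : (0:ℝ) < (n:ℝ) + 1 := by positivity
    have h3 := mul_le_mul_of_nonneg_left h2 (mul_nonneg (hg0 q.1) (mul_pos two_pos (one_div_pos.2 hp)).le)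
    refine le_trans (le_of_eq ?_) (h3.trans (le_of_eq (by ring)))
    field_simp
  · rw [image_eq_zero_of_notMem_tsupport hq]; simp

lemma Mo.closed (hJ : JS J) (h : Mo b ν x1 ρ) : CL J ν (Metric.ball x1 ρ) := by
  obtain ⟨C, κ, p, t, P⟩ := pnE hJ b
  refine ⟨fun S hS _ => lt_of_le_of_lt (measure_mono (preimage_mono (hS.trans Metric.ball_subset_closedBall))) h.fin,
    fun α hα hαc hαs => ?_⟩
  obtain ⟨χ, hχ, hχ01, hχc, hχs, hχ1⟩ := cut hαc Metric.isOpen_ball hαs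
  rw [eventually_nhdsSet_iff_forall] at hχ1
  obtain ⟨iG, lG⟩ := h.G_lim hJ P hχ hχc hχs fun x => (hχ01 x).1
  have idd : Integrable (fun q => dd J α q.1 q.2) ν := h.int hJ (dd_sm hJ hα).continuous (dd_sc hJ α) hαs fun x hx => dd_off hx
  have hαap : ∀ {f : E4 × E4 → E4}, Continuous f → Continuous fun q : E4 × E4 => α q.1 (f q) := fun hf =>
    (hα.continuous.comp continuous_fst).clm_apply hf
  have hJc : Continuous fun q : E4 × E4 => J q.1 q.2 := (hJ.sm.continuous.comp continuous_fst).clm_apply continuous_snd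
  have hα0 : ∀ x ∉ tsupport α, α x = 0 := fun x hx => image_eq_zero_of_notMem_tsupport hx
  set Aq : E4 → E4 → ℝ := fun x ξ => α x ξ ^ 2 + α x (J x ξ) ^ 2 with hAq
  have iA : Integrable (fun q => Aq q.1 q.2) ν := h.int hJ (Ψ := Aq)
    (((hαap continuous_snd).pow 2).add ((hαap hJc).pow 2))
    (fun x ξ t => by simp only [hAq, map_smul, smul_eq_mul]; ring) hαs fun x hx ξ => by simp [hAq, hα0 x hx]
  have key : ∀ δ > 0, ∀ n, |∫ q, p n q.1 * dd J α q.1 q.2 ∂ν| ≤ δ * ∫ q, Aq q.1 q.2 ∂ν + δ⁻¹ * ∫ q, χ q.1 * GG J (p n) (p n) q.1 q.2 ∂ν := by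
    intro δ hδ n
    have hs : tsupport (fun y => p n y • α y) ⊆ tsupport α ∩ {y | t n ≤ nn b.W y} := by
      refine closure_minimal (fun y hy => ⟨subset_tsupport _ fun h0 => hy (by simp [h0]), ?_⟩)
        ((isClosed_tsupport _).inter (isClosed_le continuous_const (nn_sm b.Ws).continuous))
      by_contra hn
      exact hy (by simp only; rw [P.near n y (not_le.1 hn), zero_smul])
    have hsm : ContDiff ℝ ∞ (fun y => p n y • α y) := (P.sm n).smul hα
    have h1 := h.cl.cl _ hsm (hαc.of_isClosed_subset (isClosed_tsupport _) (hs.trans inter_subset_left))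
      (fun y hy => ⟨hαs (hs hy).1, fun h0 => by
        have h1 : t n ≤ nn b.W y := (hs hy).2
        rw [nn_eq_zero.2 h0] at h1; linarith [P.t0 n]⟩)
    have i1 : Integrable (fun q => dd J (fun y => p n y • α y) q.1 q.2) ν := h.int hJ (dd_sm hJ hsm).continuous (dd_sc hJ _) hαs
      fun x hx => dd_off fun hn => hx (hs hn).1
    have i2 : Integrable (fun q => p n q.1 * dd J α q.1 q.2) ν := h.int hJ (Ψ := fun x ξ => p n x * dd J α x ξ)
      (((P.sm n).continuous.comp continuous_fst).mul (dd_sm hJ hα).continuous) (fun x ξ t => by rw [dd_sc hJ]; ring) hαs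
      fun x hx ξ => by rw [dd_off hx, mul_zero]
    have e : ∫ q, p n q.1 * dd J α q.1 q.2 ∂ν = ∫ q, (p n q.1 * dd J α q.1 q.2 - dd J (fun y => p n y • α y) q.1 q.2) ∂ν := by
      rw [integral_sub i2 i1, h1, sub_zero]
    rw [e, ← integral_const_mul, ← integral_const_mul, ← integral_add (iA.const_mul _) ((iG n).const_mul _)]
    refine (abs_integral_le_integral_abs).trans (integral_mono (i2.sub i1).abs ((iA.const_mul _).add ((iG n).const_mul _)) fun q => ?_)
    simp only [Pi.add_apply]
    by_cases hq : q.1 ∈ tsupport α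
    · rw [dd_smul (cd1 (P.sm n) _) (cd1 hα _), (hχ1 _ hq).self_of_nhds, one_mul]
      simp only [hAq, GG]
      set a := fderiv ℝ (p n) q.1 q.2
      set b' := fderiv ℝ (p n) q.1 (J q.1 q.2)
      set c := α q.1 q.2
      set d := α q.1 (J q.1 q.2)
      have e1 : p n q.1 * dd J α q.1 q.2 - (p n q.1 * dd J α q.1 q.2 + a * d - b' * c) = b' * c - a * d := by ring
      rw [e1]
      have k1 : ∀ u v : ℝ, |u * v| ≤ δ * v ^ 2 + δ⁻¹ * (u * u) := fun u v => by
        have k2 : δ * v ^ 2 + δ⁻¹ * (u * u) - |u * v| = δ⁻¹ * ((|u| - δ * |v| / 2) ^ 2 + 3 / 4 * (δ * |v|) ^ 2) := by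
          rw [abs_mul]; field_simp; nlinarith [sq_abs u, sq_abs v]
        have k3 : 0 ≤ δ⁻¹ * ((|u| - δ * |v| / 2) ^ 2 + 3 / 4 * (δ * |v|) ^ 2) := by positivity
        linarith
      have := abs_sub (b' * c) (a * d)
      linarith [k1 b' c, k1 a d]
    · rw [dd_off hq, dd_off fun hn => hq (hs hn).1]
      simp only [mul_zero, sub_zero, abs_zero]
      have := GG_nonneg (J := J) (p n) q.1 q.2
      have := (hχ01 q.1).1
      simp only [hAq]
      positivity
  have key2 : ∀ δ > 0, κ * |∫ q, dd J α q.1 q.2 ∂ν| ≤ δ * ∫ q, Aq q.1 q.2 ∂ν := fun δ hδ => by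
    have := le_of_tendsto_of_tendsto' (h.lim P idd).abs ((tendsto_const_nhds (x := δ * ∫ q, Aq q.1 q.2 ∂ν)).add (lG.const_mul δ⁻¹))
      (fun n => key δ hδ n)
    rwa [mul_zero, add_zero, abs_mul, abs_of_pos P.κ0] at this
  have key3 : κ * |∫ q, dd J α q.1 q.2 ∂ν| ≤ 0 := by
    have l : Tendsto (fun δ : ℝ => δ * ∫ q, Aq q.1 q.2 ∂ν) (𝓝[>] 0) (𝓝 (0 * ∫ q, Aq q.1 q.2 ∂ν)) :=
      ((continuous_id.mul continuous_const).tendsto 0).mono_left nhdsWithin_le_nhds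
    rw [zero_mul] at l
    exact ge_of_tendsto l (eventually_nhdsWithin_of_forall fun δ hδ => key2 δ hδ)
  have := abs_nonneg (∫ q, dd J α q.1 q.2 ∂ν)
  have h0 := P.κ0
  exact abs_eq_zero.1 (le_antisymm (nonpos_of_mul_nonpos_right key3 h0) this)
end

def qq (J : E4 → E4 →L[ℝ] E4) (a : E4) (y : E4) : ℝ := omega0 (y - a) (J a (y - a))

lemma om_add (a b c : E4) : omega0 (a + b) c = omega0 a c + omega0 b c := by simp only [← omB_apply, map_add, LinearMap.add_apply]
lemma om_neg (a c : E4) : omega0 (-a) c = -omega0 a c := by simp only [← omB_apply, map_neg, LinearMap.neg_apply]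
lemma om_sub (a b c : E4) : omega0 (a - b) c = omega0 a c - omega0 b c := by simp only [← omB_apply, map_sub, LinearMap.sub_apply]
lemma om_subr (a b c : E4) : omega0 c (a - b) = omega0 c a - omega0 c b := by simp only [← omB_apply, map_sub]
lemma om_le (v w : E4) : |omega0 v w| ≤ 4 * ‖v‖ * ‖w‖ := by
  have h : ∀ i j, |v i * w j| ≤ ‖v‖ * ‖w‖ := fun i j => by
    rw [abs_mul]; exact mul_le_mul (PiLp.norm_apply_le v i) (PiLp.norm_apply_le w j) (abs_nonneg _) (norm_nonneg _)
  have h1 := abs_le.1 (h 0 1)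
  have h2 := abs_le.1 (h 1 0)
  have h3 := abs_le.1 (h 2 3)
  have h4 := abs_le.1 (h 3 2)
  unfold omega0
  exact abs_le.2 ⟨by linarith, by linarith⟩
def omC : E4 →L[ℝ] E4 →L[ℝ] ℝ := LinearMap.mkContinuous₂ omB 4 om_le
lemma omC_apply (v w : E4) : omC v w = omega0 v w := rfl
lemma om_symm (hJ : JS J) (a u v : E4) : omega0 u (J a v) = omega0 v (J a u) := by
  rw [om_swap u, ← hJ.inv a (J a v) u, hJ.sq, om_neg, neg_neg]

lemma qq_sm (J : E4 → E4 →L[ℝ] E4) (a : E4) : ContDiff ℝ ∞ (qq J a) :=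
  om_sm (contDiff_id.sub contDiff_const) ((J a).contDiff.comp (contDiff_id.sub contDiff_const))

def qd (J : E4 → E4 →L[ℝ] E4) (a y : E4) : E4 →L[ℝ] ℝ := (2:ℝ) • omC.flip (J a (y - a))
lemma qd_apply (a y ζ : E4) : qd J a y ζ = 2 * omega0 ζ (J a (y - a)) := by
  rfl

lemma qq_fd (hJ : JS J) (a y : E4) : fderiv ℝ (qq J a) y = qd J a y := by
  have h1 : HasFDerivAt (fun y : E4 => y - a) (ContinuousLinearMap.id ℝ E4) y := (hasFDerivAt_id y).sub_const a
  have h2 : HasFDerivAt (fun y : E4 => J a (y - a)) ((J a).comp (ContinuousLinearMap.id ℝ E4)) y := (J a).hasFDerivAt.comp y h1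
  have h3 := (omC.hasFDerivAt_of_bilinear h1 h2)
  have h4 : HasFDerivAt (qq J a) _ y := h3
  rw [h4.fderiv]
  ext ζ
  simp only [ContinuousLinearMap.add_apply, ContinuousLinearMap.precompR_apply, ContinuousLinearMap.precompL_apply, qd_apply, ContinuousLinearMap.compL_apply,
    ContinuousLinearMap.comp_apply, ContinuousLinearMap.id_apply, omC_apply]
  rw [om_symm hJ a (y - a) ζ]; ring

lemma qq_GG (hJ : JS J) (a y ξ : E4) : GG J (qq J a) (qq J a) y ξ =
    4 * (omega0 ξ (J a (y - a)) ^ 2 + omega0 (J y ξ) (J a (y - a)) ^ 2) := by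
  simp only [GG, qq_fd hJ, qd_apply]; ring

lemma qq_LL (hJ : JS J) (a y ξ : E4) : LL J (qq J a) y ξ = 2 * omega0 ξ (J a ξ) + 2 * omega0 (J y ξ) (J a (J y ξ))
    - 2 * omega0 (fderiv ℝ J y ξ (J y ξ) - fderiv ℝ J y (J y ξ) ξ) (J a (y - a)) := by
  have e : dc J (qq J a) = fun y => (qd J a y).comp (J y) := by funext y; rw [dc, qq_fd hJ]
  have h1 : HasFDerivAt (fun y : E4 => y - a) (ContinuousLinearMap.id ℝ E4) y := (hasFDerivAt_id y).sub_const a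
  obtain ⟨T, hT⟩ : ∃ T : E4 →L[ℝ] E4 →L[ℝ] ℝ, T = ((2:ℝ) • omC.flip).comp (J a) := ⟨_, rfl⟩
  have h2 : HasFDerivAt (qd J a) (T.comp (ContinuousLinearMap.id ℝ E4)) y := by
    have := T.hasFDerivAt.comp y h1
    rw [hT] at this ⊢; exact this
  have h3 := HasFDerivAt.clm_comp (G := E4) (c := qd J a) (d := J) h2 (cd1 hJ.sm y).hasFDerivAt
  rw [← e] at h3
  simp only [LL, dd, h3.fderiv]
  have e5 : ∀ ζ θ : E4, ((ContinuousLinearMap.compL ℝ E4 E4 ℝ (qd J a y)).comp (fderiv ℝ J y) +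
      ((ContinuousLinearMap.compL ℝ E4 E4 ℝ).flip (J y)).comp (T.comp (ContinuousLinearMap.id ℝ E4))) ζ θ
      = 2 * omega0 (fderiv ℝ J y ζ θ) (J a (y - a)) + 2 * omega0 (J y θ) (J a ζ) := fun ζ θ => by
    rw [← qd_apply (J := J), hT]; rfl
  rw [e5, e5, hJ.sq, om_neg, om_sub]
  ring

lemma herm_cs (hJ : JS J) (a u w : E4) : omega0 u (J a w) ^ 2 + omega0 u w ^ 2 ≤ Gq J a u * Gq J a w := by
  by_cases hu : u = 0
  · have e : ∀ z, omega0 (0 : E4) z = 0 := fun z => by simp [← omC_apply]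
    simp [hu, Gq, e]
  have hp := Gq_pos hJ a hu
  set A := omega0 u (J a w)
  set B := omega0 u w
  set G := Gq J a u
  have h0 : 0 ≤ Gq J a (G • w - (A • u + B • J a u)) := by
    by_cases hz : G • w - (A • u + B • J a u) = 0
    · rw [hz, Gq, map_zero, om_self]
    · exact (Gq_pos hJ a hz).le
  have e1 : Gq J a (G • w - (A • u + B • J a u)) = G ^ 2 * Gq J a w - 2 * G * (A ^ 2 + B ^ 2) + (A ^ 2 + B ^ 2) * G := by
    have e2 : ∀ x y : E4, Gq J a (x - y) = Gq J a x - 2 * omega0 y (J a x) + Gq J a y := fun x y => by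
      simp only [Gq, map_sub, om_sub, om_subr]; rw [om_symm hJ a x y]; ring
    rw [e2, Gq_sc hJ, Gq_rot hJ]
    have e3 : omega0 (A • u + B • J a u) (J a (G • w)) = G * (A ^ 2 + B ^ 2) := by
      simp only [map_smul, om_add]
      have e4 : ∀ (r s : ℝ) (x y : E4), omega0 (r • x) (s • y) = r * s * omega0 x y := fun r s x y => by
        simp only [← omC_apply, map_smul, ContinuousLinearMap.smul_apply, smul_eq_mul]; ring
      rw [e4, e4, hJ.inv]; ring
    rw [e3]; ring
  rw [e1] at h0
  have h1 : 0 ≤ G * (G * Gq J a w - (A ^ 2 + B ^ 2)) := by linarith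
  linarith [nonneg_of_mul_nonneg_right h1 hp]

lemma qest (hJ : JS J) (x1 : E4) : ∃ C c0 B : ℝ, 0 ≤ C ∧ 0 < c0 ∧ 0 ≤ B ∧ ∀ a ∈ Metric.closedBall x1 1, ∀ y ∈ Metric.closedBall x1 1,
    c0 * ‖y - a‖ ^ 2 ≤ qq J a y ∧ qq J a y ≤ B * ‖y - a‖ ^ 2 ∧ ∀ ξ, Gq J y ξ = 1 →
      4 - C * ‖y - a‖ ≤ LL J (qq J a) y ξ ∧ GG J (qq J a) (qq J a) y ξ ≤ 4 * qq J a y + C * ‖y - a‖ ^ 3 := by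
  have hK := isCompact_closedBall x1 (1:ℝ)
  obtain ⟨D, hD⟩ := hK.exists_bound_of_continuousOn hJ.sm.continuous.continuousOn
  obtain ⟨A, hA⟩ := hK.exists_bound_of_continuousOn (cdf hJ.sm).continuous.continuousOn
  have hD0 : 0 ≤ D := (norm_nonneg _).trans (hD x1 (Metric.mem_closedBall_self zero_le_one))
  have hA0 : 0 ≤ A := (norm_nonneg _).trans (hA x1 (Metric.mem_closedBall_self zero_le_one))
  have hL : ∀ a ∈ Metric.closedBall x1 1, ∀ y ∈ Metric.closedBall x1 1, ‖J y - J a‖ ≤ A * ‖y - a‖ := fun a ha y hy =>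
    (convex_closedBall x1 1).norm_image_sub_le_of_norm_fderiv_le (fun z _ => cd1 hJ.sm z) hA ha hy
  obtain ⟨n0, hn0, hn⟩ := bdd2 hJ (Ψ := fun _ ξ => ‖ξ‖ ^ 2) (by fun_prop) (fun x ξ t => by
    rw [norm_smul, mul_pow, Real.norm_eq_abs, sq_abs]) hK
  have hn' : ∀ a ∈ Metric.closedBall x1 1, ∀ ξ, ‖ξ‖ ^ 2 ≤ (n0 + 1) * Gq J a ξ := fun a ha ξ => by
    have := hn a ha ξ
    rw [abs_of_nonneg (by positivity)] at this
    have h2 : 0 ≤ Gq J a ξ := by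
      by_cases hz : ξ = 0
      · rw [hz, Gq, map_zero, om_self]
      · exact (Gq_pos hJ a hz).le
    linarith
  set X := n0 + 1 with hX
  have hX0 : 0 < X := by positivity
  refine ⟨(8 * A + 8 * D ^ 2 * A + 16 * A * D ^ 2) * X + 4 * (16 * A * D * X + 32 * A * D * X + 32 * A ^ 2 * D ^ 2 * X), X⁻¹, 4 * D, by positivity,
    by positivity, by positivity, fun a ha y hy => ?_⟩
  set w := y - a with hw
  have hw2 : ‖w‖ ≤ 2 := by
    have h1 : dist y a ≤ dist y x1 + dist x1 a := dist_triangle _ _ _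
    rw [dist_eq_norm, dist_comm x1] at h1
    have := Metric.mem_closedBall.1 hy; have := Metric.mem_closedBall.1 ha
    linarith
  have w0 := norm_nonneg w
  have hq1 : X⁻¹ * ‖w‖ ^ 2 ≤ qq J a y := by
    rw [inv_mul_le_iff₀ hX0]; exact hn' a ha w
  have hJle : ∀ z ∈ Metric.closedBall x1 1, ∀ v, ‖J z v‖ ≤ D * ‖v‖ := fun z hz v => (J z).le_of_opNorm_le (hD z hz) v
  have hJa := hJle a ha w
  have hq2 : qq J a y ≤ 4 * D * ‖w‖ ^ 2 := by
    have := (le_abs_self _).trans (om_le w (J a w))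
    have h2 : 4 * ‖w‖ * ‖J a w‖ ≤ 4 * ‖w‖ * (D * ‖w‖) := mul_le_mul_of_nonneg_left hJa (by positivity)
    exact this.trans (h2.trans (le_of_eq (by ring)))
  refine ⟨hq1, hq2, fun ξ hξ => ?_⟩
  have x0 := norm_nonneg ξ
  have hξX : ‖ξ‖ ^ 2 ≤ X := by have := hn' y hy ξ; rwa [hξ, mul_one] at this
  have hJy := hJle y hy ξ
  have hdif : ∀ v, ‖(J a - J y) v‖ ≤ A * ‖w‖ * ‖v‖ := fun v => ContinuousLinearMap.le_of_opNorm_le _ (by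
    rw [norm_sub_rev]; exact hL a ha y hy) v
  have b1 : ∀ v, |omega0 v (J a v) - omega0 v (J y v)| ≤ 4 * (A * ‖w‖) * ‖v‖ ^ 2 := fun v => by
    rw [← om_subr, ← ContinuousLinearMap.sub_apply]
    refine (om_le _ _).trans ?_
    calc 4 * ‖v‖ * ‖(J a - J y) v‖ ≤ 4 * ‖v‖ * (A * ‖w‖ * ‖v‖) := mul_le_mul_of_nonneg_left (hdif v) (by positivity)
      _ = _ := by ring
  have b2 : 4 * (A * ‖w‖) * ‖ξ‖ ^ 2 ≤ 4 * (A * ‖w‖) * X := mul_le_mul_of_nonneg_left hξX (by positivity)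
  have g1 := abs_le.1 ((b1 ξ).trans b2)
  have hξ' : omega0 ξ (J y ξ) = 1 := hξ
  rw [hξ'] at g1
  constructor
  · rw [qq_LL hJ]
    have g2 := abs_le.1 (b1 (J y ξ))
    have e1 : omega0 (J y ξ) (J y (J y ξ)) = 1 := by rw [hJ.inv]; exact hξ
    rw [e1] at g2
    have b3 : 4 * (A * ‖w‖) * ‖J y ξ‖ ^ 2 ≤ 4 * (A * ‖w‖) * (D ^ 2 * X) := by
      refine mul_le_mul_of_nonneg_left ?_ (by positivity)
      calc ‖J y ξ‖ ^ 2 ≤ (D * ‖ξ‖) ^ 2 := pow_le_pow_left₀ (norm_nonneg _) hJy 2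
        _ = D ^ 2 * ‖ξ‖ ^ 2 := by ring
        _ ≤ _ := mul_le_mul_of_nonneg_left hξX (by positivity)
    have b4 : ‖fderiv ℝ J y ξ (J y ξ) - fderiv ℝ J y (J y ξ) ξ‖ ≤ 2 * (A * D * ‖ξ‖ ^ 2) := by
      have k1 := (fderiv ℝ J y ξ).le_of_opNorm_le ((fderiv ℝ J y).le_of_opNorm_le (hA y hy) ξ) (J y ξ)
      have k2 := (fderiv ℝ J y (J y ξ)).le_of_opNorm_le ((fderiv ℝ J y).le_of_opNorm_le (hA y hy) (J y ξ)) ξ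
      have k3 : A * ‖ξ‖ * ‖J y ξ‖ ≤ A * ‖ξ‖ * (D * ‖ξ‖) := mul_le_mul_of_nonneg_left hJy (by positivity)
      have := norm_sub_le (fderiv ℝ J y ξ (J y ξ)) (fderiv ℝ J y (J y ξ) ξ)
      linarith
    have b5 : |omega0 (fderiv ℝ J y ξ (J y ξ) - fderiv ℝ J y (J y ξ) ξ) (J a w)| ≤ 8 * A * D ^ 2 * X * ‖w‖ := by
      refine (om_le _ _).trans ?_
      calc _ ≤ 4 * (2 * (A * D * X)) * (D * ‖w‖) := by
            refine mul_le_mul (mul_le_mul_of_nonneg_left (b4.trans ?_) (by norm_num)) hJa (norm_nonneg _) (by positivity)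
            exact mul_le_mul_of_nonneg_left (mul_le_mul_of_nonneg_left hξX (by positivity)) (by norm_num)
        _ = _ := by ring
    have b6 := abs_le.1 b5
    have b7 : 0 ≤ 4 * (16 * A * D * X + 32 * A * D * X + 32 * A ^ 2 * D ^ 2 * X) * ‖w‖ := by positivity
    linarith [g1.1, g2.1, b6.2]
  · rw [qq_GG hJ]
    set e := omega0 (J y ξ - J a ξ) (J a w) with he
    have e1 : omega0 (J y ξ) (J a w) = omega0 ξ w + e := by rw [he, om_sub, hJ.inv]; ring
    have be : |e| ≤ 4 * A * D * ‖ξ‖ * ‖w‖ ^ 2 := by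
      refine (om_le _ _).trans ?_
      have k1 : ‖J y ξ - J a ξ‖ ≤ A * ‖w‖ * ‖ξ‖ := by rw [norm_sub_rev, ← ContinuousLinearMap.sub_apply]; exact hdif ξ
      calc _ ≤ 4 * (A * ‖w‖ * ‖ξ‖) * (D * ‖w‖) := by gcongr
        _ = _ := by ring
    have bo := om_le ξ w
    have k1 : |omega0 ξ w * e| ≤ (4 * ‖ξ‖ * ‖w‖) * (4 * A * D * ‖ξ‖ * ‖w‖ ^ 2) := by
      rw [abs_mul]; exact mul_le_mul bo be (abs_nonneg _) (by positivity)
    have k2 : (4 * ‖ξ‖ * ‖w‖) * (4 * A * D * ‖ξ‖ * ‖w‖ ^ 2) ≤ 16 * A * D * X * ‖w‖ ^ 3 := by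
      calc _ = 16 * A * D * ‖w‖ ^ 3 * ‖ξ‖ ^ 2 := by ring
        _ ≤ 16 * A * D * ‖w‖ ^ 3 * X := mul_le_mul_of_nonneg_left hξX (by positivity)
        _ = _ := by ring
    have k3 : e ^ 2 ≤ 32 * A ^ 2 * D ^ 2 * X * ‖w‖ ^ 3 := by
      rw [← sq_abs]
      calc |e| ^ 2 ≤ (4 * A * D * ‖ξ‖ * ‖w‖ ^ 2) ^ 2 := pow_le_pow_left₀ (abs_nonneg _) be 2
        _ = 16 * A ^ 2 * D ^ 2 * ‖w‖ ^ 3 * (‖w‖ * ‖ξ‖ ^ 2) := by ring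
        _ ≤ 16 * A ^ 2 * D ^ 2 * ‖w‖ ^ 3 * (2 * X) := by gcongr
        _ = _ := by ring
    have cs := herm_cs hJ a ξ w
    have k4 : Gq J a ξ * Gq J a w ≤ qq J a y + 16 * A * D * X * ‖w‖ ^ 3 := by
      have q0 : 0 ≤ qq J a y := le_trans (by positivity) hq1
      have e2 : Gq J a w = qq J a y := rfl
      have e3 : Gq J a ξ ≤ 1 + 4 * (A * ‖w‖) * X := by have : Gq J a ξ = omega0 ξ (J a ξ) := rfl; linarith [g1.2]
      rw [e2]
      have m1 := mul_le_mul_of_nonneg_right e3 q0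
      have m2 : 4 * (A * ‖w‖) * X * qq J a y ≤ 4 * (A * ‖w‖) * X * (4 * D * ‖w‖ ^ 2) := mul_le_mul_of_nonneg_left hq2 (by positivity)
      linarith
    rw [e1]
    have b7 : 0 ≤ (8 * A + 8 * D ^ 2 * A + 16 * A * D ^ 2) * X * ‖w‖ ^ 3 := by positivity
    have := le_of_abs_le k1
    linarith

lemma qq_nonneg (hJ : JS J) (a y : E4) : 0 ≤ qq J a y := by
  by_cases hz : y - a = 0
  · rw [qq, hz, map_zero, om_self]
  · exact (Gq_pos hJ a hz).le

lemma kern_alg {C m w q s T R L G B : ℝ} (hC : 0 ≤ C) (hm : 0 ≤ m) (hT : T = q + s) (hR : T = R ^ 2) (R0 : 0 < R)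
    (hw0 : 0 ≤ w) (hw : w ≤ m * R) (hs : 0 < s) (hL : 4 - C * w ≤ L) (hG : G ≤ 4 * q + C * w ^ 3) (hq : 0 ≤ q)
    (hB : B = 2 * (C * (m + m ^ 3))) (hR1 : C * (m + m ^ 3) * R ≤ 1) :
    4 * s ≤ (T * L - G) + B * R / 4 * (2 * (T * L - G) + G) := by
  have T0 : 0 < T := by rw [hR]; positivity
  have h1 : T * (4 - C * w) ≤ T * L := mul_le_mul_of_nonneg_left hL T0.le
  have h2 : C * w * T ≤ C * (m * R) * T := by gcongr
  have h3 : C * w ^ 3 ≤ C * (m * R) ^ 3 := by gcongr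
  set C1 := C * (m + m ^ 3) with hC1
  have C10 : 0 ≤ C1 := by positivity
  have h4 : C * (m * R) * T + C * (m * R) ^ 3 = C1 * R ^ 3 := by rw [hC1, hR]; ring
  have h5 : 4 * s - C1 * R ^ 3 ≤ T * L - G := by linarith [hT]
  have h6 : C1 * R ^ 3 ≤ T := by
    calc C1 * R ^ 3 = (C1 * R) * R ^ 2 := by ring
      _ ≤ 1 * R ^ 2 := by gcongr
      _ = T := by rw [hR]; ring
  have h7 : 0 ≤ C * (m * R) ^ 3 := by positivity
  have h8 : 2 * T ≤ 2 * (T * L - G) + G := by linarith [hT]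
  have h9 : B * R / 4 * (2 * T) ≤ B * R / 4 * (2 * (T * L - G) + G) := mul_le_mul_of_nonneg_left h8 (by rw [hB]; positivity)
  have h10 : B * R / 4 * (2 * T) = C1 * R ^ 3 := by rw [hB, hR]; ring
  linarith

lemma kern (hJ : JS J) (x1 : E4) : ∃ ρ0 s0 Ck Bk : ℝ, 0 < ρ0 ∧ 0 < s0 ∧ 0 < Ck ∧ 0 < Bk ∧
    ∀ a ∈ Metric.closedBall x1 ρ0, ∀ s, 0 < s → s < s0 → ∃ ℓ : E4 → ℝ, ContDiff ℝ ∞ ℓ ∧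
      ∀ y ∈ Metric.closedBall x1 ρ0, ℓ y ≤ 0 ∧ -ℓ y * √‖y - a‖ ≤ Ck ∧ ∀ ξ, Gq J y ξ = 1 → 0 ≤ LL J ℓ y ξ ∧
        (Bk * ‖y - a‖ ^ 2 ≤ s → 1 / s ≤ LL J ℓ y ξ) := by
  obtain ⟨C, c0, Bq, hC, hc0, hBq, hq⟩ := qest hJ x1
  set m := (√c0)⁻¹ with hm
  have hs0 : 0 < √c0 := Real.sqrt_pos.2 hc0
  have m0 : 0 < m := by positivity
  set C1 := C * (m + m ^ 3) with hC1
  have C10 : 0 ≤ C1 := by positivity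
  set R0 := (C1 + 1)⁻¹ with hR0
  have R00 : 0 < R0 := by positivity
  have R01 : R0 ≤ 1 := inv_le_one_of_one_le₀ (by linarith)
  have hCR : C1 * R0 ≤ 1 := by rw [hR0, ← div_eq_mul_inv, div_le_one (by positivity)]; linarith
  set ρ0 := R0 / (4 * (1 + Bq)) with hρ
  have ρ00 : 0 < ρ0 := by positivity
  have ρ1 : ρ0 ≤ 1 / 4 := by
    rw [hρ, div_le_iff₀ (by positivity)]; linarith
  have ρB : Bq * (2 * ρ0) ^ 2 ≤ R0 ^ 2 / 2 := by
    have e : 2 * ρ0 * (1 + Bq) = R0 / 2 := by rw [hρ]; field_simp; ring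
    have h1 : Bq * (2 * ρ0) ^ 2 ≤ (2 * ρ0 * (1 + Bq)) ^ 2 := by
      rw [mul_pow (2 * ρ0), mul_comm]
      exact mul_le_mul_of_nonneg_left (by nlinarith) (by positivity)
    rw [e] at h1; nlinarith [sq_nonneg R0]
  set B := 2 * C1 with hB
  refine ⟨ρ0, R0 ^ 2 / 2, |Real.log c0| + 4 + B, Bq + 1, ρ00, by positivity, by positivity, by positivity, fun a ha s hs hs0' => ?_⟩
  have qs : ∀ y, 0 < qq J a y + s := fun y => by have := qq_nonneg hJ a y; linarith
  set u : E4 → ℝ := fun y => Real.log (qq J a y + s) with hu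
  have us : ContDiff ℝ ∞ u := ((qq_sm J a).add contDiff_const).log (fun y => (qs y).ne')
  set k : ℝ → ℝ := fun t => t + B * Real.exp (t / 2) - B with hk
  have ks : ContDiff ℝ ∞ k := by fun_prop
  have k1 : deriv k = fun t => 1 + B / 2 * Real.exp (t / 2) := by
    funext t
    have := (((hasDerivAt_id t).add ((((hasDerivAt_id t).div_const 2).exp).const_mul B)).sub_const B).deriv
    refine Eq.trans this ?_; simp only [id]; ring
  have k2 : deriv (deriv k) = fun t => B / 4 * Real.exp (t / 2) := by
    funext t
    rw [k1]
    have := (((((hasDerivAt_id t).div_const 2).exp).const_mul (B / 2)).const_add 1).deriv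
    refine Eq.trans this ?_; simp only [id]; ring
  have es : ContDiff ℝ ∞ (fun t : ℝ => Real.exp t - s) := by fun_prop
  have e1 : deriv (fun t : ℝ => Real.exp t - s) = Real.exp := by funext t; simp
  have eq : qq J a = fun y => (fun t : ℝ => Real.exp t - s) (u y) := by
    funext y; simp only [hu, Real.exp_log (qs y)]; ring
  refine ⟨fun y => k (u y), ks.comp us, fun y hy => ?_⟩
  have hy1 := Metric.closedBall_subset_closedBall (by linarith : ρ0 ≤ 1) hy
  have ha1 := Metric.closedBall_subset_closedBall (by linarith : ρ0 ≤ 1) ha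
  obtain ⟨q1, q2, q3⟩ := hq a ha1 y hy1
  have w0 := norm_nonneg (y - a)
  have w2 : ‖y - a‖ ≤ 2 * ρ0 := by
    have h1 : dist y a ≤ dist y x1 + dist x1 a := dist_triangle _ _ _
    rw [dist_eq_norm, dist_comm x1] at h1
    have := Metric.mem_closedBall.1 hy; have := Metric.mem_closedBall.1 ha
    linarith
  set w := ‖y - a‖ with hw
  have T0 := qs y
  set T := qq J a y + s with hT
  have eT : Real.exp (u y) = T := Real.exp_log T0
  set R := Real.exp (u y / 2) with hR
  have Rp : 0 < R := Real.exp_pos _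
  have TR : T = R ^ 2 := by rw [← eT, hR, ← Real.exp_nat_mul]; congr 1; push_cast; ring
  have TR0 : T ≤ R0 ^ 2 := by
    have : Bq * w ^ 2 ≤ Bq * (2 * ρ0) ^ 2 := by gcongr
    linarith
  have RR0 : R ≤ R0 := by
    rw [TR] at TR0; exact (pow_le_pow_iff_left₀ Rp.le R00.le two_ne_zero).1 TR0
  have wR : w ≤ m * R := by
    have h1 : (√c0 * w) ^ 2 ≤ R ^ 2 := by rw [mul_pow, Real.sq_sqrt hc0.le, ← TR]; linarith
    have h2 := (pow_le_pow_iff_left₀ (by positivity) Rp.le two_ne_zero).1 h1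
    rw [hm, ← div_eq_inv_mul, le_div_iff₀ hs0]; linarith
  have u0 : u y ≤ 0 := Real.log_nonpos T0.le (TR0.trans (pow_le_one₀ R00.le R01))
  have B0 : 0 ≤ B := by positivity
  refine ⟨?_, ?_, fun ξ hξ => ?_⟩
  · have : B * R ≤ B * 1 := by gcongr; linarith
    simp only [hk]; linarith
  · have h1 : -k (u y) ≤ -u y + B := by
      have : 0 ≤ B * R := by positivity
      simp only [hk]; linarith
    rcases eq_or_lt_of_le w0 with h0 | h0
    · rw [← h0, Real.sqrt_zero, mul_zero]; positivity
    have r0 : 0 < √w := Real.sqrt_pos.2 h0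
    have r1 : √w ≤ 1 := Real.sqrt_le_one.2 (by linarith)
    have h2 : Real.log c0 + 4 * Real.log (√w) ≤ u y := by
      have : Real.log (c0 * (√w) ^ 4) ≤ u y := by
        refine Real.log_le_log (by positivity) ?_
        have : (√w) ^ 4 = w ^ 2 := by rw [show 4 = 2 * 2 by norm_num, pow_mul, Real.sq_sqrt w0]
        rw [this]; linarith
      rw [Real.log_mul hc0.ne' (by positivity), Real.log_pow] at this
      exact_mod_cast this
    have h3 := Real.one_sub_inv_le_log_of_pos r0
    have h4 : -k (u y) ≤ |Real.log c0| + B + 4 * (√w)⁻¹ := by linarith [neg_abs_le (Real.log c0)]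
    calc -k (u y) * √w ≤ (|Real.log c0| + B + 4 * (√w)⁻¹) * √w := by gcongr
      _ = (|Real.log c0| + B) * √w + 4 := by field_simp
      _ ≤ (|Real.log c0| + B) * 1 + 4 := by gcongr
      _ = _ := by ring
  · obtain ⟨q4, q5⟩ := q3 ξ hξ
    have l1 := LL_comp hJ us ks y ξ
    have l2 := LL_comp hJ us es y ξ
    have l3 : GG J (qq J a) (qq J a) y ξ = T * (T * GG J u u y ξ) := by
      have l4 := GG_comp us es y ξ (J := J) (g := qq J a)
      have l5 := GG_comp us es y ξ (J := J) (g := u)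
      rw [e1, eT] at l4 l5
      have e' : (fun y => Real.exp (u y) - s) = qq J a := eq.symm
      rw [e'] at l4 l5
      rw [l4, GG_comm, l5]
    have e' : (fun y => Real.exp (u y) - s) = qq J a := eq.symm
    rw [e', e1, Real.deriv_exp, eT] at l2
    rw [k2, k1] at l1
    have al := kern_alg hC m0.le hT TR Rp w0 wR hs q4 q5 (qq_nonneg hJ a y) hB ((mul_le_mul_of_nonneg_left RR0 C10).trans hCR)
    have e : T ^ 2 * LL J (fun y => k (u y)) y ξ = (T * LL J (qq J a) y ξ - GG J (qq J a) (qq J a) y ξ) + B * R / 4 *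
       (2 * (T * LL J (qq J a) y ξ - GG J (qq J a) (qq J a) y ξ) + GG J (qq J a) (qq J a) y ξ) := by
      rw [l1, l2, l3]; ring
    rw [← e] at al
    have T2 : 0 < T ^ 2 := by positivity
    refine ⟨?_, fun hB' => ?_⟩
    · by_contra hn
      have := mul_neg_of_pos_of_neg T2 (not_le.1 hn)
      linarith
    · have h1 : T ≤ 2 * s := by have := sq_nonneg w; linarith
      have h2 : T ^ 2 ≤ (2 * s) ^ 2 := by gcongr
      have h3 : 0 ≤ LL J (fun y => k (u y)) y ξ := by
        by_contra hn
        have := mul_neg_of_pos_of_neg T2 (not_le.1 hn)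
        linarith
      have h4 := mul_le_mul_of_nonneg_right h2 h3
      rw [div_le_iff₀ hs]
      exact le_of_mul_le_mul_left (by linarith : 4 * s * 1 ≤ 4 * s * (LL J (fun y => k (u y)) y ξ * s)) (by positivity)

section
variable {b : Box J} {ν : Measure (E4 × E4)} {x1 : E4} {ρ C κ : ℝ} {p : ℕ → E4 → ℝ} {t : ℕ → ℝ}

lemma Mo.GG_lim (hJ : JS J) (h : Mo b ν x1 ρ) (P : Pn b C κ p t) {g : E4 → ℝ} (hg : ContDiff ℝ ∞ g) (hgc : HasCompactSupport g)
    (hgs : tsupport g ⊆ Metric.ball x1 ρ) : (∀ n, Integrable (fun q => GG J g (p n) q.1 q.2) ν) ∧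
      Tendsto (fun n => ∫ q, 2 * |GG J g (p n) q.1 q.2| ∂ν) atTop (𝓝 0) := by
  obtain ⟨χ, hχ, hχ01, hχc, hχs, hχ1⟩ := cut hgc Metric.isOpen_ball hgs
  rw [eventually_nhdsSet_iff_forall] at hχ1
  obtain ⟨iG, lG⟩ := h.G_lim hJ P hχ hχc hχs fun x => (hχ01 x).1
  have i1 : ∀ n, Integrable (fun q => GG J g (p n) q.1 q.2) ν := fun n =>
    h.int hJ (GG_sm hJ hg (P.sm n)).continuous (GG_sc hJ g (p n)) hgs fun x hx ξ => GG_off _ hx ξ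
  have i2 : Integrable (fun q => GG J g g q.1 q.2) ν :=
    h.int hJ (GG_sm hJ hg hg).continuous (GG_sc hJ g g) hgs fun x hx ξ => GG_off _ hx ξ
  refine ⟨i1, ?_⟩
  set I : ℕ → ℝ := fun n => ∫ q, χ q.1 * GG J (p n) (p n) q.1 q.2 ∂ν with hI
  have I0 : ∀ n, 0 ≤ I n := fun n => integral_nonneg fun q => mul_nonneg (hχ01 _).1 (GG_nonneg _ _ _)
  have lS : Tendsto (fun n => √(I n)) atTop (𝓝 0) := by simpa using lG.sqrt
  have ld : Tendsto (fun n : ℕ => √(I n) + 1 / ((n:ℝ) + 1)) atTop (𝓝 0) := by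
    simpa using lS.add (tendsto_one_div_add_atTop_nhds_zero_nat (𝕜 := ℝ))
  refine squeeze_zero (g := fun n : ℕ => (√(I n) + 1 / ((n:ℝ) + 1)) * (∫ q, GG J g g q.1 q.2 ∂ν) + √(I n))
    (fun n => integral_nonneg fun q => by positivity) (fun n => ?_) (by simpa using (ld.mul_const _).add lS)
  have hn : (0:ℝ) < 1 / ((n:ℝ) + 1) := by positivity
  have s0 := Real.sqrt_nonneg (I n)
  set δ := √(I n) + 1 / ((n:ℝ) + 1) with hδ
  have δ0 : 0 < δ := by linarith
  have e1 : δ⁻¹ * I n ≤ √(I n) := by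
    rw [inv_mul_le_iff₀ δ0]
    nth_rw 1 [← Real.mul_self_sqrt (I0 n)]
    exact mul_le_mul_of_nonneg_right (by linarith) s0
  refine le_trans ?_ (add_le_add_right e1 _)
  rw [hI, ← integral_const_mul, ← integral_const_mul, ← integral_add (i2.const_mul _) ((iG n).const_mul _)]
  refine integral_mono ((i1 n).abs.const_mul _) ((i2.const_mul _).add ((iG n).const_mul _)) fun q => ?_
  simp only [Pi.add_apply]
  by_cases hq : q.1 ∈ tsupport g
  · rw [(hχ1 _ hq).self_of_nhds, one_mul]
    exact GG_young _ _ _ _ δ0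
  · rw [GG_off _ hq, GG_off _ hq, abs_zero]
    have := GG_nonneg (J := J) (p n) q.1 q.2
    have := (hχ01 q.1).1
    rw [mul_zero, mul_zero, zero_add]; positivity

lemma ofReal_int_le {α : Type*} [MeasurableSpace α] {μ : Measure α} {f : α → ℝ} (hf : Integrable f μ) :
    ENNReal.ofReal (∫ x, f x ∂μ) ≤ ∫⁻ x, ENNReal.ofReal (f x) ∂μ := by
  have h1 : ∫ x, f x ∂μ ≤ ∫ x, max (f x) 0 ∂μ := integral_mono hf hf.pos_part fun x => le_max_left _ _
  refine (ENNReal.ofReal_le_ofReal h1).trans ?_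
  rw [ofReal_integral_eq_lintegral_ofReal hf.pos_part (Eventually.of_forall fun x => le_max_right _ _)]
  refine lintegral_mono fun x => ?_
  rcases le_total (f x) 0 with h | h
  · simp [max_eq_right h]
  · rw [max_eq_left h]

lemma E3 (hJ : JS J) (h : Mo b ν x1 ρ) (P : Pn b C κ p t) {g : E4 → ℝ} (hg : ContDiff ℝ ∞ g) (hgc : HasCompactSupport g)
    (hgs : tsupport g ⊆ Metric.ball x1 ρ) (hg0 : ∀ x, 0 ≤ g x ∧ g x ≤ 1) (hg1 : ∀ᶠ x in 𝓝ˢ (Metric.closedBall x1 (ρ / 2)), g x = 1) (hρ : 0 < ρ)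
    {s0 Ck Bk : ℝ} (hs0 : 0 < s0) (hCk : 0 < Ck) (hBk : 0 < Bk)
    (hk : ∀ a ∈ Metric.closedBall x1 ρ, ∀ s, 0 < s → s < s0 → ∃ ℓ : E4 → ℝ, ContDiff ℝ ∞ ℓ ∧
      ∀ y ∈ Metric.closedBall x1 ρ, ℓ y ≤ 0 ∧ -ℓ y * √‖y - a‖ ≤ Ck ∧ ∀ ξ, Gq J y ξ = 1 → 0 ≤ LL J ℓ y ξ ∧
        (Bk * ‖y - a‖ ^ 2 ≤ s → 1 / s ≤ LL J ℓ y ξ)) {A : Set E4} {c2 : ℝ} (hc2 : 0 < c2)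
    (hA : ∀ x ∈ A, ∀ᶠ r in 𝓝[>] (0:ℝ), c2 * r ^ 2 ≤ ν.real (Prod.fst ⁻¹' Metric.closedBall x r)) :
    ∃ c > 0, ∃ Λ ≥ 0, ∃ ε : ℕ → ENNReal, Tendsto ε atTop (𝓝 0) ∧ ∀ x ∈ closure A, b.W x = 0 → x ∈ Metric.ball x1 (ρ / 4) → ∀ n,
      ENNReal.ofReal c ≤ ENNReal.ofReal Λ * ∫⁻ q, ENNReal.ofReal (g q.1 * Dn J C p n q.1 q.2) * (ENNReal.ofReal √‖q.1 - x‖)⁻¹ ∂ν + ε n := by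
  rw [eventually_nhdsSet_iff_forall] at hg1
  obtain ⟨iG, lG⟩ := h.GG_lim hJ P hg hgc hgs
  have iL : Integrable (fun q => |LL J g q.1 q.2|) ν := (h.int hJ (LL_sm hJ hg).continuous (LL_sc hJ g) hgs fun x hx ξ => LL_off hx ξ).abs
  have iLp : ∀ n, Integrable (fun q => (κ - p n q.1) * |LL J g q.1 q.2|) ν := fun n => h.int hJ (Ψ := fun x ξ => (κ - p n x) * |LL J g x ξ|)
    ((continuous_const.sub ((P.sm n).continuous.comp continuous_fst)).mul (LL_sm hJ hg).continuous.abs)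
    (fun x ξ t => by rw [LL_sc hJ, abs_mul, abs_of_nonneg (sq_nonneg t)]; ring) hgs fun x hx ξ => by rw [LL_off hx, abs_zero, mul_zero]
  set F : ℕ → E4 × E4 → ℝ := fun n q => (κ - p n q.1) * |LL J g q.1 q.2| + 2 * |GG J g (p n) q.1 q.2| with hF
  have iF : ∀ n, Integrable (F n) ν := fun n => (iLp n).add ((iG n).abs.const_mul 2)
  have F0 : ∀ n q, 0 ≤ F n q := fun n q => add_nonneg (mul_nonneg (sub_nonneg.2 (P.up n _)) (abs_nonneg _)) (by positivity)
  have lF : Tendsto (fun n => ∫ q, F n q ∂ν) atTop (𝓝 0) := by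
    have e : ∀ n, ∫ q, F n q ∂ν = (κ * ∫ q, |LL J g q.1 q.2| ∂ν - ∫ q, p n q.1 * |LL J g q.1 q.2| ∂ν) + ∫ q, 2 * |GG J g (p n) q.1 q.2| ∂ν := fun n => by
      have ip : Integrable (fun q => p n q.1 * |LL J g q.1 q.2|) ν := by
        refine ((iL.const_mul κ).sub (iLp n)).congr (Eventually.of_forall fun q => ?_)
        simp only [Pi.sub_apply]; ring
      rw [hF, integral_add (iLp n) ((iG n).abs.const_mul 2), ← integral_const_mul, ← integral_sub (iL.const_mul κ) ip]
      simp only [sub_mul]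
    simp only [e]
    simpa using ((tendsto_const_nhds (x := κ * ∫ q, |LL J g q.1 q.2| ∂ν)).sub (h.lim P iL)).add lG
  set Λ0 := Ck / √(ρ / 6) with hΛ0
  refine ⟨κ * c2 / Bk, by have := P.κ0; positivity, 2 * Ck, by positivity, fun n => ENNReal.ofReal (Λ0 * ∫ q, F n q ∂ν), ?_, fun x hxA hxW hx n => ?_⟩
  · have := ENNReal.tendsto_ofReal (lF.const_mul Λ0)
    simpa using this
  have hUo : IsOpen {y | nn b.W y < t n} := isOpen_lt (nn_sm b.Ws).continuous continuous_const
  obtain ⟨d, d0, hd⟩ := Metric.isOpen_iff.1 hUo x (by simp only [mem_setOf_eq]; rw [nn_eq_zero.2 hxW]; exact P.t0 n)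
  obtain ⟨x', hx'A, hxx'⟩ := Metric.mem_closure_iff.1 hxA (min (d / 2) (ρ / 12)) (by positivity)
  have hxx1 := hxx'.trans_le (min_le_left _ _)
  have hxx2 := hxx'.trans_le (min_le_right _ _)
  have hx1 := Metric.mem_ball.1 hx
  have hx'1 : dist x' x1 < ρ / 3 := by
    have := dist_triangle_left x' x1 x; linarith
  obtain ⟨r, ⟨⟨hr, hr1⟩, hr2⟩, r0⟩ := (((hA x' hx'A).and ((Ioo_mem_nhdsGT (lt_min (half_pos d0) (by positivity : 0 < ρ / 6)) :
      ∀ᶠ r in 𝓝[>] (0:ℝ), r ∈ Ioo 0 _))).and (((((continuous_const.mul (continuous_pow 2)).tendsto' (0:ℝ) 0 (by simp)).mono_left nhdsWithin_le_nhds).eventually (gt_mem_nhds hs0) :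
      ∀ᶠ r : ℝ in 𝓝[>] (0:ℝ), Bk * r ^ 2 < s0))).and self_mem_nhdsWithin |>.exists
  have r0 : 0 < r := r0
  have hr3 := hr1.2.trans_le (min_le_left _ _)
  have hr4 := hr1.2.trans_le (min_le_right _ _)
  obtain ⟨ℓ, hℓ, hℓ2⟩ := hk x' (Metric.mem_closedBall.2 (by linarith)) (Bk * r ^ 2) (by positivity) hr2
  set H : E4 → ℝ := fun y => g y * (κ - p n y) with hH
  have Hs : ContDiff ℝ ∞ H := hg.mul (contDiff_const.sub (P.sm n))
  have Hc : HasCompactSupport H := hgc.mul_right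
  have Ht : tsupport H ⊆ Metric.ball x1 ρ := (tsupport_mul_subset_left).trans hgs
  have Hg : ∀ {y}, y ∉ Metric.closedBall x1 ρ → g y = 0 := fun {y} hy => image_eq_zero_of_notMem_tsupport fun hn => hy (Metric.ball_subset_closedBall (hgs hn))
  obtain ⟨j1, j2, -, -, j3⟩ := (h.closed hJ).ibp hJ h.ae Hs hℓ Hc Ht
  have H0 : ∀ y, 0 ≤ H y := fun y => mul_nonneg (hg0 y).1 (sub_nonneg.2 (P.up n y))
  have low : κ * c2 / Bk ≤ ∫ q, H q.1 * LL J ℓ q.1 q.2 ∂ν := by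
    have n0 : 0 ≤ᵐ[ν] fun q => H q.1 * LL J ℓ q.1 q.2 := by
      filter_upwards [h.ae] with q hq
      by_cases hy : q.1 ∈ Metric.closedBall x1 ρ
      · exact mul_nonneg (H0 _) ((hℓ2 _ hy).2.2 _ hq).1
      · simp only [hH]; rw [Hg hy]; simp
    have hsub : Metric.closedBall x' r ⊆ Metric.closedBall x1 (ρ / 2) := Metric.closedBall_subset_closedBall' (by linarith)
    have hm : MeasurableSet (Prod.fst ⁻¹' Metric.closedBall x' r : Set (E4 × E4)) := fst_pre Metric.isClosed_closedBall.measurableSet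
    have hfin : ν (Prod.fst ⁻¹' Metric.closedBall x' r) ≠ ⊤ := ne_top_of_le_ne_top h.fin.ne
      (measure_mono (preimage_mono (hsub.trans (Metric.closedBall_subset_closedBall (by linarith)))))
    refine le_trans ?_ (setIntegral_le_integral (s := Prod.fst ⁻¹' Metric.closedBall x' r) j1 n0)
    have h2 : ∫ q in Prod.fst ⁻¹' Metric.closedBall x' r, κ * (1 / (Bk * r ^ 2)) ∂ν ≤ ∫ q in Prod.fst ⁻¹' Metric.closedBall x' r, H q.1 * LL J ℓ q.1 q.2 ∂ν := by
      refine setIntegral_mono_ae_restrict (integrableOn_const hfin) j1.integrableOn ?_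
      filter_upwards [ae_restrict_of_ae h.ae, ae_restrict_mem hm] with q hq hqm
      have hqm : q.1 ∈ Metric.closedBall x' r := hqm
      have hd1 := Metric.mem_closedBall.1 hqm
      have hp0 : p n q.1 = 0 := P.near n _ (hd (Metric.mem_ball.2 (by
        have := dist_triangle_right q.1 x x'; linarith)))
      have e1 : H q.1 = κ := by simp only [hH]; rw [hp0, (hg1 _ (hsub hqm)).self_of_nhds]; ring
      rw [e1]
      refine mul_le_mul_of_nonneg_left (((hℓ2 _ (Metric.closedBall_subset_closedBall (by linarith) (hsub hqm))).2.2 _ hq).2 ?_) P.κ0.le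
      rw [← dist_eq_norm]; gcongr
    refine le_trans ?_ h2
    rw [setIntegral_const, smul_eq_mul]
    have := mul_le_mul_of_nonneg_right hr (by have := P.κ0; positivity : 0 ≤ κ * (1 / (Bk * r ^ 2)))
    refine le_trans (le_of_eq ?_) this
    field_simp
  rw [j3] at low
  refine (ENNReal.ofReal_le_ofReal low).trans ((ofReal_int_le j2).trans ?_)
  have iF' : ∫⁻ q, ENNReal.ofReal (Λ0 * F n q) ∂ν = ENNReal.ofReal (Λ0 * ∫ q, F n q ∂ν) := by
    rw [← integral_const_mul, ofReal_integral_eq_lintegral_ofReal ((iF n).const_mul _) (Eventually.of_forall fun q => mul_nonneg (by positivity) (F0 n q))]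
  have hmD : Measurable fun q : E4 × E4 => ENNReal.ofReal (g q.1 * Dn J C p n q.1 q.2) * (ENNReal.ofReal √‖q.1 - x‖)⁻¹ := by
    have c1 : Continuous fun q : E4 × E4 => g q.1 * Dn J C p n q.1 q.2 := by
      unfold Dn
      exact (hg.continuous.comp continuous_fst).mul ((LL_sm hJ (P.sm n)).continuous.add (continuous_const.mul (Gq_sm hJ).continuous))
    have c2 : Continuous fun q : E4 × E4 => √‖q.1 - x‖ := by fun_prop
    exact c1.measurable.ennreal_ofReal.mul c2.measurable.ennreal_ofReal.inv
  simp only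
  rw [← iF', ← lintegral_const_mul _ hmD, ← lintegral_add_left (hmD.const_mul _)]
  refine lintegral_mono_ae ?_
  filter_upwards [h.ae] with q hq
  by_cases hy : q.1 ∈ Metric.closedBall x1 ρ
  swap
  · rw [LL_off fun hn => hy (Metric.ball_subset_closedBall (Ht hn))]; simp
  obtain ⟨l1, l2, -⟩ := hℓ2 _ hy
  have eL : LL J H q.1 q.2 = (κ - p n q.1) * LL J g q.1 q.2 - g q.1 * LL J (p n) q.1 q.2 - 2 * GG J g (p n) q.1 q.2 := by
    have e1 : H = fun y => κ * g y + (-1) * (g y * p n y) := by funext y; simp only [hH]; ring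
    rw [e1, LL_add hJ (contDiff_const.mul hg) (contDiff_const.mul (hg.mul (P.sm n))), LL_cmul hJ hg, LL_cmul hJ (hg.mul (P.sm n)), LL_mul hJ hg (P.sm n)]
    ring
  have k1 : ℓ q.1 * LL J H q.1 q.2 ≤ -ℓ q.1 * (g q.1 * LL J (p n) q.1 q.2) + -ℓ q.1 * F n q := by
    rw [eL]
    have m1 := mul_nonneg (neg_nonneg.2 l1) (sub_nonneg.2 ((abs_le.1 (le_refl |LL J g q.1 q.2|)).1))
    have a1 := neg_abs_le (LL J g q.1 q.2)
    have a2 := neg_abs_le (GG J g (p n) q.1 q.2)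
    have a3 := le_abs_self (GG J g (p n) q.1 q.2)
    have b1 : (κ - p n q.1) * -|LL J g q.1 q.2| ≤ (κ - p n q.1) * LL J g q.1 q.2 := mul_le_mul_of_nonneg_left a1 (sub_nonneg.2 (P.up n _))
    have b2 : 0 ≤ (κ - p n q.1) * LL J g q.1 q.2 - 2 * GG J g (p n) q.1 q.2 + F n q := by simp only [hF]; linarith
    have := mul_nonneg (neg_nonneg.2 l1) b2
    linarith
  have k2 : -ℓ q.1 * F n q ≤ Λ0 * F n q := by
    by_cases hc : q.1 ∈ Metric.closedBall x1 (ρ / 2)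
    · have z1 : LL J g q.1 q.2 = 0 := by
        rw [LL_congr (g := fun _ => 1) (hg1 _ hc)]; exact LL_const 1 _ _
      have z2 : GG J g (p n) q.1 q.2 = 0 := by
        have : fderiv ℝ g q.1 = 0 := by
          rw [Filter.EventuallyEq.fderiv_eq (f₁ := g) (f := fun _ => (1:ℝ)) (hg1 _ hc)]; simp
        simp [GG, this]
      simp only [hF, z1, z2]; simp
    · refine mul_le_mul_of_nonneg_right ?_ (F0 n q)
      have hfar : ρ / 6 ≤ ‖q.1 - x'‖ := by
        rw [← dist_eq_norm]
        have := dist_triangle q.1 x' x1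
        have := not_le.1 fun h' => hc (Metric.mem_closedBall.2 h')
        linarith
      rw [hΛ0, le_div_iff₀ (by positivity)]
      exact (mul_le_mul_of_nonneg_left (Real.sqrt_le_sqrt hfar) (neg_nonneg.2 l1)).trans l2
  have D0 : 0 ≤ Dn J C p n q.1 q.2 := by
    have h1 := P.LLp n q.1 (h.V hy) q.2
    have h2 := GG_nonneg (J := J) (p n) q.1 q.2
    have h3 : 0 ≤ ((n : ℝ) + 1) / 2 * GG J (p n) (p n) q.1 q.2 := by positivity
    unfold Dn; linarith
  by_cases hyt : nn b.W q.1 < t n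
  · have z : LL J (p n) q.1 q.2 = 0 := by
      rw [LL_congr (g := fun _ => 0) (by filter_upwards [hUo.mem_nhds hyt] with y hy' using P.near n y hy')]; exact LL_const 0 _ _
    rw [z, mul_zero, mul_zero, zero_add] at k1
    exact (ENNReal.ofReal_le_ofReal (k1.trans k2)).trans le_add_self
  · have hfx : d ≤ dist q.1 x := by
      by_contra hn; exact hyt (hd (Metric.mem_ball.2 (not_le.1 hn)))
    have hfar : dist q.1 x / 2 ≤ ‖q.1 - x'‖ := by
      rw [← dist_eq_norm]
      have := dist_triangle_right q.1 x x'
      have := dist_triangle q.1 x' x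
      rw [dist_comm x' x] at this
      linarith
    have s1 : √(dist q.1 x) ≤ 2 * √‖q.1 - x'‖ := by
      have : √(dist q.1 x) ≤ √(2 ^ 2 * ‖q.1 - x'‖) := Real.sqrt_le_sqrt (by linarith [norm_nonneg (q.1 - x')])
      rwa [Real.sqrt_mul (by norm_num), Real.sqrt_sq (by norm_num)] at this
    have sp : 0 < √(dist q.1 x) := Real.sqrt_pos.2 (by linarith)
    have k3 : -ℓ q.1 ≤ 2 * Ck * (√‖q.1 - x‖)⁻¹ := by
      rw [← dist_eq_norm, ← div_eq_mul_inv, le_div_iff₀ sp]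
      have := mul_le_mul_of_nonneg_left s1 (neg_nonneg.2 l1)
      linarith
    have k4 : -ℓ q.1 * (g q.1 * LL J (p n) q.1 q.2) ≤ 2 * Ck * ((g q.1 * Dn J C p n q.1 q.2) * (√‖q.1 - x‖)⁻¹) := by
      have hLD : LL J (p n) q.1 q.2 ≤ Dn J C p n q.1 q.2 := by
        have : 0 ≤ C / ((n:ℝ) + 1) * Gq J q.1 q.2 := by rw [hq]; have := P.C0; positivity
        unfold Dn; linarith
      calc _ ≤ -ℓ q.1 * (g q.1 * Dn J C p n q.1 q.2) := mul_le_mul_of_nonneg_left (mul_le_mul_of_nonneg_left hLD (hg0 _).1) (neg_nonneg.2 l1)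
        _ ≤ 2 * Ck * (√‖q.1 - x‖)⁻¹ * (g q.1 * Dn J C p n q.1 q.2) := mul_le_mul_of_nonneg_right k3 (mul_nonneg (hg0 _).1 D0)
        _ = _ := by ring
    refine (ENNReal.ofReal_le_ofReal (k1.trans (add_le_add k4 k2))).trans (ENNReal.ofReal_add_le.trans (add_le_add_left (le_of_eq ?_) _))
    rw [dist_eq_norm] at sp
    rw [ENNReal.ofReal_mul (by positivity), ENNReal.ofReal_mul (mul_nonneg (hg0 _).1 D0), ENNReal.ofReal_inv_of_pos sp]
end

lemma ksing (M : ℝ) : ∃ B : ENNReal, B ≠ ⊤ ∧ ∀ a : ℝ, ∫⁻ τ in Icc (-M) M, (ENNReal.ofReal √|a - τ|)⁻¹ ≤ B := by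
  set k : ℝ → ENNReal := fun u => (ENNReal.ofReal √|u|)⁻¹ with hk
  have hkm : Measurable k := by
    have : Continuous fun u : ℝ => √|u| := by fun_prop
    exact this.measurable.ennreal_ofReal.inv
  have i1 : IntegrableOn (fun u : ℝ => u ^ (-(1/2) : ℝ)) (Ioc (-1) 1) :=
    (intervalIntegrable_iff_integrableOn_Ioc_of_le (by norm_num)).1 (intervalIntegral.intervalIntegrable_rpow' (by norm_num))
  have i2 : IntegrableOn (fun u : ℝ => (-u) ^ (-(1/2) : ℝ)) (Ioc (-1) 1) := by
    have := (intervalIntegral.intervalIntegrable_rpow' (a := 1) (b := -1) (r := -(1/2)) (by norm_num)).comp_sub_left 0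
    simp only [zero_sub, neg_neg] at this
    exact (intervalIntegrable_iff_integrableOn_Ioc_of_le (by norm_num)).1 this
  have hI : ∫⁻ u in Ioc (-1:ℝ) 1, k u < ⊤ := by
    have e1 := i1.norm.lintegral_lt_top
    have e2 := i2.norm.lintegral_lt_top
    refine lt_of_le_of_lt ?_ (ENNReal.add_lt_top.2 ⟨e1, e2⟩)
    rw [← lintegral_add_left (by fun_prop)]
    refine lintegral_mono_ae (ae_restrict_of_ae ?_)
    filter_upwards [compl_mem_ae_iff.2 (measure_singleton (0:ℝ))] with u hu
    have hu : u ≠ 0 := hu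
    have key : ∀ w : ℝ, 0 < w → (ENNReal.ofReal √w)⁻¹ ≤ ENNReal.ofReal ‖w ^ (-(1/2) : ℝ)‖ := fun w hw => by
      rw [← ENNReal.ofReal_inv_of_pos (Real.sqrt_pos.2 hw), Real.rpow_neg hw.le, Real.sqrt_eq_rpow]
      exact ENNReal.ofReal_le_ofReal (le_abs_self _)
    rcases lt_or_gt_of_ne hu with h | h
    · simp only [hk]; rw [abs_of_neg h]
      exact (key (-u) (by linarith)).trans le_add_self
    · simp only [hk]; rw [abs_of_pos h]
      exact (key u h).trans le_self_add
  refine ⟨(∫⁻ u in Ioc (-1:ℝ) 1, k u) + volume (Icc (-M) M), ENNReal.add_ne_top.2 ⟨hI.ne, by simp⟩, fun a => ?_⟩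
  have hle : ∀ u, k u ≤ (Ioc (-1:ℝ) 1).indicator k u + 1 := fun u => by
    by_cases hu : u ∈ Ioc (-1:ℝ) 1
    · rw [indicator_of_mem hu]; exact le_self_add
    · rw [indicator_of_notMem hu, zero_add]
      simp only [hk]
      rw [ENNReal.inv_le_one, ENNReal.one_le_ofReal, Real.one_le_sqrt]
      by_contra hc
      rw [not_le, abs_lt] at hc
      exact hu ⟨hc.1, hc.2.le⟩
  have hm : Measurable fun τ => (Ioc (-1:ℝ) 1).indicator k (a - τ) := (hkm.indicator measurableSet_Ioc).comp (measurable_const.sub measurable_id)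
  calc _ ≤ ∫⁻ τ in Icc (-M) M, ((Ioc (-1:ℝ) 1).indicator k (a - τ) + 1) := lintegral_mono fun τ => hle _
    _ = (∫⁻ τ in Icc (-M) M, (Ioc (-1:ℝ) 1).indicator k (a - τ)) + volume (Icc (-M) M) := by
      rw [lintegral_add_left hm]; simp
    _ ≤ _ := by
      refine add_le_add_left ((setLIntegral_le_lintegral _ _).trans (le_of_eq ?_)) _
      rw [lintegral_sub_left_eq_self (fun u => (Ioc (-1:ℝ) 1).indicator k u) a, lintegral_indicator measurableSet_Ioc]

lemma nullT {X : Type*} [MeasurableSpace X] {ν : Measure X} [IsFiniteMeasure ν] {φ : ℕ → X → ENNReal} (hφ : ∀ n, Measurable (φ n))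
    (hl : Tendsto (fun n => ∫⁻ q, φ n q ∂ν) atTop (𝓝 0)) {ζ : X → ℝ} (hζ : Measurable ζ) {T : Set ℝ} {M : ℝ} (hT : T ⊆ Icc (-M) M)
    {c Λ : ENNReal} (hc : c ≠ 0) (hc' : c ≠ ⊤) (hΛ : Λ ≠ ⊤) {ε : ℕ → ENNReal} (hε : Tendsto ε atTop (𝓝 0))
    (h : ∀ τ ∈ T, ∀ n, c ≤ Λ * ∫⁻ q, φ n q * (ENNReal.ofReal √|ζ q - τ|)⁻¹ ∂ν + ε n) : volume T = 0 := by
  obtain ⟨B, hB, hk⟩ := ksing M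
  have hkm : Measurable fun u : ℝ => (ENNReal.ofReal √|u|)⁻¹ := by
    have : Continuous fun u : ℝ => √|u| := by fun_prop
    exact this.measurable.ennreal_ofReal.inv
  have hm : ∀ n, Measurable (fun r : ℝ × X => φ n r.2 * (ENNReal.ofReal √|ζ r.2 - r.1|)⁻¹) := fun n =>
    ((hφ n).comp measurable_snd).mul (hkm.comp ((hζ.comp measurable_snd).sub measurable_fst))
  have hm1 : ∀ n, Measurable fun τ : ℝ => ∫⁻ q, φ n q * (ENNReal.ofReal √|ζ q - τ|)⁻¹ ∂ν := fun n => (hm n).lintegral_prod_right'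
  have main : ∀ n, c * volume T ≤ Λ * (B * ∫⁻ q, φ n q ∂ν) + ε n * volume (Icc (-M) M) := fun n => by
    have h1 : volume T ≤ volume.restrict (Icc (-M) M) {τ | c ≤ Λ * ∫⁻ q, φ n q * (ENNReal.ofReal √|ζ q - τ|)⁻¹ ∂ν + ε n} := by
      rw [Measure.restrict_apply' measurableSet_Icc]
      exact measure_mono fun τ hτ => ⟨h τ hτ n, hT hτ⟩
    refine (mul_le_mul_right h1 c).trans ((mul_meas_ge_le_lintegral (((hm1 n).const_mul _).add_const _) c).trans ?_)
    rw [lintegral_add_right _ measurable_const, lintegral_const_mul _ (hm1 n), lintegral_const, Measure.restrict_apply_univ]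
    gcongr
    rw [lintegral_lintegral_swap (hm n).aemeasurable, ← lintegral_const_mul _ (hφ n)]
    refine lintegral_mono fun q => ?_
    have hq : Measurable fun τ : ℝ => (ENNReal.ofReal √|ζ q - τ|)⁻¹ := hkm.comp (measurable_const.sub measurable_id)
    rw [lintegral_const_mul _ hq, mul_comm]
    exact mul_le_mul_left (hk _) _
  have lim : Tendsto (fun n => Λ * (B * ∫⁻ q, φ n q ∂ν) + ε n * volume (Icc (-M) M)) atTop (𝓝 0) := by
    have e1 := ENNReal.Tendsto.const_mul (ENNReal.Tendsto.const_mul hl (Or.inr hB)) (Or.inr hΛ)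
    have e2 := ENNReal.Tendsto.mul_const hε (b := volume (Icc (-M) M)) (Or.inr (by simp))
    simpa using e1.add e2
  have := ge_of_tendsto' lim main
  have := (mul_eq_zero.1 (le_antisymm this bot_le)).resolve_left hc
  exact this

lemma E4a (hJ : JS J) {b : Box J} {ν : Measure (E4 × E4)} {x1 : E4} {ρ : ℝ} (h : Mo b ν x1 ρ) (hρ : 0 < ρ)
    {s0 Ck Bk : ℝ} (hs0 : 0 < s0) (hCk : 0 < Ck) (hBk : 0 < Bk)
    (hk : ∀ a ∈ Metric.closedBall x1 ρ, ∀ s, 0 < s → s < s0 → ∃ ℓ : E4 → ℝ, ContDiff ℝ ∞ ℓ ∧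
      ∀ y ∈ Metric.closedBall x1 ρ, ℓ y ≤ 0 ∧ -ℓ y * √‖y - a‖ ≤ Ck ∧ ∀ ξ, Gq J y ξ = 1 → 0 ≤ LL J ℓ y ξ ∧
        (Bk * ‖y - a‖ ^ 2 ≤ s → 1 / s ≤ LL J ℓ y ξ)) {A : Set E4} {c2 : ℝ} (hc2 : 0 < c2)
    (hA : ∀ x ∈ A, ∀ᶠ r in 𝓝[>] (0:ℝ), c2 * r ^ 2 ≤ ν.real (Prod.fst ⁻¹' Metric.closedBall x r))
    {ζ : E4 → ℝ} (hζ : ContDiff ℝ ∞ ζ) :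
    volume (ζ '' {x | x ∈ closure A ∧ b.W x = 0 ∧ x ∈ Metric.ball x1 (ρ / 4)}) = 0 := by
  obtain ⟨C, κ, p, t, P⟩ := pnE hJ b
  obtain ⟨g, hg, hg0, hgc, hgs, hg1⟩ := cut (isCompact_closedBall x1 (ρ / 2)) Metric.isOpen_ball
    (Metric.closedBall_subset_ball (by linarith : ρ / 2 < ρ))
  obtain ⟨c, c0, Λ, Λ0, ε, hε, main⟩ := E3 hJ h P hg hgc hgs hg0 hg1 hρ hs0 hCk hBk hk hc2 hA
  obtain ⟨iD, lD⟩ := h.D_lim hJ P hg hgc hgs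
  have z0 : ∫ q, LL J g q.1 q.2 ∂ν = 0 := by
    have := ((h.closed hJ).ibp hJ h.ae hg (contDiff_const (c := (1:ℝ))) hgc hgs).2.2.2.2
    simpa [LL_const] using this.symm
  rw [z0, mul_zero] at lD
  have D0 : ∀ n, 0 ≤ᵐ[ν] fun q => g q.1 * Dn J C p n q.1 q.2 := fun n => Eventually.of_forall fun q => by
    by_cases hq : q.1 ∈ tsupport g
    · refine mul_nonneg (hg0 _).1 ?_
      have h1 := P.LLp n _ (h.V (Metric.ball_subset_closedBall (hgs hq))) q.2
      have h2 := mul_nonneg (by positivity : 0 ≤ ((n:ℝ) + 1) / 2) (GG_nonneg (J := J) (p n) q.1 q.2)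
      unfold Dn; linarith
    · simp [image_eq_zero_of_notMem_tsupport hq]
  set φ : ℕ → E4 × E4 → ENNReal := fun n q => ENNReal.ofReal (g q.1 * Dn J C p n q.1 q.2) with hφ
  have hφm : ∀ n, Measurable (φ n) := fun n => by
    have c1 : Continuous fun q : E4 × E4 => g q.1 * Dn J C p n q.1 q.2 := by
      unfold Dn
      exact (hg.continuous.comp continuous_fst).mul ((LL_sm hJ (P.sm n)).continuous.add (continuous_const.mul (Gq_sm hJ).continuous))
    exact c1.measurable.ennreal_ofReal
  have hcB : MeasurableSet (Prod.fst ⁻¹' Metric.closedBall x1 ρ : Set (E4 × E4)) := fst_pre Metric.isClosed_closedBall.measurableSet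
  haveI : IsFiniteMeasure (ν.restrict (Prod.fst ⁻¹' Metric.closedBall x1 ρ)) := ⟨by rw [Measure.restrict_apply_univ]; exact h.fin⟩
  have hφ0 : ∀ n q, q.1 ∉ Metric.closedBall x1 ρ → φ n q = 0 := fun n q hq => by
    simp only [hφ]; rw [image_eq_zero_of_notMem_tsupport fun hn => hq (Metric.ball_subset_closedBall (hgs hn))]; simp
  obtain ⟨L, L0, hL⟩ := lip_ball hζ (‖x1‖ + ρ)
  have hsub : Metric.closedBall x1 ρ ⊆ Metric.closedBall 0 (‖x1‖ + ρ) := Metric.closedBall_subset_closedBall' (by simp [add_comm])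
  have L1 : 0 < L + 1 := by linarith
  refine nullT (ν := ν.restrict (Prod.fst ⁻¹' Metric.closedBall x1 ρ)) hφm ?_ (ζ := fun q => ζ q.1) (hζ.continuous.comp continuous_fst).measurable
    (M := |ζ x1| + L * ρ) ?_ (c := ENNReal.ofReal c) (by simpa using c0) ENNReal.ofReal_ne_top
    (Λ := ENNReal.ofReal Λ * ENNReal.ofReal √(L + 1)) (by finiteness) hε ?_
  · refine tendsto_of_tendsto_of_tendsto_of_le_of_le tendsto_const_nhds (by simpa using ENNReal.tendsto_ofReal lD) (fun n => bot_le) fun n => ?_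
    simp only
    rw [ofReal_integral_eq_lintegral_ofReal (iD n) (D0 n)]
    exact setLIntegral_le_lintegral _ _
  · rintro _ ⟨x, ⟨-, -, hx⟩, rfl⟩
    have hx := (Metric.mem_ball.1 hx).le
    have h1 := hL x (hsub (Metric.mem_closedBall.2 (by linarith))) x1 (hsub (Metric.mem_closedBall_self hρ.le))
    rw [← dist_eq_norm x x1, Real.norm_eq_abs] at h1
    have h2 : L * dist x x1 ≤ L * ρ := mul_le_mul_of_nonneg_left (by linarith) L0
    rw [mem_Icc, ← abs_le]
    have := abs_sub_abs_le_abs_sub (ζ x) (ζ x1); linarith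
  · rintro _ ⟨x, ⟨hxA, hxW, hx⟩, rfl⟩ n
    refine (main x hxA hxW hx n).trans (add_le_add_left ?_ _)
    rw [mul_assoc]
    refine mul_le_mul_right ?_ _
    have e : ∫⁻ q, φ n q * (ENNReal.ofReal √‖q.1 - x‖)⁻¹ ∂ν = ∫⁻ q in Prod.fst ⁻¹' Metric.closedBall x1 ρ, φ n q * (ENNReal.ofReal √‖q.1 - x‖)⁻¹ ∂ν := by
      rw [← lintegral_indicator hcB]
      congr 1; ext q
      by_cases hq : q ∈ (Prod.fst ⁻¹' Metric.closedBall x1 ρ : Set (E4 × E4))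
      · rw [indicator_of_mem hq]
      · rw [indicator_of_notMem hq, hφ0 n q hq, zero_mul]
    rw [e, ← lintegral_const_mul' _ _ ENNReal.ofReal_ne_top]
    refine lintegral_mono_ae ?_
    filter_upwards [ae_restrict_mem hcB] with q hq
    have hq : q.1 ∈ Metric.closedBall x1 ρ := hq
    rw [mul_left_comm]
    refine mul_le_mul_right ?_ _
    have hx' := (Metric.mem_ball.1 hx).le
    have h1 := hL q.1 (hsub hq) x (hsub (Metric.mem_closedBall.2 (by linarith)))
    have h2 : √|ζ q.1 - ζ x| ≤ √(L + 1) * √‖q.1 - x‖ := by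
      rw [← Real.sqrt_mul L1.le]
      refine Real.sqrt_le_sqrt (le_trans h1 (mul_le_mul_of_nonneg_right (by linarith) (norm_nonneg _)))
    have h3 := ENNReal.ofReal_le_ofReal h2
    rw [ENNReal.ofReal_mul (Real.sqrt_nonneg _)] at h3
    have hs : ENNReal.ofReal √(L + 1) ≠ 0 := by simpa using L1
    have h4 := mul_le_mul_right (ENNReal.inv_le_inv.2 h3) (ENNReal.ofReal √(L + 1))
    rwa [ENNReal.mul_inv (Or.inl hs) (Or.inl ENNReal.ofReal_ne_top), ← mul_assoc, ENNReal.mul_inv_cancel hs ENNReal.ofReal_ne_top, one_mul] at h4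

lemma area_lo (hJ : JS J) {b : ℕ → Box J} {K : Set E4} (hK : IsClosed K) (hc : K ⊆ ⋃ k, (b k).D) {S : Set E4} (hS : IsCompact S) :
    ∃ c2 > 0, ∀ x ∈ UK J K, x ∈ S → ∀ᶠ r in 𝓝[>] (0:ℝ), ENNReal.ofReal (c2 * r ^ 2) ≤ mm b K (Prod.fst ⁻¹' Metric.closedBall x r) := by
  obtain ⟨n0, n00, hn0⟩ := bdd2 hJ (Ψ := fun _ ξ => ‖ξ‖ ^ 2) (by fun_prop) (fun x ξ t => by rw [norm_smul, mul_pow, Real.norm_eq_abs, sq_abs]) hS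
  obtain ⟨D', hD'⟩ := hS.exists_bound_of_continuousOn hJ.sm.continuous.continuousOn
  set D := max D' 0 with hD
  have D0 : 0 ≤ D := le_max_right _ _
  refine ⟨2 / ((n0 + 1) * (2 + D) ^ 2), by positivity, fun x hxU hxS => ?_⟩
  obtain ⟨c, hcl, hxV, hxW⟩ := UK_iff.1 hxU
  obtain ⟨hz, hvz⟩ := c.back x hxV hxW
  set z := c.Z x with hzx
  have ha : 0 < ‖vx c.v z‖ := norm_pos_iff.2 (c.vx_ne hz)
  set a := ‖vx c.v z‖ with haa
  have hg : a ^ 2 ≤ (n0 + 1) * c.gz z := by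
    have h1 := hn0 x hxS (vx c.v z)
    rw [abs_of_nonneg (by positivity)] at h1
    have h2 := c.gz_pos hJ hz
    have h3 : Gq J x (vx c.v z) = c.gz z := by rw [Box.gz, hvz]
    rw [h3] at h1; nlinarith
  have hd : ∀ ζ, ‖fderiv ℝ c.v z ζ‖ ≤ (1 + D) * a * ‖ζ‖ := fun ζ => by
    rw [c.jh.fd_apply hz ζ]
    have h1 : ‖J (c.v z) (vx c.v z)‖ ≤ D * a := (le_trans (ContinuousLinearMap.le_opNorm _ _) (by
      rw [hvz]; exact mul_le_mul_of_nonneg_right ((hD' x hxS).trans (le_max_left _ _)) ha.le))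
    have h2 := norm_fst_le ζ
    have h3 := norm_snd_le ζ
    calc _ ≤ ‖ζ.1‖ * a + ‖ζ.2‖ * ‖J (c.v z) (vx c.v z)‖ := by
          refine (norm_add_le _ _).trans ?_; rw [norm_smul, norm_smul]
      _ ≤ ‖ζ‖ * a + ‖ζ‖ * (D * a) := by gcongr
      _ = _ := by ring
  have hdiff : HasFDerivAt c.v (fderiv ℝ c.v z) z := ((c.jh.at_ hz).differentiableAt (by simp)).hasFDerivAt
  have e1 := hdiff.isLittleO.def ha
  have e2 : ∀ᶠ w in 𝓝 z, c.gz z / 2 < c.gz w := ((c.gz_cont hJ).continuousAt (c.jh.op.mem_nhds hz)).eventually (lt_mem_nhds (by have := c.gz_pos hJ hz; linarith))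
  obtain ⟨δ, δ0, hδ⟩ := Metric.eventually_nhds_iff_ball.1 ((e1.and e2).and (c.jh.op.mem_nhds hz))
  have hE : 0 < (2 + D) * a := by positivity
  filter_upwards [Ioo_mem_nhdsGT (mul_pos hE δ0)] with r hr
  set s := r / ((2 + D) * a) with hs
  have s0 : 0 < s := div_pos hr.1 hE
  have sδ : s < δ := by rw [hs, div_lt_iff₀ hE, mul_comm]; exact hr.2
  have hX : MeasurableSet (Metric.closedBall x r ∩ c.D) := Metric.isClosed_closedBall.measurableSet.inter c.D_meas
  have key := mm_box hJ hK hc c hX inter_subset_right (inter_subset_right.trans fun y hy => UK_iff.2 ⟨c, hcl, hy⟩)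
    (Ψ := fun _ => 1) measurable_const (fun _ _ _ _ _ => rfl)
  rw [c.am_lint hJ hX measurable_const] at key
  simp only [lintegral_one, Measure.restrict_apply_univ, mul_one] at key
  have hsub : Metric.closedBall z s ⊆ c.pre (Metric.closedBall x r ∩ c.D) := fun w hw => by
    obtain ⟨⟨h1, -⟩, h3⟩ := hδ w (Metric.closedBall_subset_ball sδ hw)
    refine ⟨h3, ?_, c.mV w h3, c.wv w h3⟩
    rw [Metric.mem_closedBall, dist_eq_norm] at hw
    rw [Metric.mem_closedBall, dist_eq_norm, ← hvz]
    calc ‖c.v w - c.v z‖ ≤ ‖c.v w - c.v z - fderiv ℝ c.v z (w - z)‖ + ‖fderiv ℝ c.v z (w - z)‖ := norm_le_norm_sub_add _ _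
      _ ≤ a * ‖w - z‖ + (1 + D) * a * ‖w - z‖ := add_le_add h1 (hd _)
      _ = (2 + D) * a * ‖w - z‖ := by ring
      _ ≤ (2 + D) * a * s := by gcongr
      _ = r := by rw [hs]; field_simp
  have hvol : volume (Metric.closedBall z s) = ENNReal.ofReal ((2 * s) ^ 2) := by
    rw [show z = (z.1, z.2) from rfl, ← closedBall_prod_same, Measure.volume_eq_prod, Measure.prod_prod, Real.volume_closedBall, Real.volume_closedBall,
      ← ENNReal.ofReal_mul (by positivity), sq]
  calc ENNReal.ofReal (2 / ((n0 + 1) * (2 + D) ^ 2) * r ^ 2) ≤ ENNReal.ofReal (c.gz z / 2 * (2 * s) ^ 2) := by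
        refine ENNReal.ofReal_le_ofReal ?_
        have : c.gz z / 2 * (2 * s) ^ 2 = 2 / ((n0 + 1) * (2 + D) ^ 2) * r ^ 2 * ((n0 + 1) * c.gz z / a ^ 2) := by
          rw [hs]; field_simp
        rw [this]
        exact le_mul_of_one_le_right (by positivity) ((one_le_div (by positivity)).2 hg)
    _ = ENNReal.ofReal (c.gz z / 2) * volume (Metric.closedBall z s) := by
        rw [hvol, ENNReal.ofReal_mul (by have := c.gz_pos hJ hz; positivity)]
    _ = ∫⁻ w in Metric.closedBall z s, ENNReal.ofReal (c.gz z / 2) := by rw [setLIntegral_const]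
    _ ≤ ∫⁻ w in Metric.closedBall z s, ENNReal.ofReal (c.gz w) := setLIntegral_mono' Metric.isClosed_closedBall.measurableSet fun w hw =>
        ENNReal.ofReal_le_ofReal (hδ w (Metric.closedBall_subset_ball sδ hw)).1.2.le
    _ ≤ ∫⁻ w in c.pre (Metric.closedBall x r ∩ c.D), ENNReal.ofReal (c.gz w) := lintegral_mono_set hsub
    _ = mm b K (Prod.fst ⁻¹' (Metric.closedBall x r ∩ c.D)) := key.symm
    _ ≤ _ := measure_mono (preimage_mono inter_subset_left)

lemma square_aux {T T' E : Set E2} (hT : IsOpen T) (hT' : IsOpen T') (hd : Disjoint T T') {z : E2} {η : ℝ} (hη : 0 < η)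
    (hc : Metric.closedBall z η ⊆ T ∪ T' ∪ E) (h1 : volume (Prod.fst '' (E ∩ Metric.closedBall z η)) = 0) {t : ℝ} (ht : t ∈ Metric.closedBall z.2 η)
    (hl : (fun s : ℝ => (s, t)) '' Metric.closedBall z.1 η ⊆ T) : volume (Metric.closedBall z η \ T) = 0 := by
  have hb : Metric.closedBall z η = Metric.closedBall z.1 η ×ˢ Metric.closedBall z.2 η := (closedBall_prod_same z.1 z.2 η).symm
  refine measure_mono_null (t := (Prod.fst '' (E ∩ Metric.closedBall z η)) ×ˢ univ) (fun w hw => ⟨?_, trivial⟩) (by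
    rw [Measure.volume_eq_prod, Measure.prod_prod, h1, zero_mul])
  by_contra hn
  have hw' := hw.1
  rw [hb] at hw'
  have hv : (fun s : ℝ => (w.1, s)) '' Metric.closedBall z.2 η ⊆ T ∪ T' := by
    rintro _ ⟨s, hs, rfl⟩
    have hm : (w.1, s) ∈ Metric.closedBall z η := by rw [hb]; exact ⟨hw'.1, hs⟩
    exact (hc hm).resolve_right fun hE => hn ⟨_, ⟨hE, hm⟩, rfl⟩
  have hp : IsPreconnected ((fun s : ℝ => (w.1, s)) '' Metric.closedBall z.2 η) :=
    ((convex_closedBall z.2 η).isPreconnected).image _ (by fun_prop)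
  exact hw.2 (hp.subset_left_of_subset_union hT hT' hd hv ⟨(w.1, t), ⟨t, ht, rfl⟩, hl ⟨w.1, hw'.1, rfl⟩⟩ ⟨w.2, hw'.2, rfl⟩)

lemma square {T T' E : Set E2} (hT : IsOpen T) (hT' : IsOpen T') (hd : Disjoint T T') {z : E2} {η : ℝ} (hη : 0 < η)
    (hc : Metric.closedBall z η ⊆ T ∪ T' ∪ E) (h1 : volume (Prod.fst '' (E ∩ Metric.closedBall z η)) = 0)
    (h2 : volume (Prod.snd '' (E ∩ Metric.closedBall z η)) = 0) :
    volume (Metric.closedBall z η \ T) = 0 ∨ volume (Metric.closedBall z η \ T') = 0 := by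
  have hb : Metric.closedBall z η = Metric.closedBall z.1 η ×ˢ Metric.closedBall z.2 η := (closedBall_prod_same z.1 z.2 η).symm
  obtain ⟨t, ht, hn⟩ : ∃ t ∈ Metric.closedBall z.2 η, t ∉ Prod.snd '' (E ∩ Metric.closedBall z η) := by
    by_contra! h
    have := measure_mono_null h h2
    rw [Real.volume_closedBall, ENNReal.ofReal_eq_zero] at this; linarith
  have hv : (fun s : ℝ => (s, t)) '' Metric.closedBall z.1 η ⊆ T ∪ T' := by
    rintro _ ⟨s, hs, rfl⟩
    have hm : (s, t) ∈ Metric.closedBall z η := by rw [hb]; exact ⟨hs, ht⟩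
    exact (hc hm).resolve_right fun hE => hn ⟨_, ⟨hE, hm⟩, rfl⟩
  have hp : IsPreconnected ((fun s : ℝ => (s, t)) '' Metric.closedBall z.1 η) := ((convex_closedBall z.1 η).isPreconnected).image _ (by fun_prop)
  rcases isPreconnected_iff_subset_of_disjoint.1 hp T T' hT hT' hv (by rw [hd.inter_eq, inter_empty]) with h | h
  · exact Or.inl (square_aux hT hT' hd hη hc h1 ht h)
  · exact Or.inr (square_aux hT' hT hd.symm hη (by rwa [union_comm T' T]) h1 ht h)

lemma E4b (hJ : JS J) {bb : ℕ → Box J} {K : Set E4} (hK : IsClosed K) (hL : LMP J K) (hc : K ⊆ ⋃ k, (bb k).D)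
    (b : Box J) {x1 : E4} {ρ : ℝ} (hρ : 0 < ρ) (hV : Metric.closedBall x1 ρ ⊆ b.V) (hx1 : b.W x1 = 0) {A : Set E4}
    (hA : A = UK J K ∩ {x | b.W x ≠ 0} ∩ Metric.ball x1 ρ)
    (hn : ∀ ζ : E4 → ℝ, ContDiff ℝ ∞ ζ → volume (ζ '' {x | x ∈ closure A ∧ b.W x = 0 ∧ x ∈ Metric.ball x1 (ρ / 4)}) = 0) :
    ∃ η > 0, Metric.closedBall (b.Z x1) η ⊆ b.Ω ∧
      (volume (Metric.closedBall (b.Z x1) η \ b.v ⁻¹' UK J K) = 0 ∨ volume (Metric.closedBall (b.Z x1) η \ b.v ⁻¹' Kᶜ) = 0) := by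
  obtain ⟨hz, hvz⟩ := b.back x1 (hV (Metric.mem_closedBall_self hρ.le)) hx1
  have hO : IsOpen (b.Ω ∩ b.v ⁻¹' Metric.ball x1 (ρ / 4)) := b.v_cont.isOpen_inter_preimage b.jh.op Metric.isOpen_ball
  obtain ⟨η, η0, hη⟩ := Metric.nhds_basis_closedBall.mem_iff.1 (hO.mem_nhds ⟨hz, by rw [mem_preimage, hvz]; exact Metric.mem_ball_self (by positivity)⟩)
  refine ⟨η, η0, fun w hw => (hη hw).1, ?_⟩
  set N : Set E4 := {x | ∀ᶠ y in 𝓝 x, y ∈ K ↔ b.W y = 0} with hN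
  have hNo : IsOpen N := isOpen_setOf_eventually_nhds
  set T := b.Ω ∩ b.v ⁻¹' N with hT
  set T' := b.Ω ∩ b.v ⁻¹' Kᶜ with hT'
  set E := b.v ⁻¹' closure A with hE
  have hp : ∀ i : E2 → ℝ, ContDiff ℝ ∞ i → volume (i '' (E ∩ Metric.closedBall (b.Z x1) η)) = 0 := fun i hi => by
    refine measure_mono_null ?_ (hn (fun x => i (b.Z x)) (hi.comp b.Zs))
    rintro _ ⟨w, ⟨hwE, hw⟩, rfl⟩
    obtain ⟨hw1, hw2⟩ := hη hw
    exact ⟨b.v w, ⟨hwE, b.wv w hw1, hw2⟩, by simp only [b.zv w hw1]⟩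
  have hTU : T ⊆ b.v ⁻¹' UK J K := fun w hw => by
    obtain ⟨O, hO2, hOo, hwO⟩ := eventually_nhds_iff.1 hw.2
    exact UK_iff.2 ⟨b.sub O hOo, fun y hy => hO2 y hy.2, ⟨b.mV w hw.1, hwO⟩, b.wv w hw.1⟩
  have := square (T := T) (T' := T') (E := E) (b.v_cont.isOpen_inter_preimage b.jh.op hNo) (b.v_cont.isOpen_inter_preimage b.jh.op hK.isOpen_compl)
    (Set.disjoint_left.2 fun w hw hw' => hw'.2 (hTU hw).1) η0 (fun w hw => ?_) (hp _ contDiff_fst) (hp _ contDiff_snd)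
  · exact this.imp (measure_mono_null (diff_subset_diff_right hTU)) (measure_mono_null (diff_subset_diff_right inter_subset_right))
  obtain ⟨hw1, hw2⟩ := hη hw
  by_cases hwE : b.v w ∈ closure A
  · exact Or.inr hwE
  by_cases hwK : b.v w ∈ K
  swap
  · exact Or.inl (Or.inr ⟨hw1, hwK⟩)
  refine Or.inl (Or.inl ⟨hw1, ?_⟩)
  set O : Set E4 := (closure A)ᶜ ∩ Metric.ball x1 ρ with hOd
  have hOo : IsOpen O := isClosed_closure.isOpen_compl.inter Metric.isOpen_ball
  have hwO : b.v w ∈ O := ⟨hwE, Metric.ball_subset_ball (by linarith) hw2⟩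
  have hUO : UK J K ∩ O ⊆ {x | b.W x = 0} := fun y hy => by
    by_contra hy0
    exact hy.2.1 (subset_closure (hA ▸ ⟨⟨hy.1, hy0⟩, hy.2.2⟩))
  have hKO : K ∩ O ⊆ {x | b.W x = 0} := fun y hy => by
    have h1 : y ∈ closure (UK J K ∩ O) := by
      have := hOo.closure_inter (s := UK J K) ⟨UK_dense hJ hK hL hc hy.1, hy.2⟩
      exact this
    exact (closure_minimal hUO (isClosed_eq b.Ws.continuous continuous_const)) h1
  obtain ⟨O', hO', hwO', hcl⟩ := clean_of hJ (b.sub O hOo) hK hL (fun y hy => hKO ⟨hy.1, hy.2.2⟩) (z := w) ⟨hw1, hwO⟩ hwK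
  exact Filter.mem_of_superset (((b.sub O hOo).sub O' hO').opV.mem_nhds ⟨⟨b.mV w hw1, hwO⟩, hwO'⟩) fun y hy => hcl y hy

lemma E4c (hJ : JS J) {bb : ℕ → Box J} {K : Set E4} (hK : IsClosed K) (hc : K ⊆ ⋃ k, (bb k).D) (b : Box J) {x1 : E4} {ρ : ℝ} (hρ : 0 < ρ)
    (h : Mo b ((mm bb K).restrict (Prod.fst ⁻¹' {x | b.W x ≠ 0})) x1 ρ) {η : ℝ} (hη : 0 < η) (hs : Metric.closedBall (b.Z x1) η ⊆ b.Ω)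
    (hq : volume (Metric.closedBall (b.Z x1) η \ b.v ⁻¹' UK J K) = 0 ∨ volume (Metric.closedBall (b.Z x1) η \ b.v ⁻¹' Kᶜ) = 0) :
    ∃ O, IsOpen O ∧ x1 ∈ O ∧ CL J (mm bb K) O := by
  have hae := mm_ae hJ bb hK
  have hWm : MeasurableSet {x : E4 | b.W x ≠ 0} := (isOpen_ne_fun b.Ws.continuous continuous_const).measurableSet
  have hXm : MeasurableSet (UK J K ∩ b.D) := (UK_meas hK).inter b.D_meas
  set O := Metric.ball x1 ρ ∩ b.Z ⁻¹' Metric.ball (b.Z x1) η with hO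
  have hOV : O ⊆ b.V := fun y hy => h.V (Metric.ball_subset_closedBall hy.1)
  have fin : ∀ S ⊆ O, IsCompact S → mm bb K (Prod.fst ⁻¹' S) < ⊤ := fun S hS hSc => by
    have h1 := h.fin
    rw [Measure.restrict_apply' (fst_pre hWm)] at h1
    have h2 := mm_fin hJ hK hc b (X := S ∩ (UK J K ∩ b.D)) (hSc.measurableSet.inter hXm) (fun y hy => hy.2.2) (fun y hy => hy.2.1) hSc (hS.trans hOV) inter_subset_left
    refine lt_of_le_of_lt ((measure_mono_ae ?_).trans (measure_union_le _ _)) (ENNReal.add_lt_top.2 ⟨h1, h2⟩)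
    filter_upwards [hae] with q hq hqS
    have hqS : q.1 ∈ S := hqS
    by_cases hw : b.W q.1 = 0
    · exact Or.inr ⟨hqS, hq.1, hOV (hS hqS), hw⟩
    · exact Or.inl ⟨Metric.ball_subset_closedBall (hS hqS).1, hw⟩
  refine ⟨O, Metric.isOpen_ball.inter (Metric.isOpen_ball.preimage b.Zs.continuous), ⟨Metric.mem_ball_self hρ, Metric.mem_ball_self hη⟩, fin,
    fun α hα hαc hαs => ?_⟩
  have hint := dd_int hJ (hae.mono fun q hq => hq.2) fin hα hαc hαs
  rw [← integral_add_compl (fst_pre hWm) hint, (h.closed hJ).cl α hα hαc (hαs.trans inter_subset_left), zero_add]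
  have e1 : ∫ q in (Prod.fst ⁻¹' {x | b.W x ≠ 0})ᶜ, dd J α q.1 q.2 ∂mm bb K = ∫ q in Prod.fst ⁻¹' (UK J K ∩ b.D), dd J α q.1 q.2 ∂mm bb K := by
    refine setIntegral_eq_of_subset_of_ae_diff_eq_zero (fst_pre hWm).compl.nullMeasurableSet (fun q hq hn => hn hq.2.2) ?_
    filter_upwards [hae] with q hq hqs
    refine dd_off (fun ht => hqs.2 ⟨hq.1, hOV (hαs ht), ?_⟩) _
    by_contra hw; exact hqs.1 hw
  rw [e1, mm_box_int hJ hK hc b hXm inter_subset_right inter_subset_left (dd_sm hJ hα).continuous.measurable (dd_Rot hJ α),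
    b.am_int hJ hXm (dd_sm hJ hα).continuous.measurable fun x ξ t => dd_sc hJ α x ξ t]
  have f0 : ∀ z ∈ b.Ω, z ∉ Metric.closedBall (b.Z x1) η → dd J α (b.v z) (vx b.v z) = 0 := fun z hz hn => dd_off (fun ht => hn (by
    have := (hαs ht).2
    rw [mem_preimage, b.zv z hz] at this
    exact Metric.ball_subset_closedBall this)) _
  rcases hq with hq | hq
  · rw [← stokes b hα hαc (hαs.trans hOV)]
    refine (setIntegral_eq_of_subset_of_ae_diff_eq_zero b.jh.op.measurableSet.nullMeasurableSet inter_subset_left ?_).symm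
    filter_upwards [compl_mem_ae_iff.2 hq] with z hz hzs
    refine f0 z hzs.1 fun hzc => hzs.2 ⟨hzs.1, ?_, b.mV z hzs.1, b.wv z hzs.1⟩
    by_contra hn; exact hz ⟨hzc, hn⟩
  · refine integral_eq_zero_of_ae ((ae_restrict_iff' (b.pre_meas hJ hXm)).2 ?_)
    filter_upwards [compl_mem_ae_iff.2 hq] with z hz hzs
    exact f0 z hzs.1 fun hzc => hz ⟨hzc, fun hn => hn hzs.2.1.1⟩

lemma local_good (hJ : JS J) {bb : ℕ → Box J} {K : Set E4} (hK : IsClosed K) (hL : LMP J K) (hc : K ⊆ ⋃ k, (bb k).D)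
    {b : Box J} {N : Set E4} {x1 : E4} {f : E4 → ℝ} {r ε c : ℝ} (h : Cf b (mm bb K) N x1 f r ε c) (hx1 : b.W x1 = 0) :
    ∃ O, IsOpen O ∧ x1 ∈ O ∧ CL J (mm bb K) O := by
  obtain ⟨ρ1, ρ10, hρr, hN, hfin⟩ := h.step2 hJ
  obtain ⟨ρ0, s0, Ck, Bk, ρ00, hs0, hCk, hBk, hk⟩ := kern hJ x1
  have hWo : IsOpen {x : E4 | b.W x ≠ 0} := isOpen_ne_fun b.Ws.continuous continuous_const
  have hWm := fst_pre hWo.measurableSet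
  obtain ⟨ρ, hρ, le1, le0⟩ : ∃ ρ > 0, ρ ≤ ρ1 ∧ ρ ≤ ρ0 := ⟨min ρ1 ρ0, lt_min ρ10 ρ00, min_le_left _ _, min_le_right _ _⟩
  have s1 := Metric.closedBall_subset_closedBall (x := x1) le1
  have s2 := Metric.closedBall_subset_closedBall (x := x1) le0
  have hV : Metric.closedBall x1 ρ ⊆ b.V := (Metric.closedBall_subset_closedBall (by have := h.r0; linarith)).trans h.V
  have hsN : Metric.ball x1 ρ ∩ {y | b.W y ≠ 0} ⊆ Nᶜ := fun y hy hyN => hy.2 (hN y (s1 (Metric.ball_subset_closedBall hy.1)) hyN)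
  have mo : Mo b ((mm bb K).restrict (Prod.fst ⁻¹' {x | b.W x ≠ 0})) x1 ρ := by
    refine ⟨ae_restrict_of_ae h.ae, ae_restrict_mem hWm, ?_, ⟨fun S hS hSc => ?_, fun α hα hαc hαs => ?_⟩, hV⟩
    · rw [Measure.restrict_apply' hWm]
      refine lt_of_le_of_lt (measure_mono ?_) hfin
      exact fun q hq => ⟨s1 hq.1, hq.2⟩
    · exact lt_of_le_of_lt (Measure.restrict_apply_le _ _) (h.cl.fin S (hS.trans hsN) hSc)
    · rw [setIntegral_eq_integral_of_forall_compl_eq_zero (s := Prod.fst ⁻¹' {x : E4 | b.W x ≠ 0}) (f := fun q : E4 × E4 => dd J α q.1 q.2)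
        fun q hq => dd_off (fun ht => hq (hαs ht).2) _]
      exact h.cl.cl α hα hαc (hαs.trans hsN)
  obtain ⟨c2, c20, har⟩ := area_lo hJ hK hc (isCompact_closedBall x1 ρ)
  have hA : ∀ x ∈ UK J K ∩ {x | b.W x ≠ 0} ∩ Metric.ball x1 ρ, ∀ᶠ r in 𝓝[>] (0:ℝ),
      c2 * r ^ 2 ≤ ((mm bb K).restrict (Prod.fst ⁻¹' {x | b.W x ≠ 0})).real (Prod.fst ⁻¹' Metric.closedBall x r) := by
    rintro x ⟨⟨hxU, hxW⟩, hxb⟩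
    obtain ⟨d, d0, hd⟩ := Metric.isOpen_iff.1 (hWo.inter Metric.isOpen_ball) x ⟨hxW, hxb⟩
    filter_upwards [har x hxU (Metric.ball_subset_closedBall hxb), Ioo_mem_nhdsGT d0] with r hr hrd
    have hsub := (Metric.closedBall_subset_ball hrd.2).trans hd
    have hne := (lt_of_le_of_lt (measure_mono (preimage_mono fun y hy => Metric.ball_subset_closedBall (hsub hy).2)) mo.fin).ne
    rw [Measure.real, ← ENNReal.ofReal_le_iff_le_toReal hne, Measure.restrict_apply' hWm]
    exact hr.trans (measure_mono fun q hq => ⟨hq, (hsub hq).1⟩)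
  obtain ⟨η, η0, h1, h2⟩ := E4b hJ hK hL hc b hρ hV hx1 rfl fun ζ hζ => E4a hJ mo hρ hs0 hCk hBk (fun a ha s hs hs' => by
    obtain ⟨ℓ, h1, h2⟩ := hk a (s2 ha) s hs hs'
    exact ⟨ℓ, h1, fun y hy => h2 y (s2 hy)⟩) c20 hA hζ
  exact E4c hJ hK hc b hρ mo η0 h1 h2

lemma all_good (hJ : JS J) {bb : ℕ → Box J} {K : Set E4} (hK : IsCompact K) (hne : K.Nonempty) (hL : LMP J K) (hc : K ⊆ ⋃ k, (bb k).D)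
    (hmin : ∀ K' ⊆ K, IsCompact K' → K'.Nonempty → LMP J K' → K' = K) : CL J (mm bb K) univ := by
  have hae := mm_ae hJ bb hK.isClosed
  have hae' := hae.mono fun q hq => hq.2
  set G : Set E4 := {x | ∃ O, IsOpen O ∧ x ∈ O ∧ CL J (mm bb K) O} with hG
  have hGo : IsOpen G := isOpen_iff_forall_mem_open.2 fun x ⟨O, h1, h2, h3⟩ => ⟨O, fun y hy => ⟨O, h1, hy, h3⟩, h1, h2⟩
  have hU : UK J K ⊆ G := fun x hx => by
    obtain ⟨c, hcl, hx⟩ := UK_iff.1 hx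
    exact ⟨c.V, c.opV, hx.1, CL_clean hJ hK.isClosed hc c hcl⟩
  have hKc : Kᶜ ⊆ G := fun x hx => by
    refine ⟨Kᶜ, hK.isClosed.isOpen_compl, hx, fun S hS hSc => ?_, fun α hα hαc hαs => integral_eq_zero_of_ae ?_⟩
    · have h0 : mm bb K (Prod.fst ⁻¹' S) = 0 := measure_eq_zero_iff_ae_notMem.2 (hae.mono fun q hq hqS => hS hqS hq.1.1)
      rw [h0]; exact ENNReal.zero_lt_top
    · filter_upwards [hae] with q hq
      exact dd_off (fun ht => hαs ht hq.1.1) _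
  set N := K \ G with hN
  have hNc : IsCompact N := hK.diff hGo
  have hNG : Nᶜ ⊆ G := fun x hx => by
    by_cases hxK : x ∈ K
    · by_contra hxG; exact hx ⟨hxK, hxG⟩
    · exact hKc hxK
  have hclN : CL J (mm bb K) Nᶜ := CL.sUnion hJ hae' fun x hx => hNG hx
  have hNe : N = ∅ := by
    by_contra hn
    have hnn := nonempty_iff_ne_empty.2 hn
    have hLN : LMP J N := by
      by_contra hLN
      set F := closure {x ∈ N | ¬ LMPat J N x} with hF
      have hFN : F ⊆ N := closure_minimal (sep_subset _ _) hNc.isClosed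
      have hFne : (F ∩ univ).Nonempty := by
        simp only [LMP, not_forall] at hLN
        obtain ⟨x, hx, hx'⟩ := hLN
        exact ⟨x, subset_closure ⟨hx, hx'⟩, trivial⟩
      obtain ⟨c, -, ⟨y, hyF, hyV⟩, -, hcW⟩ := baire_box isClosed_closure isOpen_univ hFne (b := bb) (fun x hx => hc (hFN hx.1).1)
      obtain ⟨x1, hx1V, hx1N, hx1⟩ := mem_closure_iff.1 hyF c.V c.opV hyV
      obtain ⟨R, R0, hR⟩ := Metric.nhds_basis_closedBall.mem_iff.1 (c.opV.mem_nhds hx1V)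
      obtain ⟨f, hf, f0, ε, cc, r, hε, hcc, hr, hrR, h1, h2⟩ := strictify hJ hx1N hx1 R0
      have hV := (Metric.closedBall_subset_closedBall hrR).trans hR
      have cf : Cf c (mm bb K) N x1 f r ε cc := ⟨hNc.isClosed, hclN, hae', hV, hf, f0, hr, hε, hcc, h1, h2,
        step1 hJ c hNc hf hV hcc hε hr h1 h2 fun y hy hyN hyW => by
          by_contra hyL
          exact hyW (hcW ⟨subset_closure ⟨hyN, hyL⟩, hV hy⟩)⟩
      exact hx1N.2 (local_good hJ hK.isClosed hL hc cf (hcW ⟨subset_closure ⟨hx1N, hx1⟩, hx1V⟩))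
    have hNK := hmin N diff_subset hNc hnn hLN
    have hUe : (UK J K).Nonempty := closure_nonempty_iff.1 (hne.mono (UK_dense hJ hK.isClosed hL hc))
    obtain ⟨x, hx⟩ := hUe
    exact (hNK ▸ hx.1 : x ∈ N).2 (hU hx)
  rwa [hNe, compl_empty] at hclN

def lam : E4 → E4 →L[ℝ] ℝ := fun x => x 0 • (EuclideanSpace.proj 1 : E4 →L[ℝ] ℝ) + x 2 • (EuclideanSpace.proj 3 : E4 →L[ℝ] ℝ)

lemma lam_sm : ContDiff ℝ ∞ lam := by unfold lam; fun_prop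

lemma lam_dd (hJ : JS J) (x ξ : E4) : dd J lam x ξ = Gq J x ξ := by
  set L : E4 →L[ℝ] E4 →L[ℝ] ℝ := (EuclideanSpace.proj 0 : E4 →L[ℝ] ℝ).smulRight (EuclideanSpace.proj 1 : E4 →L[ℝ] ℝ) +
    (EuclideanSpace.proj 2 : E4 →L[ℝ] ℝ).smulRight (EuclideanSpace.proj 3 : E4 →L[ℝ] ℝ) with hL
  have e : lam = fun x => L x := by
    funext x; simp [lam, hL]
  rw [dd, e, L.fderiv, Gq, omega0]
  simp [hL]; ring

lemma final (hJ : JS J) {C : Set E4} (hne : C.Nonempty) (hC : IsCompact C)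
    (h : ∀ x ∈ C, ∃ V : Set E4, IsOpen V ∧ x ∈ V ∧ ∃ D v, JH J v D ∧ IsRegularOn v D ∧ C ∩ V = v '' D) : False := by
  obtain ⟨bb, hb⟩ := cover hJ h hne
  obtain ⟨K, hKC, hK, hKne, hL, hmin⟩ := exists_min hJ hC hne (C_LMP hJ h)
  have hc := hKC.trans hb
  have cl := all_good hJ hK hKne hL hc hmin
  have hae := mm_ae hJ bb hK.isClosed
  obtain ⟨χ, hχ, -, hχc, -, hχ1⟩ := cut hK isOpen_univ (subset_univ _)
  rw [eventually_nhdsSet_iff_forall] at hχ1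
  have key := cl.cl (fun x => χ x • lam x) (hχ.smul lam_sm) hχc.smul_right (subset_univ _)
  have e : ∫ q, dd J (fun x => χ x • lam x) q.1 q.2 ∂mm bb K = ∫ q, (1:ℝ) ∂mm bb K := by
    refine integral_congr_ae ?_
    filter_upwards [hae] with q hq
    have h1 : (fun x => χ x • lam x) =ᶠ[𝓝 q.1] lam := by
      filter_upwards [hχ1 _ hq.1.1] with y hy; rw [hy, one_smul]
    have h2 : dd J (fun x => χ x • lam x) q.1 q.2 = dd J lam q.1 q.2 := by
      rw [dd, dd, h1.fderiv_eq]
    rw [h2, lam_dd hJ, hq.2]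
  have fin : mm bb K univ < ⊤ := by
    refine lt_of_le_of_lt (measure_mono_ae ?_) (cl.fin K (subset_univ _) hK)
    filter_upwards [hae] with q hq _; exact hq.1.1
  rw [e, integral_const, smul_eq_mul, mul_one, Measure.real, ENNReal.toReal_eq_zero_iff] at key
  have h0 := key.resolve_right fin.ne
  obtain ⟨c2, c20, har⟩ := area_lo hJ hK.isClosed hc hK
  obtain ⟨x, hx⟩ : (UK J K).Nonempty := closure_nonempty_iff.1 (hKne.mono (UK_dense hJ hK.isClosed hL hc))
  obtain ⟨r, hr, hr0⟩ := ((har x hx hx.1).and self_mem_nhdsWithin).exists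
  have := hr.trans (measure_mono (subset_univ _))
  rw [h0, nonpos_iff_eq_zero, ENNReal.ofReal_eq_zero] at this
  have hr0 : 0 < r := hr0
  exact absurd this (not_le.2 (by positivity))

end MyDev

/-- There is no nonempty compact closed `J`-holomorphic curve without boundary in `ℝ⁴`
when the smooth almost complex structure `J` is adapted to the standard (exact) symplectic
form `ω₀`. -/
theorem no_compact_closed_J_curve
    (J : E4 → E4 →L[ℝ] E4)
    (hsmooth : ContDiff ℝ (⊤ : ℕ∞) J)
    (hsq : ∀ p, (J p).comp (J p) = - ContinuousLinearMap.id ℝ E4)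
    (hAd : IsAdapted J) :
    ¬ ∃ C : Set E4, C.Nonempty ∧ IsCompact C ∧
      ∀ x ∈ C, ∃ V : Set E4, IsOpen V ∧ x ∈ V ∧
        ∃ D v, IsJHolDisk J D v ∧ IsRegularOn v D ∧ Set.InjOn v D ∧
          C ∩ V = v '' D := by
  rintro ⟨C, hne, hC, h⟩
  have hJ : JS J := ⟨hsmooth, fun x ξ => by simpa using congrArg (fun L => L ξ) (hsq x), hAd.1, hAd.2⟩
  refine final hJ hne hC fun x hx => ?_
  obtain ⟨V, hV, hxV, D, v, hv, hr, -, hCV⟩ := h x hx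
  exact ⟨V, hV, hxV, D, v, ⟨hv.1, hv.2.2.1, fun z hz ζ => by simpa using congrArg (fun L => L ζ) (hv.2.2.2 z hz)⟩, hr, hCV⟩
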